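/- arXiv:2209.10812 — 5 statements merged into one kernel-verified Lean document; each statement's English description precedes it below -/
import Mathlib

section
/- Let Λ ⊆ ℝ^n be a discrete subgroup, π : ℝ^n → ℝ^n/Λ the quotient map, and X ⊆ ℝ^n a closed set. Then the topological closure of π(X) in ℝ^n/Λ equals π(X) ∪ Fl(X). -/
/-!
Setup: `Λ ⊆ ℝ^n` a discrete subgroup, `π : ℝ^n → ℝ^n/Λ` the quotient map (quotient
topology), and for `X ⊆ ℝ^n` the flow set
`Fl(X) := ⋂_{R>0} closure (π '' {x ∈ X : ‖x‖ ≥ R})` with `‖·‖` the Euclidean norm.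
-/

/-- The Euclidean norm on `ℝ^n` (modelled as `Fin n → ℝ`). -/
noncomputable def euclNorm {n : ℕ} (x : Fin n → ℝ) : ℝ :=
  Real.sqrt (∑ i, (x i) ^ 2)

/-- The quotient map `π : ℝ^n → ℝ^n/Λ`. -/
def qmap {n : ℕ} (Λ : AddSubgroup (Fin n → ℝ)) : (Fin n → ℝ) → (Fin n → ℝ) ⧸ Λ :=
  QuotientAddGroup.mk

/-- The flow set `Fl(X) = ⋂_{R>0} closure (π '' {x ∈ X : ‖x‖ ≥ R})`. -/
noncomputable def flowSet {n : ℕ} (Λ : AddSubgroup (Fin n → ℝ)) (X : Set (Fin n → ℝ)) :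
    Set ((Fin n → ℝ) ⧸ Λ) :=
  ⋂ R > (0 : ℝ), closure (qmap Λ '' {x | x ∈ X ∧ R ≤ euclNorm x})

/-- For `Λ ⊆ ℝ^n` a discrete subgroup and `X ⊆ ℝ^n` closed,
`closure (π '' X) = π '' X ∪ Fl(X)`. -/
theorem stmt5 {n : ℕ} (Λ : AddSubgroup (Fin n → ℝ)) (hΛ : DiscreteTopology Λ)
    (X : Set (Fin n → ℝ)) (hX : IsClosed X) :
    closure (qmap Λ '' X) = qmap Λ '' X ∪ flowSet Λ X := by
  have hcl : IsClosed (Λ : Set (Fin n → ℝ)) := AddSubgroup.isClosed_of_discrete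
  have hq : Continuous (qmap Λ) := continuous_quotient_mk'
  apply Set.Subset.antisymm
  · intro y hy
    by_cases hf : y ∈ flowSet Λ X
    · exact Or.inr hf
    left
    simp only [flowSet, Set.mem_iInter, not_forall] at hf
    obtain ⟨R, hR, hyR⟩ := hf
    have hnc : Continuous (euclNorm : (Fin n → ℝ) → ℝ) := by
      unfold euclNorm
      fun_prop
    have hK : IsCompact {x | x ∈ X ∧ euclNorm x ≤ R} := by
      refine (isCompact_closedBall (0 : Fin n → ℝ) R).of_isClosed_subset
        (hX.inter (isClosed_le hnc continuous_const)) ?_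
      rintro x ⟨-, hx⟩
      rw [mem_closedBall_zero_iff, pi_norm_le_iff_of_nonneg hR.le]
      intro i
      refine le_trans ?_ hx
      rw [Real.norm_eq_abs]
      apply Real.abs_le_sqrt
      exact Finset.single_le_sum (f := fun i => (x i) ^ 2) (fun j _ => sq_nonneg _)
        (Finset.mem_univ i)
    have hKc : IsClosed (qmap Λ '' {x | x ∈ X ∧ euclNorm x ≤ R}) := (hK.image hq).isClosed
    have hXe : X = {x | x ∈ X ∧ euclNorm x ≤ R} ∪ {x | x ∈ X ∧ R ≤ euclNorm x} := by
      ext x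
      have := le_total (euclNorm x) R
      simp only [Set.mem_union, Set.mem_setOf_eq]
      tauto
    rw [hXe, Set.image_union, closure_union, hKc.closure_eq] at hy
    rcases hy with hy | hy
    · exact Set.image_mono (fun x hx => hx.1) hy
    · exact absurd hy hyR
  · refine Set.union_subset subset_closure ?_
    intro y hy
    simp only [flowSet, Set.mem_iInter] at hy
    exact closure_mono (Set.image_mono (fun x hx => hx.1)) (hy 1 one_pos)
end

section
/- Let L be a finite-dimensional real vector space and Γ ⊆ L a lattice (a discrete subgroup whose ℝ-linear span equals L). Then the torus L/Γ has only countably many closed subgroups. -/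
open Filter Topology in
/-- A closed subgroup `M` agrees near `0` with a linear subspace `V` contained in it. -/
theorem aux_local_subspace {L : Type*} [NormedAddCommGroup L] [NormedSpace ℝ L]
    [FiniteDimensional ℝ L] (M : AddSubgroup L) (hM : IsClosed (M : Set L)) :
    ∃ V : Submodule ℝ L, (∀ v ∈ V, v ∈ M) ∧ ∃ ε : ℝ, 0 < ε ∧ ∀ m ∈ M, ‖m‖ < ε → m ∈ V := by
  let V : Submodule ℝ L :=
    { carrier := {v | ∀ t : ℝ, t • v ∈ M}
      add_mem' := fun {a b} ha hb t => by
        rw [smul_add]; exact M.add_mem (ha t) (hb t)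
      zero_mem' := fun t => by rw [smul_zero]; exact M.zero_mem
      smul_mem' := fun c x hx t => by rw [smul_smul]; exact hx (t * c) }
  have hVM : ∀ v ∈ V, v ∈ M := fun v hv => by simpa using hv 1
  refine ⟨V, hVM, ?_⟩
  by_contra! hcon
  obtain ⟨W, hW⟩ := Submodule.exists_isCompl V
  obtain ⟨P, hPW, hPV⟩ : ∃ P : L →ₗ[ℝ] L, (∀ x, P x ∈ W) ∧ ∀ x, x - P x ∈ V := by
    refine ⟨W.subtype ∘ₗ W.projectionOnto V hW.symm, fun x => by simp, fun x => ?_⟩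
    have h : x - (W.subtype ∘ₗ W.projectionOnto V hW.symm) x
        ∈ LinearMap.ker (W.projectionOnto V hW.symm) := by
      rw [LinearMap.mem_ker, map_sub, sub_eq_zero]
      exact (Submodule.projectionOnto_apply_left hW.symm _).symm
    rwa [Submodule.ker_projectionOnto hW.symm] at h
  have hPc : Continuous P := P.continuous_of_finiteDimensional
  choose m hmM hmε hmV using fun n : ℕ => hcon (1 / ((n : ℝ) + 1)) (by positivity)
  have hm0 : Tendsto m atTop (𝓝 0) :=
    squeeze_zero_norm (fun n => (hmε n).le) tendsto_one_div_add_atTop_nhds_zero_nat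
  let w : ℕ → L := fun n => P (m n)
  have hw0 : Tendsto w atTop (𝓝 0) := by
    have := (hPc.tendsto 0).comp hm0
    rwa [map_zero] at this
  have hwM : ∀ n, w n ∈ M := fun n => by
    have := M.sub_mem (hmM n) (hVM _ (hPV (m n)))
    simpa [w] using this
  have hwne : ∀ n, w n ≠ 0 := fun n h => by
    have := hPV (m n)
    have h' : P (m n) = 0 := h
    rw [h', sub_zero] at this
    exact hmV n this
  have hwn : ∀ n, 0 < ‖w n‖ := fun n => norm_pos_iff.2 (hwne n)
  let u : ℕ → L := fun n => ‖w n‖⁻¹ • w n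
  have hus : ∀ n, u n ∈ Metric.sphere (0 : L) 1 := fun n => by
    simp [u, norm_smul, (hwn n).ne']
  haveI : ProperSpace L := FiniteDimensional.proper ℝ L
  obtain ⟨a, ha, φ, hφ, hlim⟩ := (isCompact_sphere (0 : L) 1).tendsto_subseq hus
  have haW : a ∈ W :=
    W.closed_of_finiteDimensional.mem_of_tendsto hlim
      (Eventually.of_forall fun n => W.smul_mem _ (hPW _))
  have haV : a ∈ V := by
    intro t
    have hn0 : Tendsto (fun n => ‖w (φ n)‖) atTop (𝓝 0) := by
      have := (hw0.comp hφ.tendsto_atTop).norm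
      simpa using this
    have hfl : Tendsto (fun n => (⌊t / ‖w (φ n)‖⌋ : ℝ) * ‖w (φ n)‖) atTop (𝓝 t) := by
      have hlow : Tendsto (fun n => t - ‖w (φ n)‖) atTop (𝓝 t) := by
        simpa using hn0.const_sub t
      refine tendsto_of_tendsto_of_tendsto_of_le_of_le hlow tendsto_const_nhds ?_ ?_
      · intro n
        have h1 := Int.sub_one_lt_floor (t / ‖w (φ n)‖)
        have h2 := mul_le_mul_of_nonneg_right h1.le (hwn (φ n)).le
        rw [sub_mul, div_mul_cancel₀ _ (hwn (φ n)).ne', one_mul] at h2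
        exact h2
      · intro n
        have h1 := Int.floor_le (t / ‖w (φ n)‖)
        have h2 := mul_le_mul_of_nonneg_right h1 (hwn (φ n)).le
        rw [div_mul_cancel₀ _ (hwn (φ n)).ne'] at h2
        exact h2
    refine hM.mem_of_tendsto (hfl.smul hlim) (Eventually.of_forall fun n => ?_)
    have : ((⌊t / ‖w (φ n)‖⌋ : ℝ) * ‖w (φ n)‖) • (u ∘ φ) n = ⌊t / ‖w (φ n)‖⌋ • w (φ n) := by
      simp only [u, Function.comp]
      rw [smul_smul, mul_assoc, mul_inv_cancel₀ (hwn (φ n)).ne', mul_one, Int.cast_smul_eq_zsmul]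
    simp only [this]
    exact M.zsmul_mem (hwM _) _
  have : a = 0 := (Submodule.disjoint_def.1 hW.disjoint) a haV haW
  rw [this] at ha
  simp at ha

/-- A subgroup that stays in a small neighbourhood of `M` is contained in `M`. -/
theorem aux_no_small {L : Type*} [NormedAddCommGroup L] [NormedSpace ℝ L]
    [FiniteDimensional ℝ L] (M K : AddSubgroup L) (V : Submodule ℝ L)
    (hVM : ∀ v ∈ V, v ∈ M) (ε : ℝ) (hV : ∀ m ∈ M, ‖m‖ < ε → m ∈ V)
    (hK : ∀ k ∈ K, ∃ m ∈ M, ‖k - m‖ < ε / 3) : K ≤ M := by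
  intro k hk
  choose m hmM hm using fun n : ℕ => hK (n • k) (K.nsmul_mem hk n)
  have key : ∀ n : ℕ, (n : ℝ) • (k - m 1) - (n • k - m n) ∈ V := by
    intro n
    induction n with
    | zero =>
      refine hV _ ?_ ?_
      · simpa using hmM 0
      · have := hm 0
        have h0 := norm_nonneg (m 0)
        simp at this ⊢
        linarith
    | succ n ih =>
      have hstep : (n • k - m n) + (k - m 1) - ((n + 1) • k - m (n + 1)) ∈ V := by
        refine hV _ ?_ ?_
        · have : (n • k - m n) + (k - m 1) - ((n + 1) • k - m (n + 1))
              = m (n + 1) - m n - m 1 := by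
            rw [add_smul, one_smul]; abel
          rw [this]
          exact M.sub_mem (M.sub_mem (hmM _) (hmM _)) (hmM _)
        · have h1 := norm_sub_le ((n • k - m n) + (k - m 1)) ((n + 1) • k - m (n + 1))
          have h2 := norm_add_le (n • k - m n) (k - m 1)
          have h3 := hm 1
          rw [one_smul] at h3
          linarith [hm n, hm (n + 1)]
      have := V.add_mem ih hstep
      convert this using 1
      push_cast
      rw [add_smul, one_smul]
      abel
  have hb : k - m 1 ∈ V := by
    have hcl : IsClosed (V : Set L) := V.closed_of_finiteDimensional
    have hlim : Filter.Tendsto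
        (fun n : ℕ => (k - m 1) - ((n : ℝ) + 1)⁻¹ • ((n + 1) • k - m (n + 1)))
        Filter.atTop (nhds (k - m 1)) := by
      have hz : Filter.Tendsto (fun n : ℕ => ((n : ℝ) + 1)⁻¹ • ((n + 1) • k - m (n + 1)))
          Filter.atTop (nhds 0) := by
        refine squeeze_zero_norm (a := fun n : ℕ => (1 / ((n : ℝ) + 1)) * (ε / 3)) ?_ ?_
        · intro n
          rw [norm_smul, Real.norm_of_nonneg (by positivity), one_div]
          exact mul_le_mul_of_nonneg_left (hm (n + 1)).le (by positivity)
        · simpa using (tendsto_one_div_add_atTop_nhds_zero_nat (𝕜 := ℝ)).mul_const (ε / 3)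
      simpa using hz.const_sub (k - m 1)
    refine hcl.mem_of_tendsto hlim (Filter.Eventually.of_forall fun n => ?_)
    have h1 := V.smul_mem ((n : ℝ) + 1)⁻¹ (key (n + 1))
    have hne : (n : ℝ) + 1 ≠ 0 := by positivity
    push_cast at h1
    rw [smul_sub, smul_smul, inv_mul_cancel₀ hne, one_smul] at h1
    exact h1
  have := M.add_mem (hVM _ hb) (hmM 1)
  simpa using this

/-- A subgroup spanning `L` is cobounded. -/
theorem aux_cobounded {L : Type*} [NormedAddCommGroup L] [NormedSpace ℝ L]
    [FiniteDimensional ℝ L] (Γ : AddSubgroup L)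
    (hspan : Submodule.span ℝ (Γ : Set L) = ⊤) :
    ∃ C : ℝ, ∀ x : L, ∃ g ∈ Γ, ‖x - g‖ ≤ C := by
  classical
  obtain ⟨s, hsΓ, hs, hli⟩ := exists_linearIndependent ℝ (Γ : Set L)
  have hfin : Finite s := hli.finite
  haveI : Fintype s := Fintype.ofFinite s
  let b : Module.Basis s ℝ L := Module.Basis.mk hli (by
    rw [Subtype.range_coe, hs, hspan])
  refine ⟨∑ i, ‖b i‖, fun x => ⟨ZSpan.floor b x, ?_, ZSpan.norm_fract_le b x⟩⟩
  have h1 : Submodule.span ℤ (Set.range b) ≤ Γ.toIntSubmodule := by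
    rw [Submodule.span_le]
    rintro _ ⟨i, rfl⟩
    simp only [b, Module.Basis.mk_apply]
    exact hsΓ i.2
  exact h1 (ZSpan.floor b x).2

/-- Let `L` be a finite-dimensional real vector space and `Γ ⊆ L` a
lattice (a discrete subgroup whose `ℝ`-linear span is all of `L`). Then the torus `L/Γ`
has only countably many closed subgroups. -/
theorem stmt9 (L : Type*) [NormedAddCommGroup L] [NormedSpace ℝ L]
    [FiniteDimensional ℝ L] (Γ : AddSubgroup L) (hΓ : DiscreteTopology Γ)
    (hspan : Submodule.span ℝ (Γ : Set L) = ⊤) :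
    {H : AddSubgroup (L ⧸ Γ) | IsClosed (H : Set (L ⧸ Γ))}.Countable := by
  classical
  haveI : ProperSpace L := FiniteDimensional.proper ℝ L
  obtain ⟨C, hC⟩ := aux_cobounded Γ hspan
  let p : AddSubgroup (L ⧸ Γ) → AddSubgroup L := fun H => H.comap (QuotientAddGroup.mk' Γ)
  have hpinj : Function.Injective p :=
    AddSubgroup.comap_injective (QuotientAddGroup.mk'_surjective Γ)
  have hpΓ : ∀ H, Γ ≤ p H := fun H g hg => by
    have : (QuotientAddGroup.mk' Γ) g = 0 := by simpa using hg
    simp only [p, AddSubgroup.mem_comap, this, H.zero_mem]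
  let S : ℕ → Set (AddSubgroup (L ⧸ Γ)) := fun n => {H | ∃ V : Submodule ℝ L,
    (∀ v ∈ V, v ∈ p H) ∧ ∀ m ∈ p H, ‖m‖ < 1 / ((n : ℝ) + 1) → m ∈ V}
  have hS : ∀ n, (S n).Countable := by
    intro n
    have hε : (0 : ℝ) < 1 / ((n : ℝ) + 1) := by positivity
    generalize hεd : 1 / ((n : ℝ) + 1) = ε at hε
    obtain ⟨F, -, hFfin, hF⟩ := (isCompact_closedBall (0 : L) C).finite_cover_balls
      (show (0 : ℝ) < ε / 6 by positivity)
    haveI : Finite F := hFfin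
    let code : AddSubgroup (L ⧸ Γ) → Set F := fun H => {f | ∃ m ∈ p H, dist m (f : L) < ε / 6}
    have hle : ∀ H ∈ S n, ∀ H', code H' = code H → p H' ≤ p H := by
      rintro H ⟨V, hV1, hV2⟩ H' hcode
      rw [hεd] at hV2
      refine aux_no_small (p H) (p H') V hV1 ε hV2 fun k hk => ?_
      obtain ⟨g, hg, hgC⟩ := hC k
      have hmem : k - g ∈ Metric.closedBall (0 : L) C := by simpa using hgC
      obtain ⟨f, hf, hfd⟩ := Set.mem_iUnion₂.1 (hF hmem)
      have h1 : (⟨f, hf⟩ : F) ∈ code H' :=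
        ⟨k - g, (p H').sub_mem hk (hpΓ H' hg), hfd⟩
      rw [hcode] at h1
      obtain ⟨m, hm, hmd⟩ := h1
      refine ⟨m + g, (p H).add_mem hm (hpΓ H hg), ?_⟩
      have h2 := dist_triangle_right (k - g) m f
      have h3 : dist (k - g) f < ε / 6 := hfd
      have h4 : k - (m + g) = (k - g) - m := by abel
      rw [h4, ← dist_eq_norm]
      simp only at hmd
      linarith
    have hinj : Set.InjOn code (S n) := fun H hH H' hH' h =>
      hpinj (le_antisymm (hle H' hH' H h) (hle H hH H' h.symm))
    exact Set.countable_of_injective_of_countable_image hinj (Set.to_countable _)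
  refine (Set.countable_iUnion hS).mono fun H hH => ?_
  have hcl : IsClosed ((p H : AddSubgroup L) : Set L) :=
    IsClosed.preimage (f := (QuotientAddGroup.mk : L → L ⧸ Γ)) QuotientAddGroup.continuous_mk hH
  obtain ⟨V, hV1, ε, hε, hV2⟩ := aux_local_subspace (p H) hcl
  obtain ⟨n, hn⟩ := exists_nat_one_div_lt hε
  exact Set.mem_iUnion.2 ⟨n, V, hV1, fun m hm hmn => hV2 m hm (hmn.trans hn)⟩
end

section
/- Let Λ ⊆ ℝ^n be a discrete subgroup with ℝ-linear span L, and π : ℝ^n → ℝ^n/Λ the quotient map. Let T ⊆ GrAff_j(ℝ^n) be a neat semialgebraic family of j-dimensional affine flats of ℝ^n with L(A) ⊆ L for all A ∈ T, where j ≥ 1. Then the set {A ∈ T : closure(π(L(A))) = closure(π(L(T)))} is topologically dense in T. -/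
/-!
The affine Grassmannian `GrAff_j(ℝ^n)` of `j`-dimensional affine flats of `ℝ^n` is
modelled, as a real algebraic subset of `ℝ^{n² + n}`, by pairs `(M, b)` where `M` is a
symmetric idempotent `n × n` matrix of rank `j` (the orthogonal projection onto the
direction of the flat) and `b ∈ ℝ^n` with `M b = 0` (the base point of the flat closest
to the origin); the corresponding flat is `b + range M`, with direction `L(A) = range M`.
-/

/-- Index type for `ℝ^{n² + n}`, the ambient space of the affine Grassmannian. -/
abbrev GAIdx (n : ℕ) := (Fin n × Fin n) ⊕ Fin n

/-- The matrix component of a point of `ℝ^{n²+n}`. -/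
def matOf {n : ℕ} (x : GAIdx n → ℝ) : Matrix (Fin n) (Fin n) ℝ :=
  Matrix.of fun i k => x (Sum.inl (i, k))

/-- The vector component of a point of `ℝ^{n²+n}`. -/
def vecOf {n : ℕ} (x : GAIdx n → ℝ) : Fin n → ℝ := fun i => x (Sum.inr i)

/-- The direction `L(A)` of the flat encoded by `x`, i.e. the column space of its
matrix component. -/
def dirOf {n : ℕ} (x : GAIdx n → ℝ) : Submodule ℝ (Fin n → ℝ) :=
  LinearMap.range (matOf x).mulVecLin

/-- The affine Grassmannian `GrAff_j(ℝ^n)` as a real algebraic subset of `ℝ^{n²+n}`: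
symmetric idempotent matrices of rank `j` together with a base point orthogonal to the
column space. -/
def grAff (n j : ℕ) : Set (GAIdx n → ℝ) :=
  {x | (matOf x).transpose = matOf x ∧ matOf x * matOf x = matOf x ∧
       Module.finrank ℝ (dirOf x) = j ∧ (matOf x).mulVec (vecOf x) = 0}

/-- The affine flat `A ⊆ ℝ^n` encoded by `x`. -/
def flatOf {n : ℕ} (x : GAIdx n → ℝ) : Set (Fin n → ℝ) :=
  {p | ∃ w ∈ dirOf x, p = vecOf x + w}

/-- `L(T)`: the linear span of the directions of the members of a family `T` of
flats. -/
def dirSpan {n : ℕ} (T : Set (GAIdx n → ℝ)) : Submodule ℝ (Fin n → ℝ) :=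
  ⨆ x ∈ T, dirOf x

/-- `S ⊆ ℝ^ι` is semialgebraic: a finite union of sets
`{x : p(x) = 0, q₁(x) > 0, …, q_r(x) > 0}` for real polynomials `p, q_j`. -/
def IsSemialgebraic {ι : Type*} [Fintype ι] (S : Set (ι → ℝ)) : Prop :=
  ∃ (k : ℕ) (p : Fin k → MvPolynomial ι ℝ) (r : Fin k → ℕ)
    (q : (a : Fin k) → Fin (r a) → MvPolynomial ι ℝ),
    S = ⋃ a, {x | MvPolynomial.eval x (p a) = 0 ∧
                  ∀ b, 0 < MvPolynomial.eval x (q a b)}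

/-- `S` is a smooth (`C^∞`) embedded submanifold of the normed space `E`: near each of
its points it is the zero set of a smooth submersion. -/
def IsSmoothSubmanifold {E : Type*} [NormedAddCommGroup E] [NormedSpace ℝ E]
    (S : Set E) : Prop :=
  ∀ x ∈ S, ∃ (d : ℕ) (U : Set E) (f : E → (Fin d → ℝ)), IsOpen U ∧ x ∈ U ∧
    ContDiffOn ℝ (⊤ : ℕ∞) f U ∧ (∀ y ∈ U, Function.Surjective (fderiv ℝ f y)) ∧
    S ∩ U = {y ∈ U | f y = 0}

/-- A neat semialgebraic family of `j`-dimensional flats: a semialgebraic subset of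
`GrAff_j(ℝ^n)` which is a connected smooth submanifold and satisfies `L(U) = L(T)` for
every nonempty (relatively) open subset `U ⊆ T`. -/
def IsNeatFamily (n j : ℕ) (T : Set (GAIdx n → ℝ)) : Prop :=
  T ⊆ grAff n j ∧ IsSemialgebraic T ∧ IsConnected T ∧ IsSmoothSubmanifold T ∧
  ∀ V : Set (GAIdx n → ℝ), IsOpen V → (T ∩ V).Nonempty →
    dirSpan (T ∩ V) = dirSpan T

section Helpers
open Filter Topology Set

/-- The largest linear subspace contained in a closed subgroup. -/
def linPart {E : Type*} [NormedAddCommGroup E] [NormedSpace ℝ E] (H : AddSubgroup E) :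
    Submodule ℝ E where
  carrier := {v | ∀ t : ℝ, t • v ∈ H}
  add_mem' := by
    intro a b ha hb t
    rw [smul_add]
    exact H.add_mem (ha t) (hb t)
  zero_mem' := by intro t; rw [smul_zero]; exact H.zero_mem
  smul_mem' := by
    intro c x hx t
    rw [smul_smul]
    exact hx _

theorem linPart_disc {E : Type*} [NormedAddCommGroup E] [NormedSpace ℝ E]
    [FiniteDimensional ℝ E] (H : AddSubgroup E) (hH : IsClosed (H : Set E))
    (C : Submodule ℝ E) (hC : Disjoint (linPart H) C) :
    ∃ ε > 0, ∀ h ∈ H, h ∈ C → ‖h‖ < ε → h = 0 := by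
  by_contra hcon
  push Not at hcon
  have h1 : ∀ k : ℕ, ∃ h, h ∈ H ∧ h ∈ C ∧ ‖h‖ < 1 / ((k : ℝ) + 1) ∧ h ≠ 0 := by
    intro k
    obtain ⟨h, a, b, c, d⟩ := hcon (1 / ((k : ℝ) + 1)) (by positivity)
    exact ⟨h, a, b, c, d⟩
  choose h hhH hhC hhn hh0 using h1
  have hn0 : Tendsto (fun k => ‖h k‖) atTop (𝓝 0) :=
    squeeze_zero (fun k => norm_nonneg _) (fun k => (hhn k).le)
      tendsto_one_div_add_atTop_nhds_zero_nat
  have hpos : ∀ k, 0 < ‖h k‖ := fun k => norm_pos_iff.mpr (hh0 k)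
  have hmem : ∀ k, (‖h k‖⁻¹ • h k) ∈ Metric.sphere (0 : E) 1 := by
    intro k
    simp [norm_smul, (hpos k).ne']
  have : ProperSpace E := FiniteDimensional.proper ℝ E
  obtain ⟨u, hu, ψ, hψ, hlim⟩ := (isCompact_sphere (0 : E) 1).tendsto_subseq hmem
  have huC : u ∈ C := by
    have hCc : IsClosed (C : Set E) := C.closed_of_finiteDimensional
    exact hCc.mem_of_tendsto hlim (Eventually.of_forall fun k => C.smul_mem _ (hhC _))
  have huH : u ∈ linPart H := by
    intro t
    have hn0' := hn0.comp hψ.tendsto_atTop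
    have ht : Tendsto (fun k => (⌊t / ‖h (ψ k)‖⌋ : ℝ) * ‖h (ψ k)‖) atTop (𝓝 t) := by
      have hlow : Tendsto (fun k => t - ‖h (ψ k)‖) atTop (𝓝 t) := by
        simpa using tendsto_const_nhds.sub hn0'
      refine tendsto_of_tendsto_of_tendsto_of_le_of_le hlow tendsto_const_nhds ?_ ?_
      · intro k
        have hp := hpos (ψ k)
        have := Int.sub_one_lt_floor (t / ‖h (ψ k)‖)
        have h2 := mul_le_mul_of_nonneg_right this.le hp.le
        rw [sub_mul, div_mul_cancel₀ _ hp.ne', one_mul] at h2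
        exact h2
      · intro k
        have hp := hpos (ψ k)
        have := Int.floor_le (t / ‖h (ψ k)‖)
        have h2 := mul_le_mul_of_nonneg_right this hp.le
        rw [div_mul_cancel₀ _ hp.ne'] at h2
        exact h2
    have h3 := ht.smul hlim
    refine hH.mem_of_tendsto h3 (Eventually.of_forall fun k => ?_)
    have hp := hpos (ψ k)
    have : ((⌊t / ‖h (ψ k)‖⌋ : ℝ) * ‖h (ψ k)‖) • ((fun k => ‖h k‖⁻¹ • h k) ∘ ψ) k
        = ⌊t / ‖h (ψ k)‖⌋ • h (ψ k) := by
      simp only [Function.comp]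
      rw [smul_smul, mul_assoc, mul_inv_cancel₀ hp.ne', mul_one, Int.cast_smul_eq_zsmul]
    rw [this]
    exact H.zsmul_mem (hhH _) _
  have hu0 : u = 0 := by
    have := (Submodule.disjoint_def.mp hC) u huH huC
    exact this
  simp [hu0] at hu

theorem closed_subgroup_sep {E : Type*} [NormedAddCommGroup E] [NormedSpace ℝ E]
    [FiniteDimensional ℝ E] (H : AddSubgroup E) (hH : IsClosed (H : Set E))
    (v : E) (hv : v ∈ Submodule.span ℝ (H : Set E))
    (hφ : ∀ φ : E →ₗ[ℝ] ℝ, (∀ h ∈ H, ∃ m : ℤ, φ h = m) → φ v = 0) : v ∈ H := by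
  obtain ⟨C, hC⟩ := Submodule.exists_isCompl (linPart H)
  obtain ⟨ε, hε, hdisc⟩ := linPart_disc H hH C hC.disjoint
  -- projection onto C
  obtain ⟨p, hpC, hpd⟩ : ∃ p : E →ₗ[ℝ] E, (∀ x, p x ∈ C) ∧ ∀ x, x - p x ∈ linPart H := by
    have key : ∀ x : E, ∃ a ∈ C, x - a ∈ linPart H := by
      intro x
      have hx : x ∈ linPart H ⊔ C := by rw [hC.sup_eq_top]; trivial
      obtain ⟨y, hy, z, hz, rfl⟩ := Submodule.mem_sup.mp hx
      exact ⟨z, hz, by simpa using hy⟩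
    choose f hfC hfd using key
    have uniq : ∀ x y, x ∈ C → y ∈ C → x - y ∈ linPart H → x = y := by
      intro x y hx hy hxy
      exact sub_eq_zero.mp
        (Submodule.disjoint_def.mp hC.disjoint _ hxy (C.sub_mem hx hy))
    refine ⟨⟨⟨f, ?_⟩, ?_⟩, hfC, hfd⟩
    · intro x y
      refine uniq _ _ (hfC _) (C.add_mem (hfC _) (hfC _)) ?_
      have := (linPart H).sub_mem ((linPart H).add_mem (hfd x) (hfd y)) (hfd (x + y))
      convert this using 1
      abel
    · intro c x
      refine uniq _ _ (hfC _) (C.smul_mem _ (hfC _)) ?_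
      have := (linPart H).sub_mem ((linPart H).smul_mem c (hfd x)) (hfd (c • x))
      convert this using 1
      simp only [smul_sub, RingHom.id_apply]
      abel
  have hVH : ∀ x ∈ linPart H, x ∈ H := by
    intro x hx
    have := hx 1
    rwa [one_smul] at this
  have hpH : ∀ h ∈ H, p h ∈ H := by
    intro h hh
    have := H.sub_mem hh (hVH _ (hpd h))
    simpa using this
  set S : Set E := {x | x ∈ H ∧ x ∈ C} with hS
  let K : Submodule ℝ E := Submodule.span ℝ S
  have hpv : p v ∈ K := by
    have : Submodule.span ℝ (H : Set E) ≤ K.comap p := by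
      rw [Submodule.span_le]
      intro h hh
      exact Submodule.subset_span ⟨hpH h hh, hpC h⟩
    exact this hv
  let L₀ : Submodule ℤ K := (AddSubgroup.toIntSubmodule (H ⊓ C.toAddSubgroup)).comap
    (K.subtype.restrictScalars ℤ)
  have hmemL : ∀ x : K, x ∈ L₀ ↔ (x : E) ∈ S := by
    intro x
    exact Iff.rfl
  have : DiscreteTopology L₀ := by
    refine discreteTopology_iff_isOpen_singleton_zero.mpr
      ⟨Metric.ball 0 ε, Metric.isOpen_ball, ?_⟩
    ext x
    simp only [mem_preimage, mem_ball_zero_iff, mem_singleton_iff]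
    constructor
    · intro hx
      have hxS : ((x : K) : E) ∈ S := x.2
      have := hdisc _ hxS.1 hxS.2 hx
      exact Subtype.ext (Subtype.ext this)
    · rintro rfl
      simpa using hε
  have : IsZLattice ℝ L₀ := ⟨by
    rw [← (Submodule.map_injective_of_injective (Submodule.injective_subtype K)).eq_iff,
      Submodule.map_span, Submodule.map_top, Submodule.range_subtype]
    congr 1
    ext x
    constructor
    · rintro ⟨y, hy, rfl⟩
      exact hy
    · intro hx
      exact ⟨⟨x, Submodule.subset_span hx⟩, hx, rfl⟩⟩
  have : Module.Finite ℤ L₀ := ZLattice.module_finite ℝ L₀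
  have : Module.Free ℤ L₀ := ZLattice.module_free ℝ L₀
  let b := Module.Free.chooseBasis ℤ L₀
  let B := b.ofZLatticeBasis ℝ L₀
  have hpv0 : (⟨p v, hpv⟩ : K) = 0 := by
    apply B.ext_elem
    intro i
    obtain ⟨g, hg⟩ := LinearMap.exists_extend (B.coord i)
    have hgK : ∀ x : K, g x = B.repr x i := by
      intro x
      have := LinearMap.congr_fun hg x
      simpa using this
    have h1 := hφ (g ∘ₗ p) (by
      intro h hh
      have hS' : p h ∈ S := ⟨hpH h hh, hpC h⟩
      let y : L₀ := ⟨⟨p h, Submodule.subset_span hS'⟩, hS'⟩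
      refine ⟨b.repr y i, ?_⟩
      have h2 := hgK y
      rw [Module.Basis.ofZLatticeBasis_repr_apply] at h2
      exact h2)
    rw [← hgK]
    simpa using h1
  have : p v = 0 := congrArg Subtype.val hpv0
  have h2 := hpd v
  rw [this, sub_zero] at h2
  exact hVH v h2

theorem closure_sub_of_dual {n : ℕ} (Λ : AddSubgroup (Fin n → ℝ))
    (W V : Submodule ℝ (Fin n → ℝ))
    (hVL : V ≤ Submodule.span ℝ (Λ : Set (Fin n → ℝ)))
    (h : ∀ φ : (Fin n → ℝ) →ₗ[ℝ] ℝ, (∀ l ∈ Λ, ∃ m : ℤ, φ l = m) →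
      (∀ w ∈ W, φ w = 0) → ∀ v ∈ V, φ v = 0) :
    qmap Λ '' (V : Set (Fin n → ℝ)) ⊆ closure (qmap Λ '' (W : Set (Fin n → ℝ))) := by
  rintro _ ⟨v, hv, rfl⟩
  set H := (W.toAddSubgroup ⊔ Λ).topologicalClosure with hHdef
  have hle : W.toAddSubgroup ⊔ Λ ≤ H := AddSubgroup.le_topologicalClosure _
  have hWH : ∀ w ∈ W, w ∈ H := fun w hw =>
    hle ((le_sup_left : W.toAddSubgroup ≤ W.toAddSubgroup ⊔ Λ) hw)
  have hΛH : ∀ w ∈ Λ, w ∈ H := fun w hw =>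
    hle ((le_sup_right : Λ ≤ W.toAddSubgroup ⊔ Λ) hw)
  have hvH : v ∈ H := by
    refine closed_subgroup_sep H (AddSubgroup.isClosed_topologicalClosure _) v
      (Submodule.span_mono (fun l hl => hΛH l hl) (hVL hv)) ?_
    intro φ hφ
    refine h φ (fun l hl => hφ l (hΛH l hl)) ?_ v hv
    intro w hw
    by_contra hne
    obtain ⟨m, hm⟩ := hφ (((1 / 2 : ℝ) * (φ w)⁻¹) • w) (hWH _ (W.smul_mem _ hw))
    rw [map_smul, smul_eq_mul, mul_assoc, inv_mul_cancel₀ hne, mul_one] at hm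
    have h2 : (1 : ℝ) = ((2 * m : ℤ) : ℝ) := by push_cast; linarith
    have h3 : (1 : ℤ) = 2 * m := by exact_mod_cast h2
    omega
  have hcont : Continuous (qmap Λ) := continuous_quotient_mk'
  have hv' : v ∈ closure ((W.toAddSubgroup ⊔ Λ : AddSubgroup (Fin n → ℝ)) :
      Set (Fin n → ℝ)) := hvH
  refine closure_mono ?_ (image_closure_subset_closure_image hcont ⟨v, hv', rfl⟩)
  rintro _ ⟨y, hy, rfl⟩
  obtain ⟨w, hw, l, hl, rfl⟩ := AddSubgroup.mem_sup.mp hy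
  refine ⟨w, hw, ?_⟩
  refine QuotientAddGroup.eq.mpr ?_
  simpa using hl

theorem IsSmoothSubmanifold.isLocallyClosed {E : Type*} [NormedAddCommGroup E]
    [NormedSpace ℝ E] {S : Set E} (hS : IsSmoothSubmanifold S) : IsLocallyClosed S := by
  refine ((isLocallyClosed_tfae S).out 0 2).mpr ?_
  intro x hx
  obtain ⟨d, U, f, hU, hxU, hf, -, hSU⟩ := hS x hx
  refine ⟨U, hU.mem_nhds hxU, ?_⟩
  have hc : Continuous (U.domRestrict f) := continuousOn_iff_continuous_domRestrict.mp hf.continuousOn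
  have : (Subtype.val ⁻¹' S : Set U) = (U.domRestrict f) ⁻¹' {0} := by
    ext y
    have := Set.ext_iff.mp hSU y
    simp only [mem_inter_iff, y.2, and_true, mem_ofPred_eq, true_and] at this
    exact this
  rw [this]
  exact isClosed_singleton.preimage hc

theorem exists_countable_duals {n : ℕ} (Λ : AddSubgroup (Fin n → ℝ))
    (hΛ : DiscreteTopology Λ) :
    ∃ (k : ℕ) (F : (Fin k → ℤ) → ((Fin n → ℝ) →ₗ[ℝ] ℝ)),
      ∀ φ : (Fin n → ℝ) →ₗ[ℝ] ℝ, (∀ l ∈ Λ, ∃ m : ℤ, φ l = m) →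
        ∃ c, ∀ v ∈ Submodule.span ℝ (Λ : Set (Fin n → ℝ)), φ v = F c v := by
  classical
  have : DiscreteTopology (AddSubgroup.toIntSubmodule Λ) := hΛ
  have hfin : Module.Finite ℤ (AddSubgroup.toIntSubmodule Λ) := inferInstance
  obtain ⟨k, s, hs⟩ := Submodule.fg_iff_exists_fin_generating_family.mp
    (Module.Finite.iff_fg.mp hfin)
  have hsΛ : ∀ i, s i ∈ Λ := by
    intro i
    have : s i ∈ Submodule.span ℤ (range s) := Submodule.subset_span ⟨i, rfl⟩
    rw [hs] at this
    exact this
  let P : (Fin k → ℤ) → ((Fin n → ℝ) →ₗ[ℝ] ℝ) → Prop := fun c φ => ∀ i, φ (s i) = c i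
  refine ⟨k, fun c => if h : ∃ φ, P c φ then h.choose else 0, ?_⟩
  intro φ hφ
  choose c hc using fun i => hφ (s i) (hsΛ i)
  have hex : ∃ φ, P c φ := ⟨φ, hc⟩
  refine ⟨c, ?_⟩
  simp only [dif_pos hex]
  have hF := hex.choose_spec
  set ψ := hex.choose
  have hΛ' : ∀ l ∈ Λ, φ l = ψ l := by
    intro l hl
    have hl' : l ∈ Submodule.span ℤ (range s) := by rw [hs]; exact hl
    have : Submodule.span ℤ (range s) ≤ LinearMap.ker ((φ - ψ).restrictScalars ℤ) := by
      rw [Submodule.span_le]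
      rintro _ ⟨i, rfl⟩
      have := hF i
      simp [hc i, this]
    have := this hl'
    simpa [sub_eq_zero] using this
  intro v hv
  have : Submodule.span ℝ (Λ : Set (Fin n → ℝ)) ≤ LinearMap.ker (φ - ψ) := by
    rw [Submodule.span_le]
    intro l hl
    simp [hΛ' l hl]
  have := this hv
  simpa [sub_eq_zero] using this

theorem isClosed_dirOf_le_ker {n : ℕ} (φ : (Fin n → ℝ) →ₗ[ℝ] ℝ) :
    IsClosed {x : GAIdx n → ℝ | dirOf x ≤ LinearMap.ker φ} := by
  have : {x : GAIdx n → ℝ | dirOf x ≤ LinearMap.ker φ} =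
      ⋂ v : Fin n → ℝ, {x | φ ((matOf x).mulVec v) = 0} := by
    ext x
    simp only [mem_ofPred_eq, mem_iInter, dirOf]
    constructor
    · intro h v
      exact h ⟨v, rfl⟩
    · rintro h _ ⟨v, rfl⟩
      exact h v
  rw [this]
  refine isClosed_iInter fun v => isClosed_eq ?_ continuous_const
  have hφ : Continuous φ := φ.continuous_of_finiteDimensional
  refine hφ.comp ?_
  refine Continuous.matrix_mulVec ?_ continuous_const
  refine continuous_matrix fun i k => ?_
  exact continuous_apply _

end Helpers

/-- Let `Λ ⊆ ℝ^n` be a discrete subgroup with `ℝ`-linear span `L`,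
and `T` a neat semialgebraic family of `j`-dimensional affine flats of `ℝ^n` (`j ≥ 1`)
with `L(A) ⊆ L` for all `A ∈ T`.  Then
`{A ∈ T : closure (π (L(A))) = closure (π (L(T)))}` is topologically dense in `T`. -/
theorem stmt10 {n j : ℕ} (hj : 1 ≤ j)
    (Λ : AddSubgroup (Fin n → ℝ)) (hΛ : DiscreteTopology Λ)
    (T : Set (GAIdx n → ℝ)) (hT : IsNeatFamily n j T)
    (hL : ∀ x ∈ T, dirOf x ≤ Submodule.span ℝ (Λ : Set (Fin n → ℝ))) :
    T ⊆ closure {x | x ∈ T ∧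
      closure (qmap Λ '' (dirOf x : Set (Fin n → ℝ))) =
        closure (qmap Λ '' (dirSpan T : Set (Fin n → ℝ)))} := by
  classical
  obtain ⟨-, -, -, hsm, hneat⟩ := hT
  have : LocallyCompactSpace T := hsm.isLocallyClosed.locallyCompactSpace
  obtain ⟨k, F, hF⟩ := exists_countable_duals Λ hΛ
  have hVL : dirSpan T ≤ Submodule.span ℝ (Λ : Set (Fin n → ℝ)) := iSup₂_le hL
  let I := {c : Fin k → ℤ // ¬ dirSpan T ≤ LinearMap.ker (F c)}
  let O : I → Set T := fun c => {x : T | dirOf (x : GAIdx n → ℝ) ≤ LinearMap.ker (F c.1)}ᶜ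
  have hO : ∀ c, IsOpen (O c) := fun c =>
    ((isClosed_dirOf_le_ker (F c.1)).preimage continuous_subtype_val).isOpen_compl
  have hD : ∀ c, Dense (O c) := by
    intro c
    rw [← interior_eq_empty_iff_dense_compl]
    by_contra hne
    obtain ⟨x, hx⟩ := Set.nonempty_iff_ne_empty.mpr hne
    obtain ⟨U, hUsub, hUo, hxU⟩ := mem_interior.mp hx
    obtain ⟨V, hV, rfl⟩ := isOpen_induced_iff.mp hUo
    apply c.2
    refine (hneat V hV ⟨x, x.2, hxU⟩).symm.le.trans ?_
    refine iSup₂_le fun y hy => ?_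
    have hyV : (⟨y, hy.1⟩ : T) ∈ (Subtype.val ⁻¹' V : Set T) := hy.2
    have h1 := hUsub hyV
    rw [Set.mem_ofPred_eq] at h1
    exact h1
  have hdense : Dense (⋂ c, O c) := dense_iInter_of_isOpen hO hD
  intro x hx
  have hxc : (⟨x, hx⟩ : T) ∈ closure (⋂ c, O c) := hdense _
  have himg := image_closure_subset_closure_image continuous_subtype_val
    (Set.mem_image_of_mem Subtype.val hxc)
  refine closure_mono ?_ himg
  rintro _ ⟨y, hy, rfl⟩
  refine ⟨y.2, ?_⟩
  have hle : dirOf (y : GAIdx n → ℝ) ≤ dirSpan T := le_iSup₂_of_le (y : GAIdx n → ℝ) y.2 le_rfl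
  refine Set.Subset.antisymm (closure_mono (Set.image_mono hle)) ?_
  refine closure_minimal ?_ isClosed_closure
  refine closure_sub_of_dual Λ _ _ hVL ?_
  intro φ hφ hW v hv
  obtain ⟨c, hc⟩ := hF φ hφ
  rw [hc v (hVL hv)]
  by_contra hne
  have hcI : ¬ dirSpan T ≤ LinearMap.ker (F c) := fun h => hne (h hv)
  have hyO := Set.mem_iInter.mp hy ⟨c, hcI⟩
  apply hyO
  intro w hw
  show F c w = 0
  rw [← hc w (hVL (hle hw))]
  exact hW w hw
end

section
/- Let Λ ⊆ ℝ^n be a discrete subgroup with ℝ-linear span L, and π : ℝ^n → ℝ^n/Λ the quotient map. Let T ⊆ GrAff_j(ℝ^n) be a neat semialgebraic family of j-dimensional affine flats of ℝ^n with L(A) ⊆ L for all A ∈ T, where j ≥ 1. Then ⋃_{A∈T} π(A) is topologically dense in ⋃_{A∈T} π(A + L(T)) in ℝ^n/Λ. -/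
open scoped Pointwise

section Aux
open Topology Filter


lemma aux_discrete {E : Type*} [NormedAddCommGroup E] [NormedSpace ℝ E] [FiniteDimensional ℝ E]
    (D : Submodule ℤ E) [DiscreteTopology D] (v : E)
    (hv : v ∈ Submodule.span ℝ (D : Set E)) (hv0 : v ≠ 0) :
    ∃ φ : E →ₗ[ℝ] ℝ, (∀ d ∈ D, ∃ m : ℤ, φ d = m) ∧ φ v ≠ 0 := by
  set F := Submodule.span ℝ (D : Set E) with hF
  let L : Submodule ℤ F := ZLattice.comap ℝ D F.subtype
  have : DiscreteTopology L :=
    ZLattice.comap_discreteTopology ℝ D F.subtype.continuous_of_finiteDimensional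
      F.subtype_injective
  have : IsZLattice ℝ L := ⟨by
    rw [eq_top_iff]
    exact Submodule.span_span_coe_preimage.symm.le⟩
  have := ZLattice.module_finite ℝ L
  have := ZLattice.module_free ℝ L
  let b := Module.Free.chooseBasis ℤ L
  let B := b.ofZLatticeBasis ℝ L
  have hne : (⟨v, hv⟩ : F) ≠ 0 := by
    intro h; exact hv0 (congrArg Subtype.val h)
  obtain ⟨i, hi⟩ : ∃ i, B.coord i ⟨v, hv⟩ ≠ 0 := by
    by_contra hcon
    push Not at hcon
    exact hne (B.forall_coord_eq_zero_iff.1 hcon)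
  obtain ⟨φ, hφ⟩ := (B.coord i).exists_extend
  have hφ' : ∀ x : F, φ x = B.coord i x := fun x => by rw [← hφ]; rfl
  refine ⟨φ, ?_, ?_⟩
  · intro d hd
    have hdF : d ∈ F := Submodule.subset_span hd
    have hdL : (⟨d, hdF⟩ : F) ∈ L := hd
    refine ⟨b.repr ⟨_, hdL⟩ i, ?_⟩
    have := hφ' ⟨d, hdF⟩
    simp only at this
    rw [this]
    exact b.ofZLatticeBasis_repr_apply ℝ L ⟨_, hdL⟩ i
  · have := hφ' ⟨v, hv⟩
    simp only at this
    rwa [this]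

/-- If small nonzero elements of a closed subgroup exist, a limiting line is contained in it. -/
lemma aux_line {E : Type*} [NormedAddCommGroup E] [NormedSpace ℝ E] [FiniteDimensional ℝ E]
    (H : AddSubgroup E) (hH : IsClosed (H : Set E))
    (hsmall : ∀ ε > 0, ∃ h ∈ H, h ≠ 0 ∧ ‖h‖ < ε) :
    ∃ u : E, u ≠ 0 ∧ ∀ t : ℝ, t • u ∈ H := by
  have : ProperSpace E := FiniteDimensional.proper_real E
  choose h hmem hne hlt using fun k : ℕ => hsmall (1 / ((k : ℝ) + 1)) (by positivity)
  have hh0 : Tendsto (fun k => ‖h k‖) atTop (𝓝 0) :=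
    squeeze_zero (fun _ => norm_nonneg _) (fun k => (hlt k).le) tendsto_one_div_add_atTop_nhds_zero_nat
  have hpos : ∀ k, 0 < ‖h k‖ := fun k => norm_pos_iff.2 (hne k)
  obtain ⟨u, hu, g, hg, hlim⟩ := (isCompact_sphere (0 : E) 1).tendsto_subseq
    (x := fun k => ‖h k‖⁻¹ • h k) (fun k => by
      simp [norm_smul, (hpos k).ne'])
  refine ⟨u, ?_, ?_⟩
  · rintro rfl; simp at hu
  intro t
  have hcoef : Tendsto (fun k => (⌊t / ‖h (g k)‖⌋ : ℝ) * ‖h (g k)‖) atTop (𝓝 t) := by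
    have h1 : Tendsto (fun k => ‖h (g k)‖) atTop (𝓝 0) := hh0.comp hg.tendsto_atTop
    have h2 : Tendsto (fun k => t - ‖h (g k)‖) atTop (𝓝 t) := by
      simpa using tendsto_const_nhds.sub h1
    refine tendsto_of_tendsto_of_tendsto_of_le_of_le h2 tendsto_const_nhds ?_ ?_
    · intro k
      have hp := hpos (g k)
      have := Int.lt_floor_add_one (t / ‖h (g k)‖)
      rw [div_lt_iff₀ hp] at this
      simp only
      linarith
    · intro k
      have hp := hpos (g k)
      have := Int.floor_le (t / ‖h (g k)‖)
      rwa [le_div_iff₀ hp] at this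
  refine hH.mem_of_tendsto (hcoef.smul hlim) (Eventually.of_forall fun k => ?_)
  have : ((⌊t / ‖h (g k)‖⌋ : ℝ) * ‖h (g k)‖) • (‖h (g k)‖⁻¹ • h (g k))
      = ⌊t / ‖h (g k)‖⌋ • h (g k) := by
    rw [smul_smul, mul_assoc, mul_inv_cancel₀ (hpos _).ne', mul_one, Int.cast_smul_eq_zsmul]
  simp only [Function.comp]
  rw [this]
  exact H.zsmul_mem (hmem _) _

/-- The largest linear subspace in a closed subgroup. -/
def lineSub {E : Type*} [NormedAddCommGroup E] [NormedSpace ℝ E] (H : AddSubgroup E) :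
    Submodule ℝ E where
  carrier := {v | ∀ t : ℝ, t • v ∈ H}
  zero_mem' := fun t => by simp [H.zero_mem]
  add_mem' := fun ha hb t => by rw [smul_add]; exact H.add_mem (ha t) (hb t)
  smul_mem' := fun c v hv t => by rw [smul_smul]; exact hv _

lemma aux_closed {E : Type*} [NormedAddCommGroup E] [NormedSpace ℝ E] [FiniteDimensional ℝ E]
    (H : AddSubgroup E) (hH : IsClosed (H : Set E)) (v : E)
    (hv : v ∈ Submodule.span ℝ (H : Set E)) (hvH : v ∉ H) :
    ∃ φ : E →ₗ[ℝ] ℝ, (∀ d ∈ H, ∃ m : ℤ, φ d = m) ∧ (∀ w ∈ lineSub H, φ w = 0) ∧ φ v ≠ 0 := by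
  set W := lineSub H with hW
  have hWH : ∀ w ∈ W, w ∈ H := fun w hw => by simpa using hw 1
  obtain ⟨C, hC⟩ := W.exists_isCompl
  let D0 : AddSubgroup E := H ⊓ C.toAddSubgroup
  let D : Submodule ℤ E := AddSubgroup.toIntSubmodule D0
  have hD : ∀ d, d ∈ D ↔ d ∈ H ∧ d ∈ C := fun d => Iff.rfl
  have hclosed : IsClosed (D0 : Set E) := hH.inter C.closed_of_finiteDimensional
  have : DiscreteTopology D := by
    by_contra hnd
    have hsmall : ∀ ε > 0, ∃ h ∈ D0, h ≠ 0 ∧ ‖h‖ < ε := by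
      by_contra hcon
      push Not at hcon
      obtain ⟨ε, hε, hcon⟩ := hcon
      apply hnd
      apply discreteTopology_of_isOpen_singleton_zero
      rw [Metric.isOpen_singleton_iff]
      refine ⟨ε, hε, fun y hy => ?_⟩
      by_contra hy0
      have := hcon y y.2 (fun h => hy0 (Subtype.ext h))
      rw [dist_zero_right] at hy
      exact absurd hy (not_lt.2 this)
    obtain ⟨u, hu0, hu⟩ := aux_line D0 hclosed hsmall
    have h1 : u ∈ W := fun t => (hu t).1
    have h2 : u ∈ C := by simpa using (hu 1).2
    exact hu0 (Submodule.disjoint_def.1 hC.disjoint u h1 h2)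
  let p : E →ₗ[ℝ] E := C.subtype ∘ₗ C.projectionOnto W hC.symm
  have hp : ∀ x, x - p x ∈ W := fun x => by
    have h2 : C.projectionOnto W hC.symm (x - p x) = 0 := by
      rw [map_sub, sub_eq_zero]
      exact (Submodule.projectionOnto_apply_left hC.symm _).symm
    exact (Submodule.projectionOnto_apply_eq_zero_iff hC.symm).1 h2
  have hpC : ∀ x, p x ∈ C := fun x => Subtype.property _
  have hpW : ∀ x ∈ W, p x = 0 := fun x hx => by
    have h2 := (Submodule.projectionOnto_apply_eq_zero_iff hC.symm).2 hx
    simp [p, h2]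
  have hpD : ∀ x ∈ H, p x ∈ D := fun x hx => by
    refine (hD _).2 ⟨?_, hpC x⟩
    have := H.sub_mem hx (hWH _ (hp x))
    simpa using this
  have hpv : p v ∈ Submodule.span ℝ (D : Set E) := by
    have : p v ∈ (Submodule.span ℝ (H : Set E)).map p := ⟨v, hv, rfl⟩
    rw [Submodule.map_span] at this
    refine Submodule.span_mono ?_ this
    rintro _ ⟨x, hx, rfl⟩
    exact hpD x hx
  have hpv0 : p v ≠ 0 := fun h => by
    have := hp v
    rw [h, sub_zero] at this
    exact hvH (hWH _ this)
  obtain ⟨φ, h1, h2⟩ := aux_discrete D (p v) hpv hpv0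
  exact ⟨φ ∘ₗ p, fun d hd => h1 _ (hpD d hd), fun w hw => by simp [hpW w hw], h2⟩

lemma aux_baire {E : Type*} [NormedAddCommGroup E] [NormedSpace ℝ E] [FiniteDimensional ℝ E]
    (S : Set E) (hS : IsSmoothSubmanifold S) : BaireSpace S := by
  have : ProperSpace E := FiniteDimensional.proper_real E
  have hlc : IsLocallyClosed S := by
    refine ((isLocallyClosed_tfae S).out 0 2).2 ?_
    intro x hx
    obtain ⟨d, U, f, hU, hxU, hf, -, hEq⟩ := hS x hx
    refine ⟨U, hU.mem_nhds hxU, ?_⟩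
    have h1 : (Subtype.val ⁻¹' S : Set U) = (U.domRestrict f) ⁻¹' {0} := by
      ext ⟨y, hy⟩
      have : y ∈ S ∩ U ↔ y ∈ {y ∈ U | f y = 0} := by rw [hEq]
      simpa [hy] using this
    rw [h1]
    exact isClosed_singleton.preimage hf.continuousOn.domRestrict
  have : LocallyCompactSpace S := hlc.locallyCompactSpace
  infer_instance

/-- Countably many functionals suffice. -/
lemma aux_countable {E : Type*} [NormedAddCommGroup E] [NormedSpace ℝ E] [FiniteDimensional ℝ E]
    (Λ : Set E) : ∃ Φ : Set (E →ₗ[ℝ] ℝ), Φ.Countable ∧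
      ∀ φ : E →ₗ[ℝ] ℝ, (∀ l ∈ Λ, ∃ m : ℤ, φ l = m) →
        ∃ ψ ∈ Φ, ∀ v ∈ Submodule.span ℝ Λ, φ v = ψ v := by
  classical
  obtain ⟨b, hb, hspan, hli⟩ := exists_linearIndependent ℝ Λ
  have : Finite b := hli.finite
  let P : (b → ℤ) → (E →ₗ[ℝ] ℝ) → Prop := fun s φ => ∀ i : b, φ i = s i
  let F : (b → ℤ) → (E →ₗ[ℝ] ℝ) := fun s => if h : ∃ φ, P s φ then h.choose else 0
  refine ⟨Set.range F, Set.countable_range F, fun φ hφ => ?_⟩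
  choose s hs using fun i : b => hφ i (hb i.2)
  have hex : ∃ φ, P s φ := ⟨φ, hs⟩
  refine ⟨F s, ⟨s, rfl⟩, fun v hv => ?_⟩
  have hF : P s (F s) := by
    simp only [F, dif_pos hex]
    exact hex.choose_spec
  rw [← hspan] at hv
  refine LinearMap.eqOn_span (s := b) (f := φ) (g := F s) ?_ hv
  intro x hx
  exact (hs ⟨x, hx⟩).trans (hF ⟨x, hx⟩).symm

/-- Generic members of the family have no more integral relations than the whole family. -/
lemma aux_generic {n j : ℕ} (T : Set (GAIdx n → ℝ)) (hT : IsNeatFamily n j T)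
    (Φ : Set ((Fin n → ℝ) →ₗ[ℝ] ℝ)) (hΦ : Φ.Countable) :
    T ⊆ closure {x ∈ T | ∀ ψ ∈ Φ, dirOf x ≤ LinearMap.ker ψ → dirSpan T ≤ LinearMap.ker ψ} := by
  obtain ⟨-, -, -, hsm, hneat⟩ := hT
  have : BaireSpace T := aux_baire T hsm
  let Φ' : Set ((Fin n → ℝ) →ₗ[ℝ] ℝ) := {ψ ∈ Φ | ¬ dirSpan T ≤ LinearMap.ker ψ}
  have hΦ' : Φ'.Countable := hΦ.mono (Set.sep_subset _ _)
  have : Countable Φ' := hΦ'.to_subtype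
  have hker : ∀ (ψ : (Fin n → ℝ) →ₗ[ℝ] ℝ) (x : GAIdx n → ℝ),
      dirOf x ≤ LinearMap.ker ψ ↔ ∀ w : Fin n → ℝ, ψ ((matOf x).mulVec w) = 0 := by
    intro ψ x
    constructor
    · intro h w
      exact h ⟨w, rfl⟩
    · rintro h _ ⟨w, rfl⟩
      exact h w
  let G : Φ' → Set T := fun ψ => {x | ¬ dirOf x.1 ≤ LinearMap.ker ψ.1}
  have hGo : ∀ ψ, IsOpen (G ψ) := by
    intro ψ
    have : G ψ = (⋂ w : Fin n → ℝ, {x : T | ψ.1 ((matOf x.1).mulVec w) = 0})ᶜ := by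
      ext x
      simp only [G, hker, Set.mem_ofPred_eq, Set.mem_compl_iff, Set.mem_iInter]
    rw [this, isOpen_compl_iff]
    refine isClosed_iInter fun w => isClosed_eq ?_ continuous_const
    have h1 : Continuous ψ.1 := ψ.1.continuous_of_finiteDimensional
    refine h1.comp ?_
    refine Continuous.matrix_mulVec ?_ continuous_const
    refine continuous_matrix fun i k => ?_
    exact (continuous_apply (Sum.inl (i, k))).comp continuous_subtype_val
  have hGd : ∀ ψ, Dense (G ψ) := by
    intro ψ
    rw [dense_iff_inter_open]
    rintro _ ⟨V, hV, rfl⟩ ⟨x, hx⟩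
    by_contra hcon
    apply ψ.2.2
    rw [← hneat V hV ⟨x.1, x.2, hx⟩]
    refine iSup₂_le fun y hy => ?_
    by_contra hy2
    exact hcon ⟨⟨y, hy.1⟩, hy.2, hy2⟩
  have hd := dense_iInter_of_isOpen hGo hGd
  intro x hx
  have := hd ⟨x, hx⟩
  rw [closure_subtype] at this
  refine closure_mono ?_ this
  rintro _ ⟨y, hy, rfl⟩
  refine ⟨y.2, fun ψ hψ hle => ?_⟩
  by_contra hcon
  exact Set.mem_iInter.1 hy ⟨ψ, hψ, hcon⟩ hle

end Aux

/-- Let `Λ ⊆ ℝ^n` be a discrete subgroup with `ℝ`-linear span `L`,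
and `T` a neat semialgebraic family of `j`-dimensional affine flats of `ℝ^n` (`j ≥ 1`)
with `L(A) ⊆ L` for all `A ∈ T`.  Then `⋃_{A ∈ T} π(A)` is topologically dense in
`⋃_{A ∈ T} π(A + L(T))` in `ℝ^n/Λ`. -/
theorem stmt11 {n j : ℕ} (hj : 1 ≤ j)
    (Λ : AddSubgroup (Fin n → ℝ)) (hΛ : DiscreteTopology Λ)
    (T : Set (GAIdx n → ℝ)) (hT : IsNeatFamily n j T)
    (hL : ∀ x ∈ T, dirOf x ≤ Submodule.span ℝ (Λ : Set (Fin n → ℝ))) :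
    (⋃ x ∈ T, qmap Λ '' (flatOf x + (dirSpan T : Set (Fin n → ℝ)))) ⊆
      closure (⋃ x ∈ T, qmap Λ '' flatOf x) := by
  obtain ⟨Φ, hΦc, hΦ⟩ := aux_countable (Λ : Set (Fin n → ℝ))
  have hgen := aux_generic T hT Φ hΦc
  have hcont : Continuous (qmap Λ) := continuous_quotient_mk'
  have hdS : dirSpan T ≤ Submodule.span ℝ (Λ : Set (Fin n → ℝ)) := iSup₂_le hL
  set S : Set (Fin n → ℝ) := qmap Λ ⁻¹' (⋃ x ∈ T, qmap Λ '' flatOf x) with hS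
  have hSmem : ∀ x ∈ T, ∀ w ∈ dirOf x, ∀ l ∈ Λ, vecOf x + (w + l) ∈ S := by
    intro x hx w hw l hl
    refine Set.mem_iUnion₂.2 ⟨x, hx, vecOf x + w, ⟨w, hw, rfl⟩, ?_⟩
    refine QuotientAddGroup.eq.2 ?_
    have : -(vecOf x + w) + (vecOf x + (w + l)) = l := by abel
    rwa [this]
  -- generic members
  have hgood : ∀ x ∈ T, (∀ ψ ∈ Φ, dirOf x ≤ LinearMap.ker ψ → dirSpan T ≤ LinearMap.ker ψ) →
      ∀ v ∈ dirSpan T, vecOf x + v ∈ closure S := by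
    intro x hx hψ v hv
    let H0 : AddSubgroup (Fin n → ℝ) := (dirOf x).toAddSubgroup ⊔ Λ
    let H : AddSubgroup (Fin n → ℝ) := H0.topologicalClosure
    have hle : H0 ≤ H := H0.le_topologicalClosure
    have hΛH : ∀ l ∈ Λ, l ∈ H := fun l hl => hle ((le_sup_right : Λ ≤ H0) hl)
    have hdH : ∀ w ∈ dirOf x, w ∈ H :=
      fun w hw => hle ((le_sup_left : (dirOf x).toAddSubgroup ≤ H0) hw)
    have hvH : v ∈ H := by
      by_contra hvH
      obtain ⟨φ, h1, h2, h3⟩ := aux_closed H H0.isClosed_topologicalClosure v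
        (Submodule.span_mono hΛH (hdS hv)) hvH
      obtain ⟨ψ, hψΦ, hφψ⟩ := hΦ φ (fun l hl => h1 l (hΛH l hl))
      have hk : dirOf x ≤ LinearMap.ker ψ := by
        intro w hw
        rw [LinearMap.mem_ker, ← hφψ w (hL x hx hw)]
        exact h2 w fun t => hdH _ ((dirOf x).smul_mem t hw)
      have := hψ ψ hψΦ hk hv
      rw [LinearMap.mem_ker, ← hφψ v (hdS hv)] at this
      exact h3 this
    have hvc : v ∈ closure (H0 : Set (Fin n → ℝ)) := hvH
    refine map_mem_closure (f := fun u => vecOf x + u) (by fun_prop) hvc ?_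
    intro u hu
    obtain ⟨w, hw, l, hl, rfl⟩ := AddSubgroup.mem_sup.1 hu
    exact hSmem x hx w hw l hl
  have key : ∀ x ∈ T, ∀ v ∈ dirSpan T, vecOf x + v ∈ closure S := by
    intro x hx v hv
    have hc : Continuous fun y : GAIdx n → ℝ => vecOf y + v := by
      unfold vecOf
      fun_prop
    have := map_mem_closure (t := closure S) hc (hgen hx) (fun y hy => hgood y hy.1 hy.2 v hv)
    rwa [closure_closure] at this
  intro q hq
  obtain ⟨x, hx, p, hp, rfl⟩ := Set.mem_iUnion₂.1 hq
  obtain ⟨_, ⟨w, hw, rfl⟩, v, hv, rfl⟩ := hp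
  have hwT : w ∈ dirSpan T := (le_iSup₂_of_le x hx le_rfl : dirOf x ≤ dirSpan T) hw
  have := key x hx (w + v) ((dirSpan T).add_mem hwT hv)
  rw [← add_assoc] at this
  exact map_mem_closure hcont this fun y hy => hy
end

section
/- Every constructible subset T of the complex affine Grassmannian GrAff_i^ℂ(ℂ^n) can be written as a finite union of neat families, where a neat family is a constructible subset T' ⊆ GrAff_i^ℂ(ℂ^n) that is a connected real submanifold and satisfies L(U) = L(T') for every nonempty open subset U ⊆ T'. -/
/-!
The complex affine Grassmannian `GrAff_i^ℂ(ℂ^n)` of `i`-dimensional complex affine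
flats of `ℂ^n`.  A flat is presented by a parameter `p = (M, b)` where `M` is a
`(n-i) × n` matrix of full rank `n-i` and `b ∈ ℂ^{n-i}`; the flat is the solution set
`{x : Mx = b}` and its direction is `L(A) = ker M`.  The parameter space is a Zariski
open subset of `ℂ^{(n-i)n + (n-i)}`, and the natural map onto `GrAff_i^ℂ(ℂ^n)` is a
Zariski-locally trivial principal `GL_{n-i}(ℂ)`-bundle; accordingly, a subset `T` of
`GrAff_i^ℂ(ℂ^n)` is constructible / Zariski closed / open / connected / irreducible /
smooth / a real submanifold exactly when its (saturated) preimage `pre T` in the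
parameter space is, which is how these notions are rendered below.
-/

/-- Index type for the parameter space `ℂ^{kn + k}` of `(n-i) × n` matrices together
with right-hand sides (`k = n - i`). -/
abbrev PIdx (n k : ℕ) := (Fin k × Fin n) ⊕ Fin k

/-- The matrix component of a parameter. -/
def matP {n k : ℕ} (p : PIdx n k → ℂ) : Matrix (Fin k) (Fin n) ℂ :=
  Matrix.of fun r c => p (Sum.inl (r, c))

/-- The right-hand-side component of a parameter. -/
def vecP {n k : ℕ} (p : PIdx n k → ℂ) : Fin k → ℂ := fun r => p (Sum.inr r)

/-- The set of full-rank parameters. -/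
def paramSet (n k : ℕ) : Set (PIdx n k → ℂ) :=
  {p | Module.finrank ℂ (LinearMap.range (matP p).mulVecLin) = k}

/-- The affine flat `{x : Mx = b} ⊆ ℂ^n` presented by a parameter. -/
def flatP {n k : ℕ} (p : PIdx n k → ℂ) : Set (Fin n → ℂ) :=
  {x | (matP p).mulVec x = vecP p}

/-- The direction `L(A) = ker M` of the flat presented by a parameter. -/
noncomputable def dirP {n k : ℕ} (p : PIdx n k → ℂ) : Submodule ℂ (Fin n → ℂ) :=
  LinearMap.ker (matP p).mulVecLin

/-- The complex affine Grassmannian `GrAff_i^ℂ(ℂ^n)`: the set of `i`-dimensional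
complex affine flats `A ⊆ ℂ^n`. -/
def grAffC (n i : ℕ) : Set (Set (Fin n → ℂ)) :=
  {A | ∃ p ∈ paramSet n (n - i), A = flatP p}

/-- The (saturated) preimage in the parameter space of a family `T ⊆ GrAff_i^ℂ(ℂ^n)`
of flats. -/
def pre (n i : ℕ) (T : Set (Set (Fin n → ℂ))) : Set (PIdx n (n - i) → ℂ) :=
  {p | p ∈ paramSet n (n - i) ∧ flatP p ∈ T}

/-- `L(T)`: the `ℂ`-linear span of the directions of the members of a (parametrized)
family of flats. -/
noncomputable def dirSpanC {n k : ℕ} (S : Set (PIdx n k → ℂ)) : Submodule ℂ (Fin n → ℂ) :=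
  ⨆ p ∈ S, dirP p

/-- A Zariski closed subset of `ℂ^ι`: the common zero locus of a set of
polynomials. -/
def IsZariskiClosed {ι : Type*} (S : Set (ι → ℂ)) : Prop :=
  ∃ P : Set (MvPolynomial ι ℂ), S = {x | ∀ q ∈ P, MvPolynomial.eval x q = 0}

/-- Constructible subsets of `ℂ^ι`: finite Boolean combinations of Zariski closed
sets. -/
inductive IsConstructibleSet {ι : Type*} : Set (ι → ℂ) → Prop
  | of_closed (S : Set (ι → ℂ)) : IsZariskiClosed S → IsConstructibleSet S
  | compl (S : Set (ι → ℂ)) : IsConstructibleSet S → IsConstructibleSet Sᶜ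
  | union (S S' : Set (ι → ℂ)) : IsConstructibleSet S → IsConstructibleSet S' →
      IsConstructibleSet (S ∪ S')

/-- A neat family of `i`-dimensional complex flats: a constructible subset
`T ⊆ GrAff_i^ℂ(ℂ^n)` which is a connected real submanifold and satisfies
`L(U) = L(T)` for every nonempty (Euclidean) open subset `U ⊆ T`. -/
def IsNeatFamilyC (n i : ℕ) (T : Set (Set (Fin n → ℂ))) : Prop :=
  T ⊆ grAffC n i ∧ IsConstructibleSet (pre n i T) ∧ IsConnected (pre n i T) ∧
  IsSmoothSubmanifold (pre n i T) ∧
  ∀ V : Set (PIdx n (n - i) → ℂ), IsOpen V → (pre n i T ∩ V).Nonempty →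
    dirSpanC (pre n i T ∩ V) = dirSpanC (pre n i T)

section
open Polynomial

/-- entire function of polynomial growth is a polynomial -/
theorem entire_poly {f : ℂ → ℂ} (hf : Differentiable ℂ f) (C : ℝ) (N : ℕ)
    (hb : ∀ t, ‖f t‖ ≤ C * (1 + ‖t‖) ^ N) :
    ∃ q : ℂ[X], q.natDegree ≤ N ∧ ∀ t, f t = q.eval t := by
  have hC : 0 ≤ C := by
    have := (norm_nonneg _).trans (hb 0)
    simpa using this
  have hz : ∀ n, N < n → iteratedDeriv n f 0 = 0 := by
    intro n hn
    have key : ∀ R : ℝ, 1 ≤ R → ‖iteratedDeriv n f 0‖ ≤ (n.factorial * C * 2 ^ N) / R := by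
      intro R hR
      have hR0 : 0 < R := by linarith
      have h1 := Complex.norm_iteratedDeriv_le_of_forall_mem_sphere_norm_le n hR0
        (hf.diffContOnCl (s := Metric.ball 0 R)) (C := C * (2 * R) ^ N) (by
          intro z hz
          have : ‖z‖ = R := by simpa using hz
          refine (hb z).trans ?_
          rw [this]
          gcongr
          linarith)
      refine h1.trans ?_
      rw [div_le_div_iff₀ (by positivity) hR0, mul_pow]
      have : R ^ N * R ≤ R ^ n := by
        rw [← pow_succ]
        exact pow_le_pow_right₀ hR hn
      calc n.factorial * (C * (2 ^ N * R ^ N)) * R = n.factorial * C * 2 ^ N * (R ^ N * R) := by ring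
        _ ≤ _ := by gcongr
    by_contra hne
    have hpos : 0 < ‖iteratedDeriv n f 0‖ := norm_pos_iff.2 hne
    set a := ‖iteratedDeriv n f 0‖
    set K := (n.factorial * C * 2 ^ N)
    have hK : 0 ≤ K := by positivity
    have := key (max 1 ((K + 1) / a)) (le_max_left _ _)
    rw [le_div_iff₀ (by positivity)] at this
    have h2 : a * ((K + 1) / a) ≤ a * max 1 ((K + 1) / a) := by
      gcongr; exact le_max_right _ _
    rw [mul_div_cancel₀ _ hpos.ne'] at h2
    linarith
  refine ⟨∑ n ∈ Finset.range (N + 1), Polynomial.C ((n.factorial : ℂ)⁻¹ * iteratedDeriv n f 0) * X ^ n,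
    ?_, ?_⟩
  · refine Polynomial.natDegree_sum_le_of_forall_le _ _ fun n hn => ?_
    refine (Polynomial.natDegree_C_mul_X_pow_le _ _).trans ?_
    have := Finset.mem_range.1 hn
    omega
  · intro t
    rw [← Complex.taylorSeries_eq_of_entire' 0 t hf, tsum_eq_sum (s := Finset.range (N + 1))]
    · simp [Polynomial.eval_finsetSum]
    · intro n hn
      rw [hz n (by simpa using hn)]
      simp

/-- Removable singularities and Liouville. -/
theorem punctured_poly {f : ℂ → ℂ} {S : Set ℂ} (hS : S.Finite)
    (hf : ∀ t ∉ S, DifferentiableAt ℂ f t) (C : ℝ) (N : ℕ)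
    (hb : ∀ t ∉ S, ‖f t‖ ≤ C * (1 + ‖t‖) ^ N) :
    ∃ q : ℂ[X], q.natDegree ≤ N ∧ ∀ t ∉ S, f t = q.eval t := by
  classical
  have hdense : ∀ c : ℂ, ∀ᶠ t in nhdsWithin c {c}ᶜ, t ∉ S := by
    intro c
    have : (S \ {c})ᶜ ∈ nhds c := (hS.subset Set.sdiff_subset).isClosed.isOpen_compl.mem_nhds (by simp)
    filter_upwards [nhdsWithin_le_nhds this, self_mem_nhdsWithin] with t ht htc hS
    exact ht ⟨hS, htc⟩
  have hC : 0 ≤ C := by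
    obtain ⟨t, ht⟩ := (hdense 0).exists
    by_contra hneg
    have h1 := (norm_nonneg _).trans (hb t ht)
    have : 0 < (1 + ‖t‖) ^ N := by positivity
    nlinarith
  set g : ℂ → ℂ := fun t => (nhdsWithin t {t}ᶜ).limUnder f with hg
  have hgf : ∀ t ∉ S, g t = f t := by
    intro t ht
    exact ((hf t ht).continuousAt.tendsto.mono_left nhdsWithin_le_nhds).limUnder_eq
  have hgd : Differentiable ℂ g := by
    intro c
    set U : Set ℂ := Metric.ball c 1 ∩ (S \ {c})ᶜ
    have hU : U ∈ nhds c := Filter.inter_mem (Metric.ball_mem_nhds _ one_pos)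
      ((hS.subset Set.sdiff_subset).isClosed.isOpen_compl.mem_nhds (by simp))
    have hUS : ∀ t ∈ U \ {c}, t ∉ S := fun t ht hS => ht.1.2 ⟨hS, ht.2⟩
    have h1 := Complex.differentiableOn_update_limUnder_of_bddAbove hU (f := f)
      (fun t ht => (hf t (hUS t ht)).differentiableWithinAt) (by
        refine ⟨C * (2 + ‖c‖) ^ N, ?_⟩
        rintro _ ⟨t, ht, rfl⟩
        refine (hb t (hUS t ht)).trans ?_
        have h2 : dist t c < 1 := ht.1.1
        rw [dist_eq_norm] at h2
        have := norm_sub_norm_le t c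
        have h3 : 1 + ‖t‖ ≤ 2 + ‖c‖ := by linarith
        exact mul_le_mul_of_nonneg_left (pow_le_pow_left₀ (by positivity) h3 _) hC)
    refine (h1.congr ?_).differentiableAt hU
    intro t ht
    by_cases htc : t = c
    · subst htc; simp [hg]
    · rw [Function.update_of_ne htc]
      exact hgf t (hUS t ⟨ht, htc⟩)
  have hgb : ∀ t, ‖g t‖ ≤ C * (1 + ‖t‖) ^ N := by
    intro t
    have h1 : Filter.Tendsto g (nhdsWithin t {t}ᶜ) (nhds (g t)) :=
      (hgd t).continuousAt.tendsto.mono_left nhdsWithin_le_nhds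
    have h2 : Filter.Tendsto (fun t : ℂ => C * (1 + ‖t‖) ^ N) (nhdsWithin t {t}ᶜ)
        (nhds (C * (1 + ‖t‖) ^ N)) := by
      have : Continuous (fun t : ℂ => C * (1 + ‖t‖) ^ N) := by fun_prop
      exact this.continuousAt.tendsto.mono_left nhdsWithin_le_nhds
    refine le_of_tendsto_of_tendsto h1.norm h2 ?_
    filter_upwards [hdense t] with s hs
    rw [hgf s hs]
    exact hb s hs
  obtain ⟨q, hq, hq'⟩ := entire_poly hgd C N hgb
  exact ⟨q, hq, fun t ht => by rw [← hgf t ht, hq']⟩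

/-- functions on a box that are polynomial of bounded degree in each variable are polynomial -/
theorem box_poly {σ : Type*} [DecidableEq σ] (D : σ → Set ℂ) (hD : ∀ i, (D i).Infinite) (N : ℕ)
    (s : (σ → ℂ) → ℂ)
    (hs : ∀ z : σ → ℂ, (∀ i, z i ∈ D i) → ∀ i, ∃ q : ℂ[X], q.natDegree ≤ N ∧
      ∀ t ∈ D i, s (Function.update z i t) = q.eval t) (A : Finset σ) :
    ∀ y : σ → ℂ, (∀ i, y i ∈ D i) → ∃ p : MvPolynomial σ ℂ, ∀ z : σ → ℂ, (∀ i, z i ∈ D i) →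
      (∀ i ∉ A, z i = y i) → s z = MvPolynomial.eval z p := by
  induction A using Finset.induction_on with
  | empty =>
    intro y hy
    refine ⟨MvPolynomial.C (s y), fun z hz hzy => ?_⟩
    have : z = y := funext fun i => hzy i (by simp)
    simp [this]
  | insert i A hi ih =>
    intro y hy
    obtain ⟨nodes, hn1, hn2⟩ := (hD i).exists_subset_card_eq (N + 1)
    have : ∀ a : ℂ, a ∈ nodes → ∃ p : MvPolynomial σ ℂ, ∀ z : σ → ℂ, (∀ i, z i ∈ D i) →
      (∀ j ∉ A, z j = Function.update y i a j) → s z = MvPolynomial.eval z p := by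
      intro a ha
      apply ih
      intro j
      by_cases hj : j = i
      · subst hj; simpa using hn1 ha
      · simpa [hj] using hy j
    choose! p hp using this
    refine ⟨∑ a ∈ nodes, MvPolynomial.bind₁ (Function.update MvPolynomial.X i (MvPolynomial.C a)) (p a) *
      Polynomial.aeval (MvPolynomial.X i) (Lagrange.basis nodes id a), fun z hz hzy => ?_⟩
    obtain ⟨q, hq, hqs⟩ := hs z hz i
    have h1 : s z = q.eval (z i) := by
      rw [← hqs _ (hz i), Function.update_eq_self]
    have h2 : q = Lagrange.interpolate nodes id (fun a => q.eval a) := by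
      refine Lagrange.eq_interpolate_of_eval_eq _ (by simp) ?_ (by simp)
      rw [hn2]
      refine (Polynomial.degree_le_natDegree).trans_lt ?_
      exact_mod_cast Nat.lt_succ_of_le hq
    rw [h1, h2, Lagrange.interpolate_apply, Polynomial.eval_finsetSum, map_sum]
    refine Finset.sum_congr rfl fun a ha => ?_
    rw [map_mul, Polynomial.eval_mul, Polynomial.eval_C, ← hqs a (hn1 ha), hp a ha]
    · congr 1
      · rw [← MvPolynomial.aeval_eq_eval, ← MvPolynomial.aeval_eq_eval]
        erw [MvPolynomial.aeval_bind₁]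
        congr 2
        funext j
        by_cases hj : j = i
        · subst hj; simp
        · simp [hj]
      · rw [← MvPolynomial.aeval_eq_eval]
        erw [← Polynomial.aeval_algHom_apply]
        simp [Polynomial.aeval_def]
    · intro j
      by_cases hj : j = i
      · subst hj; simpa using hn1 ha
      · simpa [hj] using hz j
    · intro j hj
      by_cases hji : j = i
      · subst hji; simp
      · simp only [Function.update_of_ne hji]
        exact hzy j (by simp [hji, hj])

end

section
open Polynomial

/-- restriction of a polynomial to a line -/
noncomputable def lineP {σ : Type*} (p : MvPolynomial σ ℂ) (z v : σ → ℂ) : ℂ[X] :=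
  MvPolynomial.aeval (fun i => C (z i) + C (v i) * X) p

theorem lineP_eval {σ : Type*} (p : MvPolynomial σ ℂ) (z v : σ → ℂ) (t : ℂ) :
    (lineP p z v).eval t = MvPolynomial.eval (z + t • v) p := by
  unfold lineP
  induction p using MvPolynomial.induction_on with
  | C a => simp
  | add p q hp hq => simp [hp, hq]
  | mul_X p i hp => simp [hp, mul_comm t]

theorem lineP_finite {σ : Type*} (G : MvPolynomial σ ℂ) (z v : σ → ℂ) (hz : MvPolynomial.eval z G ≠ 0) :
    {t : ℂ | MvPolynomial.eval (z + t • v) G = 0}.Finite := by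
  have hne : lineP G z v ≠ 0 := by
    intro h
    apply hz
    have := lineP_eval G z v 0
    rw [h] at this
    simpa using this.symm
  refine (Polynomial.finite_setOfPred_isRoot hne).subset fun t ht => ?_
  simpa [Polynomial.IsRoot, lineP_eval] using ht

theorem MvPolynomial_continuous {σ : Type*} (p : MvPolynomial σ ℂ) :
    Continuous fun z : σ → ℂ => MvPolynomial.eval z p := MvPolynomial.continuous_eval p

theorem isOpen_polyne {σ : Type*} (G : MvPolynomial σ ℂ) :
    IsOpen {z : σ → ℂ | MvPolynomial.eval z G ≠ 0} :=
  isOpen_ne_fun (MvPolynomial_continuous G) continuous_const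

theorem isPreconnected_ne {σ : Type*} (G : MvPolynomial σ ℂ) :
    IsPreconnected {z : σ → ℂ | MvPolynomial.eval z G ≠ 0} := by
  refine isPreconnected_of_forall_pair ?_
  intro x hx y hy
  have hfin := lineP_finite G x (y - x) hx
  refine ⟨(fun t : ℂ => x + t • (y - x)) '' {t : ℂ | MvPolynomial.eval (x + t • (y - x)) G = 0}ᶜ,
    ?_, ⟨0, by simpa using hx, by simp⟩, ⟨1, by simpa using hy, by simp⟩, ?_⟩
  · rintro _ ⟨t, ht, rfl⟩
    exact ht
  · refine IsPreconnected.image ?_ _ (by fun_prop)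
    refine (hfin.countable.isPathConnected_compl_of_one_lt_rank ?_).isConnected.isPreconnected
    rw [Complex.rank_real_complex]
    exact Nat.one_lt_ofNat

/-- a polynomial vanishing on a nonempty open set vanishes -/
theorem poly_zero_of_open {σ : Type*} (p : MvPolynomial σ ℂ) (U : Set (σ → ℂ)) (hU : IsOpen U)
    (hne : U.Nonempty) (h : ∀ z ∈ U, MvPolynomial.eval z p = 0) : p = 0 := by
  by_contra hp
  obtain ⟨y, hy⟩ : ∃ y, MvPolynomial.eval y p ≠ 0 := by
    by_contra hcon
    push Not at hcon
    exact hp (MvPolynomial.funext fun y => by simpa using hcon y)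
  obtain ⟨x, hx⟩ := hne
  have hfin := lineP_finite p y (x - y) hy
  have hcont : Continuous fun t : ℂ => y + t • (x - y) := by fun_prop
  have hnh : (fun t : ℂ => y + t • (x - y)) ⁻¹' U ∈ nhds (1 : ℂ) :=
    (hU.preimage hcont).mem_nhds (by simpa using hx)
  exact (infinite_of_mem_nhds _ hnh) (hfin.subset fun t ht => h _ ht)

theorem exists_eval_ne {σ : Type*} (p : MvPolynomial σ ℂ) (hp : p ≠ 0) :
    ∃ y, MvPolynomial.eval y p ≠ 0 := by
  by_contra hcon
  push Not at hcon
  exact hp (MvPolynomial.funext fun y => by simpa using hcon y)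

theorem holo_poly {σ : Type*} [Fintype σ] (G : MvPolynomial σ ℂ) (hG : G ≠ 0) (s : (σ → ℂ) → ℂ)
    (hs : ∀ z, MvPolynomial.eval z G ≠ 0 → DifferentiableAt ℂ s z) (C : ℝ) (N : ℕ) (hC : 0 ≤ C)
    (hb : ∀ z, MvPolynomial.eval z G ≠ 0 → ‖s z‖ ≤ C * (1 + ‖z‖) ^ N) :
    ∃ p : MvPolynomial σ ℂ, ∀ z, MvPolynomial.eval z G ≠ 0 → s z = MvPolynomial.eval z p := by
  classical
  have line : ∀ z v : σ → ℂ, MvPolynomial.eval z G ≠ 0 → ∃ q : ℂ[X], q.natDegree ≤ N ∧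
      ∀ t : ℂ, MvPolynomial.eval (z + t • v) G ≠ 0 → s (z + t • v) = q.eval t := by
    intro z v hz
    refine punctured_poly (f := fun t : ℂ => s (z + t • v)) (lineP_finite G z v hz) ?_
      (C * (1 + ‖z‖ + ‖v‖) ^ N) N ?_
    · intro t ht
      have h1 : DifferentiableAt ℂ (fun t : ℂ => z + t • v) t := by fun_prop
      exact DifferentiableAt.comp (g := s) t (hs _ ht) h1
    · intro t ht
      refine (hb _ ht).trans ?_
      rw [mul_assoc, ← mul_pow]
      have h1 : 1 + ‖z + t • v‖ ≤ (1 + ‖z‖ + ‖v‖) * (1 + ‖t‖) := by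
        have := norm_add_le z (t • v)
        rw [norm_smul] at this
        have h2 := norm_nonneg z
        have h3 := norm_nonneg v
        have h4 := norm_nonneg t
        nlinarith [mul_nonneg h2 h4]
      exact mul_le_mul_of_nonneg_left (pow_le_pow_left₀ (by positivity) h1 _) hC
  obtain ⟨z0, hz0⟩ := exists_eval_ne G hG
  obtain ⟨ε, hε, hball⟩ := Metric.isOpen_iff.1 (isOpen_polyne G) z0 hz0
  have hbox : ∀ z : σ → ℂ, (∀ i, z i ∈ Metric.ball (z0 i) ε) ↔ z ∈ Metric.ball z0 ε := by
    intro z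
    rw [ball_pi _ hε]; simp
  obtain ⟨p, hp⟩ := box_poly (fun i => Metric.ball (z0 i) ε)
    (fun i => infinite_of_mem_nhds _ (Metric.ball_mem_nhds _ hε)) N s (by
      intro z hz i
      have hzG : MvPolynomial.eval z G ≠ 0 := hball ((hbox z).1 hz)
      obtain ⟨q, hq, hq'⟩ := line z (Pi.single i 1) hzG
      refine ⟨q.comp (X - Polynomial.C (z i)), ?_, ?_⟩
      · rw [Polynomial.natDegree_comp, Polynomial.natDegree_X_sub_C, mul_one]; exact hq
      · intro t ht
        have h1 : z + (t - z i) • (Pi.single i 1 : σ → ℂ) = Function.update z i t := by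
          funext j
          by_cases hj : j = i
          · subst hj; simp
          · simp [hj]
        have h2 : Function.update z i t ∈ Metric.ball z0 ε := by
          rw [← hbox]
          intro j
          by_cases hj : j = i
          · subst hj; simpa using ht
          · rw [Function.update_of_ne hj]; exact hz j
        have h3 := hq' (t - z i) (by rw [h1]; exact hball h2)
        rw [h1] at h3
        rw [h3]; simp) Finset.univ z0 (fun i => Metric.mem_ball_self hε)
  refine ⟨p, fun z hz => ?_⟩
  obtain ⟨q, -, hq⟩ := line z0 (z - z0) hz0
  have heq : q = lineP p z0 (z - z0) := by
    have hcont : Continuous fun t : ℂ => z0 + t • (z - z0) := by fun_prop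
    have hnh : (fun t : ℂ => z0 + t • (z - z0)) ⁻¹' Metric.ball z0 ε ∈ nhds (0 : ℂ) :=
      (Metric.isOpen_ball.preimage hcont).mem_nhds (by simpa using hε)
    refine Polynomial.eq_of_infinite_eval_eq _ _ ((infinite_of_mem_nhds _ hnh).mono fun t ht => ?_)
    have ht' : z0 + t • (z - z0) ∈ Metric.ball z0 ε := ht
    rw [Set.mem_ofPred_eq, ← hq t (hball ht'), lineP_eval]
    exact hp _ ((hbox _).2 ht') (by simp)
  have h1 := hq 1 (by simpa using hz)
  rw [heq, lineP_eval] at h1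
  simpa using h1

theorem poly_growth {σ : Type*} [Fintype σ] (p : MvPolynomial σ ℂ) :
    ∃ (C : ℝ) (N : ℕ), 0 ≤ C ∧ ∀ z : σ → ℂ, ‖MvPolynomial.eval z p‖ ≤ C * (1 + ‖z‖) ^ N := by
  induction p using MvPolynomial.induction_on with
  | C a => exact ⟨‖a‖, 0, norm_nonneg _, fun z => by simp⟩
  | add p q hp hq =>
    obtain ⟨C1, N1, h1, hp⟩ := hp
    obtain ⟨C2, N2, h2, hq⟩ := hq
    refine ⟨C1 + C2, N1 + N2, by positivity, fun z => ?_⟩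
    have hz : 1 ≤ 1 + ‖z‖ := by simp
    rw [map_add]
    calc _ ≤ C1 * (1 + ‖z‖) ^ N1 + C2 * (1 + ‖z‖) ^ N2 := (norm_add_le _ _).trans (add_le_add (hp z) (hq z))
      _ ≤ C1 * (1 + ‖z‖) ^ (N1 + N2) + C2 * (1 + ‖z‖) ^ (N1 + N2) := by
        gcongr <;> first | exact hz | omega
      _ = _ := by ring
  | mul_X p i hp =>
    obtain ⟨C1, N1, h1, hp⟩ := hp
    refine ⟨C1, N1 + 1, h1, fun z => ?_⟩
    rw [map_mul, norm_mul, MvPolynomial.eval_X, pow_succ, ← mul_assoc]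
    have : ‖z i‖ ≤ 1 + ‖z‖ := (norm_le_pi_norm z i).trans (by simp)
    gcongr
    exact hp z

end

section
open Polynomial Topology
open scoped ContDiff

/-- specialization of the coefficients -/
noncomputable def pe {σ : Type*} (F : (MvPolynomial σ ℂ)[X]) (z : σ → ℂ) : ℂ[X] :=
  F.map (MvPolynomial.eval z)

theorem contDiff_mvEval {σ : Type*} [Fintype σ] (p : MvPolynomial σ ℂ) :
    ContDiff ℂ ω fun z : σ → ℂ => MvPolynomial.eval z p :=
  contDiff_iff_contDiffAt.2 fun x =>
    (AnalyticOnNhd.eval_mvPolynomial (𝕜 := ℂ) p x (Set.mem_univ _)).contDiffAt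

theorem pe_eval {σ : Type*} (F : (MvPolynomial σ ℂ)[X]) (z : σ → ℂ) (t : ℂ) :
    (pe F z).eval t = ∑ i ∈ Finset.range (F.natDegree + 1), MvPolynomial.eval z (F.coeff i) * t ^ i := by
  rw [pe, Polynomial.eval_map, Polynomial.eval₂_eq_sum_range]

theorem contDiff_pe {σ : Type*} [Fintype σ] (F : (MvPolynomial σ ℂ)[X]) :
    ContDiff ℂ ω fun u : (σ → ℂ) × ℂ => (pe F u.1).eval u.2 := by
  simp_rw [pe_eval]
  refine ContDiff.sum fun i _ => ?_
  exact ((contDiff_mvEval _).comp contDiff_fst).mul (contDiff_snd.pow i)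

theorem local_root {σ : Type*} [Fintype σ] (P : (MvPolynomial σ ℂ)[X]) (z0 : σ → ℂ) (a : ℂ)
    (ha : (pe P z0).eval a = 0) (hd : (pe P z0).derivative.eval a ≠ 0) :
    ∃ θ : (σ → ℂ) → ℂ, θ z0 = a ∧ ContDiffAt ℂ ω θ z0 ∧ ∀ᶠ z in 𝓝 z0, (pe P z).eval (θ z) = 0 := by
  set f : (σ → ℂ) × ℂ → ℂ := fun u => (pe P u.1).eval u.2 with hf
  have cdf : ContDiffAt ℂ ω f (z0, a) := (contDiff_pe P).contDiffAt
  have hder : HasDerivAt (fun t => f (z0, t)) ((pe P z0).derivative.eval a) a :=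
    (pe P z0).hasDerivAt a
  have hcomp : (fderiv ℂ f (z0, a) ∘L .inr ℂ (σ → ℂ) ℂ) 1 = (pe P z0).derivative.eval a := by
    have h1 : HasFDerivAt f (fderiv ℂ f (z0, a)) (z0, a) :=
      (cdf.differentiableAt (by simp)).hasFDerivAt
    have h2 : HasFDerivAt (fun t : ℂ => (z0, t)) (ContinuousLinearMap.inr ℂ (σ → ℂ) ℂ) a :=
      hasFDerivAt_prodMk_right z0 a
    have h3 := (h1.comp a h2).hasDerivAt
    exact h3.unique hder
  have if₂ : (fderiv ℂ f (z0, a) ∘L .inr ℂ (σ → ℂ) ℂ).IsInvertible := by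
    refine ⟨ContinuousLinearEquiv.unitsEquivAut ℂ (Units.mk0 _ hd), ?_⟩
    ext
    rw [hcomp]
    simp
  refine ⟨cdf.implicitFunction (by simp) if₂, cdf.implicitFunction_apply_self _ if₂,
    cdf.contDiffAt_implicitFunction _ if₂, ?_⟩
  filter_upwards [cdf.eventually_apply_implicitFunction (by simp) if₂] with z hz
  exact hz.trans ha

theorem pe_monic {σ : Type*} {P : (MvPolynomial σ ℂ)[X]} (hP : P.Monic) (z : σ → ℂ) : (pe P z).Monic :=
  hP.map _

theorem pe_natDegree {σ : Type*} {P : (MvPolynomial σ ℂ)[X]} (hP : P.Monic) (z : σ → ℂ) :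
    (pe P z).natDegree = P.natDegree := hP.natDegree_map _

theorem local_roots {σ : Type*} [Fintype σ] (P : (MvPolynomial σ ℂ)[X]) (hP : P.Monic) (z0 : σ → ℂ)
    (hd : ∀ a, (pe P z0).eval a = 0 → (pe P z0).derivative.eval a ≠ 0) :
    ∃ θ : ℂ → (σ → ℂ) → ℂ, (∀ a ∈ (pe P z0).roots.toFinset, θ a z0 = a) ∧
      ∀ᶠ z in 𝓝 z0, (∀ a ∈ (pe P z0).roots.toFinset, ContDiffAt ℂ ω (θ a) z) ∧
        Set.InjOn (θ · z) (pe P z0).roots.toFinset ∧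
        pe P z = ∏ a ∈ (pe P z0).roots.toFinset, (X - C (θ a z)) := by
  classical
  set Rt := (pe P z0).roots.toFinset with hRt
  have hne : pe P z0 ≠ 0 := (pe_monic hP z0).ne_zero
  have hroot : ∀ a ∈ Rt, (pe P z0).eval a = 0 := by
    intro a ha
    have := Multiset.mem_toFinset.1 ha
    exact (Polynomial.mem_roots hne).1 this
  have hcard : Rt.card = P.natDegree := by
    rw [hRt, Multiset.toFinset_card_of_nodup, ← pe_natDegree hP z0]
    · exact IsAlgClosed.card_roots_eq_natDegree
    · rw [Multiset.nodup_iff_count_le_one]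
      intro a
      rw [Polynomial.count_roots]
      by_contra hcon
      push Not at hcon
      have h1 := (Polynomial.one_lt_rootMultiplicity_iff_isRoot hne).1 hcon
      exact hd a h1.1 h1.2
  have : ∀ a ∈ Rt, ∃ θ : (σ → ℂ) → ℂ, θ z0 = a ∧ ContDiffAt ℂ ω θ z0 ∧
      ∀ᶠ z in 𝓝 z0, (pe P z).eval (θ z) = 0 :=
    fun a ha => local_root P z0 a (hroot a ha) (hd a (hroot a ha))
  choose! θ h1 h2 h3 using this
  refine ⟨θ, h1, ?_⟩
  have e1 : ∀ᶠ z in 𝓝 z0, ∀ a ∈ Rt, ContDiffAt ℂ ω (θ a) z :=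
    (Filter.eventually_all_finset _).2 fun a ha => (h2 a ha).eventually (by simp)
  have e2 : ∀ᶠ z in 𝓝 z0, ∀ a ∈ Rt, (pe P z).eval (θ a z) = 0 :=
    (Filter.eventually_all_finset _).2 fun a ha => h3 a ha
  have e3 : ∀ᶠ z in 𝓝 z0, ∀ a ∈ Rt, ∀ b ∈ Rt, a ≠ b → θ a z ≠ θ b z := by
    refine (Filter.eventually_all_finset _).2 fun a ha => (Filter.eventually_all_finset _).2 fun b hb => ?_
    by_cases hab : a = b
    · simp [hab]
    · have := ((h2 a ha).continuousAt.prodMk (h2 b hb).continuousAt).eventually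
        (isOpen_ne_fun continuous_fst continuous_snd |>.eventually_mem
          (show ((θ a z0, θ b z0) : ℂ × ℂ).1 ≠ _ by simpa [h1 a ha, h1 b hb] using hab))
      filter_upwards [this] with z hz _ using hz
  filter_upwards [e1, e2, e3] with z c1 c2 c3
  have hinj : Set.InjOn (θ · z) Rt := by
    intro a ha b hb hab
    by_contra hne
    exact c3 a ha b hb hne hab
  refine ⟨c1, hinj, ?_⟩
  have hm : (∏ a ∈ Rt, (X - C (θ a z))).Monic := monic_prod_X_sub_C _ _
  have hdvd : (∏ a ∈ Rt, (X - C (θ a z))) ∣ pe P z := by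
    refine Finset.prod_dvd_of_coprime ?_ ?_
    · intro a ha b hb hab
      exact Polynomial.pairwise_coprime_X_sub_C (s := fun x : ℂ => x) (fun _ _ h => h) (c3 a ha b hb hab)
    · intro a ha
      exact Polynomial.dvd_iff_isRoot.2 (c2 a ha)
  refine (Polynomial.eq_of_monic_of_dvd_of_natDegree_le hm (pe_monic hP z) hdvd ?_)
  rw [pe_natDegree hP, Polynomial.natDegree_finsetProd_X_sub_C_eq_card, hcard]

end

section
open Polynomial Topology
open scoped ContDiff

/-- polynomial growth -/
def PG {σ : Type*} [Fintype σ] (f : (σ → ℂ) → ℝ) : Prop :=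
  ∃ (C : ℝ) (N : ℕ), 0 ≤ C ∧ ∀ z : σ → ℂ, f z ≤ C * (1 + ‖z‖) ^ N

theorem PG.add {σ : Type*} [Fintype σ] {f g : (σ → ℂ) → ℝ} (hf : PG f) (hg : PG g) :
    PG fun z => f z + g z := by
  obtain ⟨C1, N1, h1, hp⟩ := hf
  obtain ⟨C2, N2, h2, hq⟩ := hg
  refine ⟨C1 + C2, N1 + N2, by positivity, fun z => ?_⟩
  have hz : 1 ≤ 1 + ‖z‖ := by simp
  calc _ ≤ C1 * (1 + ‖z‖) ^ N1 + C2 * (1 + ‖z‖) ^ N2 := (add_le_add (hp z) (hq z))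
    _ ≤ C1 * (1 + ‖z‖) ^ (N1 + N2) + C2 * (1 + ‖z‖) ^ (N1 + N2) := by
      gcongr <;> first | exact hz | omega
    _ = _ := by ring

theorem PG.const {σ : Type*} [Fintype σ] (c : ℝ) (hc : 0 ≤ c) : PG fun _ : σ → ℂ => c :=
  ⟨c, 0, hc, fun z => by simp⟩

theorem PG.sum {σ ι : Type*} [Fintype σ] (s : Finset ι) {f : ι → (σ → ℂ) → ℝ} (hf : ∀ i, PG (f i)) :
    PG fun z => ∑ i ∈ s, f i z := by
  classical
  induction s using Finset.induction_on with
  | empty => simpa using PG.const (σ := σ) 0 le_rfl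
  | insert a s ha ih =>
    simp_rw [Finset.sum_insert ha]
    exact (hf a).add ih

theorem PG.pow {σ : Type*} [Fintype σ] {f : (σ → ℂ) → ℝ} (hf : PG f) (h0 : ∀ z, 0 ≤ f z) (m : ℕ) :
    PG fun z => f z ^ m := by
  obtain ⟨C1, N1, h1, hp⟩ := hf
  refine ⟨C1 ^ m, N1 * m, by positivity, fun z => ?_⟩
  rw [pow_mul, ← mul_pow]
  exact pow_le_pow_left₀ (h0 z) (hp z) m

theorem root_bound (p : ℂ[X]) (hp : p.Monic) (t : ℂ) (ht : p.eval t = 0) :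
    ‖t‖ ≤ 1 + ∑ i ∈ Finset.range p.natDegree, ‖p.coeff i‖ := by
  have hs : 0 ≤ ∑ i ∈ Finset.range p.natDegree, ‖p.coeff i‖ := Finset.sum_nonneg fun _ _ => norm_nonneg _
  by_cases h1 : ‖t‖ ≤ 1
  · linarith
  push Not at h1
  rw [Polynomial.eval_eq_sum_range, Finset.sum_range_succ, hp.coeff_natDegree, one_mul] at ht
  set n := p.natDegree
  rcases Nat.eq_zero_or_pos n with hn | hn
  · rw [hn] at ht; simp at ht
  have h2 : ‖t‖ ^ n ≤ (∑ i ∈ Finset.range n, ‖p.coeff i‖) * ‖t‖ ^ (n - 1) := by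
    rw [← norm_pow, eq_neg_of_add_eq_zero_right ht, norm_neg, Finset.sum_mul]
    refine (norm_sum_le _ _).trans (Finset.sum_le_sum fun i hi => ?_)
    rw [norm_mul, norm_pow]
    have : i ≤ n - 1 := by have := Finset.mem_range.1 hi; omega
    gcongr
    exact h1.le
  have h3 : ‖t‖ ^ n = ‖t‖ * ‖t‖ ^ (n - 1) := by
    rw [← pow_succ']; congr 1; omega
  rw [h3] at h2
  have := le_of_mul_le_mul_right h2 (by positivity)
  linarith

theorem coeff_prod_bound (s : Finset ℂ) (M : ℝ) (hM : 0 ≤ M) (h : ∀ a ∈ s, ‖a‖ ≤ M) (j : ℕ) :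
    ‖(∏ a ∈ s, (X - C a)).coeff j‖ ≤ (1 + M) ^ s.card := by
  classical
  induction s using Finset.induction_on generalizing j with
  | empty => 
    simp [Polynomial.coeff_one]
    split_ifs <;> simp
  | insert a s ha ih =>
    have ih' := ih (fun b hb => h b (Finset.mem_insert_of_mem hb))
    rw [Finset.prod_insert ha, Finset.card_insert_of_notMem ha, pow_succ]
    have h1 : ‖a‖ ≤ M := h a (Finset.mem_insert_self _ _)
    set B := (1 + M) ^ s.card
    have hB : 0 ≤ B := by positivity
    rw [sub_mul, Polynomial.coeff_sub, Polynomial.coeff_C_mul]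
    have h2 : ‖(X * ∏ a ∈ s, (X - C a)).coeff j‖ ≤ B := by
      cases j with
      | zero => simpa using hB
      | succ j => rw [Polynomial.coeff_X_mul]; exact ih' j
    refine (norm_sub_le _ _).trans ?_
    rw [norm_mul]
    have h3 := mul_le_mul h1 (ih' j) (norm_nonneg _) hM
    linarith

theorem coeff_prod_differentiableAt {E : Type*} [NormedAddCommGroup E] [NormedSpace ℂ E]
    (s : Finset ℂ) (θ : ℂ → E → ℂ) (z0 : E) (h : ∀ a ∈ s, DifferentiableAt ℂ (θ a) z0) (j : ℕ) :
    DifferentiableAt ℂ (fun z => (∏ a ∈ s, (X - C (θ a z))).coeff j) z0 := by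
  classical
  induction s using Finset.induction_on generalizing j with
  | empty => simp
  | insert a s ha ih =>
    have ih' := ih (fun b hb => h b (Finset.mem_insert_of_mem hb))
    simp_rw [Finset.prod_insert ha, sub_mul, Polynomial.coeff_sub, Polynomial.coeff_C_mul]
    refine DifferentiableAt.sub ?_ ((h a (Finset.mem_insert_self _ _)).mul (ih' j))
    cases j with
    | zero => simp
    | succ j => simp_rw [Polynomial.coeff_X_mul]; exact ih' j

/-- the part of the roots lying in `W` -/
noncomputable def rootsIn {σ : Type*} (P : (MvPolynomial σ ℂ)[X]) (W : Set ((σ → ℂ) × ℂ)) (z : σ → ℂ) :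
    Finset ℂ := by
  classical exact (pe P z).roots.toFinset.filter fun t => (z, t) ∈ W

theorem mem_roots_pe {σ : Type*} {P : (MvPolynomial σ ℂ)[X]} (hP : P.Monic) (z : σ → ℂ) (t : ℂ) :
    t ∈ (pe P z).roots.toFinset ↔ (pe P z).eval t = 0 := by
  classical
  rw [Multiset.mem_toFinset, Polynomial.mem_roots (pe_monic hP z).ne_zero, Polynomial.IsRoot]

theorem mem_rootsIn {σ : Type*} {P : (MvPolynomial σ ℂ)[X]} (hP : P.Monic) (W : Set ((σ → ℂ) × ℂ))
    (z : σ → ℂ) (t : ℂ) : t ∈ rootsIn P W z ↔ (pe P z).eval t = 0 ∧ (z, t) ∈ W := by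
  classical
  unfold rootsIn
  rw [Finset.mem_filter, mem_roots_pe hP]

theorem clopen_poly {σ : Type*} [Fintype σ] (P : (MvPolynomial σ ℂ)[X]) (hP : P.Monic)
    (G : MvPolynomial σ ℂ) (hG0 : G ≠ 0)
    (hG : ∀ z, MvPolynomial.eval z G ≠ 0 → ∀ a, (pe P z).eval a = 0 → (pe P z).derivative.eval a ≠ 0)
    (W : Set ((σ → ℂ) × ℂ))
    (hW : ∀ x : (σ → ℂ) × ℂ, MvPolynomial.eval x.1 G ≠ 0 → (pe P x.1).eval x.2 = 0 →
      ∀ᶠ u in 𝓝 x, MvPolynomial.eval u.1 G ≠ 0 → (pe P u.1).eval u.2 = 0 → (u ∈ W ↔ x ∈ W)) :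
    ∃ Q : (MvPolynomial σ ℂ)[X], ∀ z, MvPolynomial.eval z G ≠ 0 →
      pe Q z = ∏ a ∈ rootsIn P W z, (X - C a) := by
  classical
  have hcardle : ∀ z, (rootsIn P W z).card ≤ P.natDegree := by
    intro z
    unfold rootsIn
    refine (Finset.card_filter_le _ _).trans ((Multiset.toFinset_card_le _).trans ?_)
    rw [← pe_natDegree hP z]
    exact Polynomial.card_roots' _
  have hdiff : ∀ j z0, MvPolynomial.eval z0 G ≠ 0 →
      DifferentiableAt ℂ (fun z => (∏ a ∈ rootsIn P W z, (X - C a)).coeff j) z0 := by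
    intro j z0 hz0
    obtain ⟨θ, hθ0, hθ⟩ := local_roots P hP z0 (hG z0 hz0)
    set Rt := (pe P z0).roots.toFinset with hRt
    have hc := hθ.self_of_nhds.1
    have e1 : ∀ᶠ z in 𝓝 z0, ∀ a ∈ Rt, (pe P z).eval (θ a z) = 0 → ((z, θ a z) ∈ W ↔ (z0, a) ∈ W) := by
      refine (Filter.eventually_all_finset _).2 fun a ha => ?_
      have h1 : ContinuousAt (fun z => (z, θ a z)) z0 :=
        continuousAt_id.prodMk (hc a ha).continuousAt
      have h2 := hW (z0, a) hz0 ((mem_roots_pe hP z0 a).1 ha)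
      have h3 : Filter.Tendsto (fun z => (z, θ a z)) (𝓝 z0) (𝓝 (z0, a)) := by
        have := h1.tendsto; rwa [hθ0 a ha] at this
      filter_upwards [h3.eventually h2, (isOpen_polyne G).eventually_mem hz0] with z hz hzG hr
      exact hz hzG hr
    have e2 : (fun z => (∏ a ∈ rootsIn P W z, (X - C a)).coeff j) =ᶠ[𝓝 z0]
        fun z => (∏ a ∈ Rt.filter (fun t => (z0, t) ∈ W), (X - C (θ a z))).coeff j := by
      filter_upwards [hθ, e1] with z hz1 hz2
      obtain ⟨-, hinj, hprod⟩ := hz1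
      have hev : ∀ t, (pe P z).eval t = 0 ↔ ∃ a ∈ Rt, θ a z = t := by
        intro t
        rw [hprod, Polynomial.eval_prod, Finset.prod_eq_zero_iff]
        simp only [Polynomial.eval_sub, Polynomial.eval_X, Polynomial.eval_C, sub_eq_zero]
        exact exists_congr fun a => and_congr_right fun _ => eq_comm
      have himg : rootsIn P W z = (Rt.filter (fun t => (z0, t) ∈ W)).image (θ · z) := by
        ext t
        rw [mem_rootsIn hP, Finset.mem_image, hev]
        constructor
        · rintro ⟨⟨a, ha, rfl⟩, hw⟩
          exact ⟨a, Finset.mem_filter.2 ⟨ha, (hz2 a ha ((hev _).2 ⟨a, ha, rfl⟩)).1 hw⟩, rfl⟩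
        · rintro ⟨a, ha, rfl⟩
          have ha' := Finset.mem_filter.1 ha
          exact ⟨⟨a, ha'.1, rfl⟩, (hz2 a ha'.1 ((hev _).2 ⟨a, ha'.1, rfl⟩)).2 ha'.2⟩
      rw [himg, Finset.prod_image]
      intro a ha b hb hab
      exact hinj (Finset.mem_filter.1 ha).1 (Finset.mem_filter.1 hb).1 hab
    refine DifferentiableAt.congr_of_eventuallyEq ?_ e2
    refine coeff_prod_differentiableAt _ _ _ (fun a ha => ?_) j
    exact (hc a (Finset.mem_filter.1 ha).1).differentiableAt (by simp)
  obtain ⟨K, N, hK, hgrow⟩ : PG fun z : σ → ℂ =>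
      (2 + ∑ i ∈ Finset.range P.natDegree, ‖MvPolynomial.eval z (P.coeff i)‖) ^ P.natDegree := by
    refine PG.pow ((PG.const 2 (by norm_num)).add (PG.sum _ fun i => ?_)) (fun z => by positivity) _
    exact poly_growth _
  have hbd : ∀ j z, ‖(∏ a ∈ rootsIn P W z, (X - C a)).coeff j‖ ≤ K * (1 + ‖z‖) ^ N := by
    intro j z
    have hs : 0 ≤ ∑ i ∈ Finset.range P.natDegree, ‖MvPolynomial.eval z (P.coeff i)‖ :=
      Finset.sum_nonneg fun _ _ => norm_nonneg _
    refine (coeff_prod_bound _ (1 + ∑ i ∈ Finset.range P.natDegree, ‖MvPolynomial.eval z (P.coeff i)‖)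
      (by positivity) ?_ j).trans (le_trans ?_ (hgrow z))
    · intro a ha
      have := root_bound (pe P z) (pe_monic hP z) a ((mem_rootsIn hP W z a).1 ha).1
      rw [pe_natDegree hP] at this
      simpa [pe] using this
    · rw [← add_assoc, one_add_one_eq_two]
      exact pow_le_pow_right₀ (by linarith) (hcardle z)
  choose p hp using fun j => holo_poly G hG0 _ (hdiff j) K N hK (fun z _ => hbd j z)
  refine ⟨∑ j ∈ Finset.range (P.natDegree + 1), Polynomial.C (p j) * X ^ j, fun z hz => ?_⟩
  have hdeg : (∏ a ∈ rootsIn P W z, (X - C a)).natDegree < P.natDegree + 1 := by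
    rw [Polynomial.natDegree_finsetProd_X_sub_C_eq_card]
    exact Nat.lt_succ_of_le (hcardle z)
  rw [Polynomial.as_sum_range' _ _ hdeg, pe, Polynomial.map_sum]
  refine Finset.sum_congr rfl fun j _ => ?_
  rw [← Polynomial.C_mul_X_pow_eq_monomial, hp j z hz]
  simp

theorem pe_mul {σ : Type*} (P Q : (MvPolynomial σ ℂ)[X]) (z : σ → ℂ) : pe (P * Q) z = pe P z * pe Q z :=
  Polynomial.map_mul _

theorem pe_ext {σ : Type*} (G : MvPolynomial σ ℂ) (hG0 : G ≠ 0) (P Q : (MvPolynomial σ ℂ)[X])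
    (h : ∀ z, MvPolynomial.eval z G ≠ 0 → pe P z = pe Q z) : P = Q := by
  ext1 j
  rw [← sub_eq_zero]
  refine poly_zero_of_open _ {z | MvPolynomial.eval z G ≠ 0} (isOpen_polyne G) (exists_eval_ne G hG0) ?_
  intro z hz
  have := congrArg (fun q => q.coeff j) (h z hz)
  simp only [pe, Polynomial.coeff_map] at this
  rw [map_sub, this, sub_self]

/-- the cover -/
def coverSet {σ : Type*} (P : (MvPolynomial σ ℂ)[X]) (G : MvPolynomial σ ℂ) : Set ((σ → ℂ) × ℂ) :=
  {u | MvPolynomial.eval u.1 G ≠ 0 ∧ (pe P u.1).eval u.2 = 0}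

theorem cover_connected {σ : Type*} [Fintype σ] (P : (MvPolynomial σ ℂ)[X]) (hP : P.Monic)
    (hirr : Irreducible P) (G : MvPolynomial σ ℂ) (hG0 : G ≠ 0)
    (hG : ∀ z, MvPolynomial.eval z G ≠ 0 → ∀ a, (pe P z).eval a = 0 → (pe P z).derivative.eval a ≠ 0) :
    IsConnected (coverSet P G) := by
  classical
  constructor
  · obtain ⟨z, hz⟩ := exists_eval_ne G hG0
    have hdeg : (pe P z).degree ≠ 0 := by
      intro h0
      have h1 : P.natDegree = 0 := by
        rw [← pe_natDegree hP z]; exact Polynomial.natDegree_eq_of_degree_eq_some h0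
      have := Polynomial.eq_one_of_monic_natDegree_zero hP h1
      exact hirr.not_isUnit (this ▸ isUnit_one)
    obtain ⟨t, ht⟩ := IsAlgClosed.exists_root (pe P z) hdeg
    exact ⟨(z, t), hz, ht⟩
  intro U V hU hV hUV ⟨⟨z1, t1⟩, h1, h1U⟩ ⟨⟨z2, t2⟩, h2, h2V⟩
  by_contra hcon
  have hdisj : ∀ u ∈ coverSet P G, (u ∈ V ↔ u ∉ U) := by
    intro u hu
    constructor
    · intro hv hu'
      exact hcon ⟨u, hu, hu', hv⟩
    · intro hnu
      exact (hUV hu).resolve_left hnu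
  have hU' : ∀ x : (σ → ℂ) × ℂ, MvPolynomial.eval x.1 G ≠ 0 → (pe P x.1).eval x.2 = 0 →
      ∀ᶠ u in 𝓝 x, MvPolynomial.eval u.1 G ≠ 0 → (pe P u.1).eval u.2 = 0 → (u ∈ U ↔ x ∈ U) := by
    intro x hx1 hx2
    by_cases hx : x ∈ U
    · filter_upwards [hU.eventually_mem hx] with u hu _ _
      exact iff_of_true hu hx
    · filter_upwards [hV.eventually_mem ((hdisj x ⟨hx1, hx2⟩).2 hx)] with u hu a b
      exact iff_of_false ((hdisj u ⟨a, b⟩).1 hu) hx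
  have hV' : ∀ x : (σ → ℂ) × ℂ, MvPolynomial.eval x.1 G ≠ 0 → (pe P x.1).eval x.2 = 0 →
      ∀ᶠ u in 𝓝 x, MvPolynomial.eval u.1 G ≠ 0 → (pe P u.1).eval u.2 = 0 → (u ∈ V ↔ x ∈ V) := by
    intro x hx1 hx2
    filter_upwards [hU' x hx1 hx2] with u hu a b
    rw [hdisj u ⟨a, b⟩, hdisj x ⟨hx1, hx2⟩, hu a b]
  obtain ⟨QU, hQU⟩ := clopen_poly P hP G hG0 hG U hU'
  obtain ⟨QV, hQV⟩ := clopen_poly P hP G hG0 hG V hV'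
  have hmul : P = QU * QV := by
    refine pe_ext G hG0 _ _ fun z hz => ?_
    rw [pe_mul, hQU z hz, hQV z hz]
    obtain ⟨θ, hθ0, hθ⟩ := local_roots P hP z (hG z hz)
    have h3 := hθ.self_of_nhds.2.2
    have h4 : pe P z = ∏ a ∈ (pe P z).roots.toFinset, (X - C a) := by
      conv_lhs => rw [h3]
      exact Finset.prod_congr rfl fun a ha => by rw [hθ0 a ha]
    rw [h4, ← Finset.prod_filter_mul_prod_filter_not _ (fun t => (z, t) ∈ U)]
    refine congrArg₂ (· * ·) ?_ ?_
    · refine Finset.prod_congr ?_ fun _ _ => rfl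
      ext t
      rw [Finset.mem_filter, mem_rootsIn hP, mem_roots_pe hP]
    · refine Finset.prod_congr ?_ fun _ _ => rfl
      ext t
      rw [Finset.mem_filter, mem_rootsIn hP, mem_roots_pe hP]
      refine and_congr_right fun ht => ?_
      exact (hdisj (z, t) ⟨hz, ht⟩).symm
  have key : ∀ (Q : (MvPolynomial σ ℂ)[X]) (W : Set ((σ → ℂ) × ℂ)) (z : σ → ℂ) (t : ℂ),
      (z, t) ∈ coverSet P G → (z, t) ∈ W → pe Q z = ∏ a ∈ rootsIn P W z, (X - C a) → ¬ IsUnit Q := by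
    intro Q W z t hzt hW hQ hu
    have h5 : IsUnit ((pe Q z).eval t) := by
      have := (hu.map (Polynomial.mapRingHom (MvPolynomial.eval z))).map (Polynomial.evalRingHom t)
      exact this
    rw [hQ, Polynomial.eval_prod, Finset.prod_eq_zero ((mem_rootsIn hP W z t).2 ⟨hzt.2, hW⟩) (by simp)] at h5
    exact not_isUnit_zero h5
  rcases hirr.isUnit_or_isUnit hmul with h | h
  · exact key QU U z1 t1 h1 h1U (hQU z1 h1.1) h
  · exact key QV V z2 t2 h2 h2V (hQV z2 h2.1) h

end

section
open Polynomial

theorem prim_elem_aux {R B F K : Type} [CommRing R] [IsDomain R] [CharZero R] [CommRing B]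
    [IsDomain B] [Algebra R B] [FaithfulSMul R B] [Algebra.IsAlgebraic R B]
    [hft : Algebra.FiniteType R B] [Field F] [Field K] [Algebra R F] [IsFractionRing R F]
    [Algebra B K] [IsFractionRing B K] [Algebra R K] [IsScalarTower R B K] [Algebra F K]
    [IsScalarTower R F K] :
    ∃ w : B, IsIntegral R w ∧ ∀ y : B, ∃ r : R, r ≠ 0 ∧ ∃ H : R[X], r • y = aeval w H := by
  have : CharZero F := charZero_of_injective_algebraMap (IsFractionRing.injective R F)
  have halgB : ∀ y : B, IsAlgebraic R (algebraMap B K y) := fun y =>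
    (Algebra.IsAlgebraic.isAlgebraic (R := R) y).algebraMap
  have halgBF : ∀ y : B, IsIntegral F (algebraMap B K y) := fun y =>
    ((halgB y).extendScalars (IsFractionRing.injective R F)).isIntegral
  obtain ⟨s, hs⟩ := hft.out
  have hfin : FiniteDimensional F K := by
    let L : IntermediateField F K := IntermediateField.adjoin F (algebraMap B K '' (s : Set B))
    have hL : FiniteDimensional F L := by
      have : Finite (algebraMap B K '' (s : Set B)) := (s.finite_toSet.image _)
      apply IntermediateField.finiteDimensional_adjoin
      rintro x ⟨y, _, rfl⟩
      exact halgBF y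
    have hB : ∀ y : B, algebraMap B K y ∈ L := by
      intro y
      have hy : y ∈ Algebra.adjoin R (s : Set B) := by rw [hs]; trivial
      induction hy using Algebra.adjoin_induction with
      | mem x hx => exact IntermediateField.subset_adjoin _ _ ⟨x, hx, rfl⟩
      | algebraMap r =>
        rw [← IsScalarTower.algebraMap_apply, IsScalarTower.algebraMap_apply R F K]
        exact L.algebraMap_mem _
      | add x y _ _ hx hy => rw [map_add]; exact L.add_mem hx hy
      | mul x y _ _ hx hy => rw [map_mul]; exact L.mul_mem hx hy
    have htop : L = ⊤ := by
      rw [eq_top_iff]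
      rintro x -
      obtain ⟨a, b, hb, rfl⟩ := IsFractionRing.div_surjective (A := B) x
      exact L.div_mem (hB a) (hB b)
    rw [htop] at hL
    exact IntermediateField.topEquiv.toLinearEquiv.finiteDimensional
  obtain ⟨α, hα⟩ := Field.exists_primitive_element F K
  obtain ⟨u, v, hv, rfl⟩ := IsFractionRing.div_surjective (A := B) α
  obtain ⟨c, d, hd, hc⟩ := (Algebra.IsAlgebraic.isAlgebraic (R := R) v).exists_smul_eq_mul u hv
  obtain ⟨r, hr, hintg⟩ := (Algebra.IsAlgebraic.isAlgebraic (R := R) c).exists_integral_multiple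
  refine ⟨r • c, hintg, fun y => ?_⟩
  have hw : algebraMap B K (r • c) =
      algebraMap F K (algebraMap R F (r * d)) * (algebraMap B K u / algebraMap B K v) := by
    have hv0 : algebraMap B K v ≠ 0 := by
      simpa using nonZeroDivisors.ne_zero hv
    rw [← mul_div_assoc, eq_div_iff hv0, ← IsScalarTower.algebraMap_apply,
      IsScalarTower.algebraMap_apply R B K, ← map_mul, ← map_mul]
    congr 1
    rw [Algebra.smul_def] at hc ⊢
    rw [map_mul]
    linear_combination (-algebraMap R B r) * hc
  have hadj : algebraMap B K y ∈ Algebra.adjoin F {algebraMap B K (r • c)} := by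
    have h1 : algebraMap B K u / algebraMap B K v ∈ Algebra.adjoin F {algebraMap B K (r • c)} := by
      have hne : algebraMap R F (r * d) ≠ 0 := by
        simpa using ⟨hr, hd⟩
      have : algebraMap B K u / algebraMap B K v =
          (algebraMap R F (r * d))⁻¹ • algebraMap B K (r • c) := by
        rw [hw, Algebra.smul_def, ← mul_assoc, ← map_mul, inv_mul_cancel₀ hne, map_one, one_mul]
      rw [this]
      exact Subalgebra.smul_mem _ (Algebra.subset_adjoin (Set.mem_singleton _)) _
    have h2 : algebraMap B K y ∈ (IntermediateField.adjoin F {algebraMap B K u / algebraMap B K v}) := by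
      rw [hα]; trivial
    rw [← IntermediateField.mem_toSubalgebra,
      IntermediateField.adjoin_simple_toSubalgebra_of_isAlgebraic
        (Algebra.IsAlgebraic.isAlgebraic _)] at h2
    exact (Algebra.adjoin_le (Set.singleton_subset_iff.2 h1)) h2
  rw [Algebra.adjoin_singleton_eq_range_aeval] at hadj
  obtain ⟨Q, hQ⟩ := hadj
  obtain ⟨b, hb, hbQ⟩ := IsLocalization.integerNormalization_spec (nonZeroDivisors R) Q
  refine ⟨b, nonZeroDivisors.ne_zero hb, IsLocalization.integerNormalization (nonZeroDivisors R) Q, ?_⟩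
  apply IsFractionRing.injective B K
  rw [← Polynomial.aeval_algebraMap_apply, ← Polynomial.aeval_map_algebraMap F, hbQ]
  have : (b • Q : F[X]) = C (algebraMap R F b) * Q := by
    rw [← algebraMap_smul F b Q, Polynomial.smul_eq_C_mul]
  rw [this, map_mul, aeval_C]
  erw [hQ]
  rw [Algebra.smul_def, map_mul, ← IsScalarTower.algebraMap_apply,
    ← IsScalarTower.algebraMap_apply]

theorem prim_elem {R B : Type} [CommRing R] [IsDomain R] [CharZero R] [CommRing B] [IsDomain B]
    [Algebra R B] [FaithfulSMul R B] [Algebra.IsAlgebraic R B] [Algebra.FiniteType R B] :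
    ∃ w : B, IsIntegral R w ∧ ∀ y : B, ∃ r : R, r ≠ 0 ∧ ∃ H : R[X], r • y = aeval w H := by
  have hinj : Function.Injective (algebraMap R B) := FaithfulSMul.algebraMap_injective R B
  have hRK : Function.Injective (algebraMap R (FractionRing B)) := by
    rw [IsScalarTower.algebraMap_eq R B (FractionRing B)]
    exact (IsFractionRing.injective B (FractionRing B)).comp hinj
  have : FaithfulSMul R (FractionRing B) :=
    (faithfulSMul_iff_algebraMap_injective R (FractionRing B)).2 hRK
  let : Algebra (FractionRing R) (FractionRing B) := FractionRing.liftAlgebra R (FractionRing B)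
  have : IsScalarTower R (FractionRing R) (FractionRing B) :=
    FractionRing.isScalarTower_liftAlgebra R (FractionRing B)
  exact prim_elem_aux (F := FractionRing R) (K := FractionRing B)
end

section
open Polynomial

theorem noether_pkg {ι : Type} [Fintype ι] (𝔭 : Ideal (MvPolynomial ι ℂ)) [h𝔭 : 𝔭.IsPrime] :
    ∃ (τ : Type) (_ : Fintype τ) (c : τ → ι) (_ : Function.Injective c)
      (P : (MvPolynomial τ ℂ)[X]) (w : MvPolynomial ι ℂ), P.Monic ∧ Irreducible P ∧
    (∀ F : (MvPolynomial τ ℂ)[X],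
      F.eval₂ (MvPolynomial.rename c).toRingHom w ∈ 𝔭 ↔ P ∣ F) ∧
    (∀ q, ∃ r ≠ 0, ∃ H : (MvPolynomial τ ℂ)[X],
      MvPolynomial.rename c r * q - H.eval₂ (MvPolynomial.rename c).toRingHom w ∈ 𝔭) ∧
    (∀ q ∉ 𝔭, ∃ r ≠ 0, ∃ H : (MvPolynomial τ ℂ)[X],
      q * H.eval₂ (MvPolynomial.rename c).toRingHom w - MvPolynomial.rename c r ∈ 𝔭) := by
  classical
  let B := MvPolynomial ι ℂ ⧸ 𝔭
  let x : ι → B := fun i => Ideal.Quotient.mk 𝔭 (MvPolynomial.X i)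
  have hadj : Algebra.adjoin ℂ (Set.range x) = ⊤ := by
    have h1 := (MvPolynomial.adjoin_range_X (R := ℂ) (σ := ι))
    have h2 := congrArg (Subalgebra.map (Ideal.Quotient.mkₐ ℂ 𝔭)) h1
    rw [AlgHom.map_adjoin, ← Set.range_comp, Algebra.map_top] at h2
    rw [show x = (Ideal.Quotient.mkₐ ℂ 𝔭) ∘ MvPolynomial.X from rfl, h2]
    exact (AlgHom.range_eq_top _).2 (Ideal.Quotient.mkₐ_surjective ℂ 𝔭)
  have halg : Algebra.IsAlgebraic (Algebra.adjoin ℂ (Set.range x)) B := by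
    rw [hadj]
    exact ⟨fun y => isAlgebraic_algebraMap (A := B) (⟨y, trivial⟩ : (⊤ : Subalgebra ℂ B))⟩
  obtain ⟨τ, hτ, htb⟩ := exists_isTranscendenceBasis_subset (R := ℂ) (Set.range x)
  have hfin : Finite τ := (Set.finite_range x).subset hτ
  let ft : Fintype τ := Fintype.ofFinite τ
  choose c hc using fun t : τ => hτ t.2
  have hcinj : Function.Injective c := fun a b h => by
    apply Subtype.ext; rw [← hc a, ← hc b, h]
  let R := MvPolynomial τ ℂ
  let φ : R →ₐ[ℂ] B := MvPolynomial.aeval (fun t : τ => (t : B))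
  let : Algebra R B := φ.toRingHom.toAlgebra
  have hmap : ∀ r : R, algebraMap R B r = Ideal.Quotient.mk 𝔭 (MvPolynomial.rename c r) := by
    intro r
    change φ r = (Ideal.Quotient.mkₐ ℂ 𝔭) (MvPolynomial.rename c r)
    have : φ = (Ideal.Quotient.mkₐ ℂ 𝔭).comp (MvPolynomial.rename c) := by
      ext t
      simpa [φ] using (hc t).symm
    rw [this]; rfl
  have hinj : Function.Injective (algebraMap R B) := htb.1
  have : FaithfulSMul R B := (faithfulSMul_iff_algebraMap_injective R B).2 hinj
  have : IsScalarTower ℂ R B := .of_algebraMap_eq fun z => (φ.commutes z).symm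
  have : Algebra.FiniteType ℂ B := inferInstance
  have : Algebra.FiniteType R B := Algebra.FiniteType.of_restrictScalars_finiteType ℂ R B
  have : Algebra.IsAlgebraic R B := by
    have := htb.isAlgebraic
    let e := htb.1.aevalEquiv
    let : Algebra (Algebra.adjoin ℂ (Set.range (fun t : τ => (t : B)))) R :=
      e.symm.toRingEquiv.toRingHom.toAlgebra
    have : IsScalarTower (Algebra.adjoin ℂ (Set.range (fun t : τ => (t : B)))) R B := by
      refine .of_algebraMap_eq fun z => ?_
      obtain ⟨y, rfl⟩ := e.surjective z
      change _ = φ (e.symm (e y))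
      rw [e.symm_apply_apply]
      exact htb.1.algebraMap_aevalEquiv y
    exact .extendScalars (R := Algebra.adjoin ℂ (Set.range (fun t : τ => (t : B))))
      (S := R) e.symm.injective
  obtain ⟨w, hw, hpr⟩ := prim_elem (R := R) (B := B)
  obtain ⟨w', rfl⟩ := Ideal.Quotient.mk_surjective w
  have hev : ∀ F : R[X], Ideal.Quotient.mk 𝔭 (F.eval₂ (MvPolynomial.rename c).toRingHom w') =
      aeval (Ideal.Quotient.mk 𝔭 w' : B) F := by
    intro F
    rw [Polynomial.hom_eval₂, aeval_def]
    congr 1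
    exact RingHom.ext fun r => (hmap r).symm
  have hc2 : ∀ q, ∃ r : R, r ≠ 0 ∧ ∃ H : R[X],
      MvPolynomial.rename c r * q - H.eval₂ (MvPolynomial.rename c).toRingHom w' ∈ 𝔭 := by
    intro q
    obtain ⟨r, hr, H, hH⟩ := hpr (Ideal.Quotient.mk 𝔭 q)
    refine ⟨r, hr, H, ?_⟩
    rw [← Ideal.Quotient.eq, map_mul, hev, ← hH, Algebra.smul_def, hmap]
  refine ⟨τ, ft, c, hcinj, minpoly R (Ideal.Quotient.mk 𝔭 w' : B), w', minpoly.monic hw,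
    minpoly.irreducible hw, ?_, hc2, ?_⟩
  · intro F
    rw [← minpoly.isIntegrallyClosed_dvd_iff hw, ← hev, Ideal.Quotient.eq_zero_iff_mem]
  · intro q hq
    have hq0 : (Ideal.Quotient.mk 𝔭 q : B) ≠ 0 := by
      rwa [Ne, Ideal.Quotient.eq_zero_iff_mem]
    obtain ⟨y, d, hd, hy⟩ := (Algebra.IsAlgebraic.isAlgebraic (R := R)
      (Ideal.Quotient.mk 𝔭 q : B)).exists_smul_eq_mul 1 (mem_nonZeroDivisors_of_ne_zero hq0)
    obtain ⟨r, hr, H, hH⟩ := hpr y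
    refine ⟨r * d, mul_ne_zero hr hd, H, ?_⟩
    rw [← Ideal.Quotient.eq, map_mul, hev, ← hH, ← hmap, map_mul, Algebra.smul_def]
    rw [Algebra.smul_def, mul_one] at hy
    rw [hy]; ring
end

section
open Polynomial

theorem pe_eval_eq {σ : Type*} (F : (MvPolynomial σ ℂ)[X]) (z : σ → ℂ) (t : ℂ) :
    (pe F z).eval t = eval₂RingHom (MvPolynomial.eval z) t F := by
  simp [pe, eval_map]

theorem eval_eval2_rename {ι τ : Type} (c : τ → ι) (w : MvPolynomial ι ℂ)
    (F : (MvPolynomial τ ℂ)[X]) (x : ι → ℂ) :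
    MvPolynomial.eval x (F.eval₂ (MvPolynomial.rename c).toRingHom w) =
      (pe F (x ∘ c)).eval (MvPolynomial.eval x w) := by
  rw [Polynomial.hom_eval₂, pe_eval_eq, coe_eval₂RingHom]
  congr 1
  refine RingHom.ext fun r => ?_
  exact MvPolynomial.eval_rename c x r

/-- clearing denominators along the rational parametrization -/
theorem clear_denoms {ι τ : Type} (c : τ → ι) (w : MvPolynomial ι ℂ)
    (𝔭 : Ideal (MvPolynomial ι ℂ)) (b : MvPolynomial τ ℂ) (Rj : ι → (MvPolynomial τ ℂ)[X])
    (hR : ∀ j, MvPolynomial.rename c b * MvPolynomial.X j -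
      (Rj j).eval₂ (MvPolynomial.rename c).toRingHom w ∈ 𝔭) (q : MvPolynomial ι ℂ) :
    ∃ (M : ℕ) (F : (MvPolynomial τ ℂ)[X]),
      MvPolynomial.rename c b ^ M * q - F.eval₂ (MvPolynomial.rename c).toRingHom w ∈ 𝔭 ∧
      ∀ z t, MvPolynomial.eval z b ≠ 0 →
        MvPolynomial.eval z b ^ M *
          MvPolynomial.eval (fun j => (pe (Rj j) z).eval t / MvPolynomial.eval z b) q =
          (pe F z).eval t := by
  induction q using MvPolynomial.induction_on with
  | C a =>
    refine ⟨0, C (MvPolynomial.C a), by simp, fun z t hz => by simp [pe_eval_eq]⟩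
  | add p q hp hq =>
    obtain ⟨M1, F1, h1, e1⟩ := hp
    obtain ⟨M2, F2, h2, e2⟩ := hq
    refine ⟨M1 + M2, C (b ^ M2) * F1 + C (b ^ M1) * F2, ?_, fun z t hz => ?_⟩
    · have := 𝔭.add_mem (𝔭.mul_mem_left (MvPolynomial.rename c b ^ M2) h1)
        (𝔭.mul_mem_left (MvPolynomial.rename c b ^ M1) h2)
      convert this using 1
      simp only [eval₂_add, eval₂_mul, eval₂_C]
      simp only [map_pow, AlgHom.toRingHom_eq_coe, RingHom.coe_coe]
      ring
    · have e1' := e1 z t hz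
      have e2' := e2 z t hz
      rw [pe_eval_eq] at e1' e2' ⊢
      rw [map_add, map_add, map_mul, map_mul, ← e1', ← e2']
      simp only [coe_eval₂RingHom, eval₂_C, map_pow]
      ring
  | mul_X p j hp =>
    obtain ⟨M1, F1, h1, e1⟩ := hp
    refine ⟨M1 + 1, F1 * Rj j, ?_, fun z t hz => ?_⟩
    · have := 𝔭.add_mem (𝔭.mul_mem_left (MvPolynomial.rename c b * MvPolynomial.X j) h1)
        (𝔭.mul_mem_left (F1.eval₂ (MvPolynomial.rename c).toRingHom w) (hR j))
      convert this using 1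
      rw [eval₂_mul]
      ring
    · have e1' := e1 z t hz
      rw [map_mul, MvPolynomial.eval_X, pe_mul, eval_mul, ← e1']
      field_simp
      ring

theorem param_pkg {ι : Type} [Fintype ι] (𝔭 : Ideal (MvPolynomial ι ℂ)) [h𝔭 : 𝔭.IsPrime]
    (h : MvPolynomial ι ℂ) (hh : h ∉ 𝔭) :
    ∃ (τ : Type) (_ : Fintype τ) (c : τ → ι) (_ : Function.Injective c)
      (P : (MvPolynomial τ ℂ)[X]) (w : MvPolynomial ι ℂ) (G b : MvPolynomial τ ℂ)
      (Rj : ι → (MvPolynomial τ ℂ)[X]),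
      P.Monic ∧ Irreducible P ∧ G ≠ 0 ∧ MvPolynomial.rename c G ∉ 𝔭 ∧
      (∀ z, MvPolynomial.eval z G ≠ 0 → ∀ a, (pe P z).eval a = 0 →
        (pe P z).derivative.eval a ≠ 0) ∧
      (∀ z, MvPolynomial.eval z G ≠ 0 → MvPolynomial.eval z b ≠ 0) ∧
      (∀ u ∈ coverSet P G,
        let x := fun j => (pe (Rj j) u.1).eval u.2 / MvPolynomial.eval u.1 b
        (∀ q ∈ 𝔭, MvPolynomial.eval x q = 0) ∧ x ∘ c = u.1 ∧ MvPolynomial.eval x w = u.2) ∧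
      (∀ x : ι → ℂ, (∀ q ∈ 𝔭, MvPolynomial.eval x q = 0) → MvPolynomial.eval (x ∘ c) G ≠ 0 →
        (x ∘ c, MvPolynomial.eval x w) ∈ coverSet P G ∧
        (∀ j, x j = (pe (Rj j) (x ∘ c)).eval (MvPolynomial.eval x w) /
          MvPolynomial.eval (x ∘ c) b) ∧ MvPolynomial.eval x h ≠ 0) ∧
      (∀ q ∉ 𝔭, ∃ r : MvPolynomial τ ℂ, r ≠ 0 ∧
        ∀ x : ι → ℂ, (∀ q ∈ 𝔭, MvPolynomial.eval x q = 0) → MvPolynomial.eval x q = 0 →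
          MvPolynomial.eval (x ∘ c) r = 0) := by
  classical
  obtain ⟨τ, ft, c, hc, P, w, hP, hirr, hdvd, hden, hinv⟩ := noether_pkg 𝔭
  have hdeg : 0 < P.natDegree := by
    by_contra hd
    have : P = 1 := hP.natDegree_eq_zero.1 (by omega)
    exact hirr.not_isUnit (this ▸ isUnit_one)
  choose r hr H hH using fun j => hden (MvPolynomial.X j)
  let b := ∏ j, r j
  let Rj : ι → (MvPolynomial τ ℂ)[X] := fun j => C (∏ i ∈ Finset.univ.erase j, r i) * H j
  have hb : b ≠ 0 := Finset.prod_ne_zero_iff.2 fun j _ => hr j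
  have hR : ∀ j, MvPolynomial.rename c b * MvPolynomial.X j -
      (Rj j).eval₂ (MvPolynomial.rename c).toRingHom w ∈ 𝔭 := by
    intro j
    have := 𝔭.mul_mem_left (MvPolynomial.rename c (∏ i ∈ Finset.univ.erase j, r i)) (hH j)
    convert this using 1
    have hbj : b = r j * ∏ i ∈ Finset.univ.erase j, r i :=
      (Finset.mul_prod_erase _ _ (Finset.mem_univ j)).symm
    rw [hbj]
    simp only [Rj, eval₂_mul, eval₂_C, AlgHom.toRingHom_eq_coe, RingHom.coe_coe, map_mul]
    ring
  have hPd : P.derivative.eval₂ (MvPolynomial.rename c).toRingHom w ∉ 𝔭 := by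
    rw [hdvd]
    apply hP.not_dvd_of_natDegree_lt
    · intro h0
      have := derivative_eq_zero.1 h0
      omega
    · exact natDegree_derivative_lt (by omega)
  obtain ⟨r1, hr1, H1, hH1⟩ := hinv _ hPd
  obtain ⟨r2, hr2, H2, hH2⟩ := hinv h hh
  have hG0 : r1 * r2 * b ≠ 0 := mul_ne_zero (mul_ne_zero hr1 hr2) hb
  refine ⟨τ, ft, c, hc, P, w, r1 * r2 * b, b, Rj, hP, hirr, hG0, ?_, ?_, ?_, ?_, ?_, ?_⟩
  · intro hmem
    have : P ∣ C (r1 * r2 * b) := by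
      rw [← hdvd]
      simpa using hmem
    exact hP.not_dvd_of_natDegree_lt (C_ne_zero.2 hG0)
      (by rw [natDegree_C]; exact hdeg) this
  · intro z hz a ha h0
    have hd : (P.derivative * H1 - C r1).eval₂ (MvPolynomial.rename c).toRingHom w ∈ 𝔭 := by
      rw [eval₂_sub, eval₂_mul, eval₂_C]
      exact hH1
    rw [hdvd] at hd
    obtain ⟨Q, hQ⟩ := hd
    have h2 := congrArg (eval₂RingHom (MvPolynomial.eval z) a) hQ
    rw [map_mul, ← pe_eval_eq P, ha, zero_mul, map_sub, map_mul, ← pe_eval_eq P.derivative, pe,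
      ← derivative_map] at h2
    change (pe P z).derivative.eval a * _ - _ = 0 at h2
    rw [h0, zero_mul, zero_sub, neg_eq_zero, coe_eval₂RingHom, eval₂_C] at h2
    apply hz
    rw [map_mul, map_mul, h2]; ring
  · intro z hz h0
    exact hz (by rw [map_mul, h0, mul_zero])
  · rintro ⟨z, t⟩ ⟨hz, ht⟩
    simp only at hz ht
    have hbz : MvPolynomial.eval z b ≠ 0 := fun h0 => hz (by rw [map_mul, h0, mul_zero])
    have key : ∀ q F0, q - eval₂ (MvPolynomial.rename c).toRingHom w F0 ∈ 𝔭 →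
        MvPolynomial.eval (fun j => (pe (Rj j) z).eval t / MvPolynomial.eval z b) q =
          (pe F0 z).eval t := by
      intro q F0 hq
      obtain ⟨M, F, hF, hev⟩ := clear_denoms c w 𝔭 b Rj hR q
      have h1 : (F - C (b ^ M) * F0).eval₂ (MvPolynomial.rename c).toRingHom w ∈ 𝔭 := by
        have := 𝔭.sub_mem (𝔭.mul_mem_left (MvPolynomial.rename c b ^ M) hq) hF
        convert this using 1
        simp only [eval₂_sub, eval₂_mul, eval₂_C]
        simp only [AlgHom.toRingHom_eq_coe, RingHom.coe_coe, map_pow]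
        ring
      rw [hdvd] at h1
      obtain ⟨Q, hQ⟩ := h1
      have h2 := congrArg (eval₂RingHom (MvPolynomial.eval z) t) hQ
      rw [map_mul, ← pe_eval_eq P, ht, zero_mul, map_sub, sub_eq_zero, ← pe_eval_eq,
        map_mul, ← pe_eval_eq F0, ← hev z t hbz] at h2
      simp only [coe_eval₂RingHom, eval₂_C, map_pow] at h2
      exact mul_left_cancel₀ (pow_ne_zero _ hbz) h2
    refine ⟨fun q hq => ?_, ?_, ?_⟩
    · have := key q 0 (by simpa using hq)
      simpa [pe] using this
    · funext i
      have := key (MvPolynomial.X (c i)) (C (MvPolynomial.X i)) (by simp)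
      simpa [pe] using this
    · have := key w X (by simp)
      simpa [pe] using this
  · intro x hx hxG
    have hbz : MvPolynomial.eval (x ∘ c) b ≠ 0 := fun h0 => hxG (by rw [map_mul, h0, mul_zero])
    refine ⟨⟨hxG, ?_⟩, fun j => ?_, fun h0 => ?_⟩
    · simp only
      rw [← eval_eval2_rename]
      exact hx _ ((hdvd P).2 dvd_rfl)
    · rw [eq_div_iff hbz]
      have := hx _ (hR j)
      rw [map_sub, map_mul, eval_eval2_rename, MvPolynomial.eval_rename, MvPolynomial.eval_X] at this
      linear_combination this
    · have := hx _ hH2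
      rw [map_sub, map_mul, h0, zero_mul, zero_sub, neg_eq_zero, MvPolynomial.eval_rename] at this
      apply hxG
      rw [map_mul, map_mul, this]; ring
  · intro q hq
    obtain ⟨r, hr, H, hH⟩ := hinv q hq
    refine ⟨r, hr, fun x hx h0 => ?_⟩
    have := hx _ hH
    rwa [map_sub, map_mul, h0, zero_mul, zero_sub, neg_eq_zero, MvPolynomial.eval_rename] at this
end

section
open Polynomial Topology
open scoped ContDiff

theorem IsConstructibleSet.inter {ι : Type*} {S S' : Set (ι → ℂ)} (h : IsConstructibleSet S)
    (h' : IsConstructibleSet S') : IsConstructibleSet (S ∩ S') := by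
  have := ((h.compl).union _ _ (h'.compl)).compl
  rwa [Set.compl_union, compl_compl, compl_compl] at this

/-- complex submanifold -/
def IsCplxSub {E : Type} [NormedAddCommGroup E] [NormedSpace ℂ E] (S : Set E) : Prop :=
  ∀ x ∈ S, ∃ (J : Type) (_ : Fintype J) (U : Set E) (f : E → (J → ℂ)), IsOpen U ∧ x ∈ U ∧
    ContDiffOn ℂ ω f U ∧ (∀ y ∈ U, Function.Surjective (fderiv ℂ f y)) ∧
    S ∩ U = {y ∈ U | f y = 0}

theorem IsCplxSub.real {ι : Type} [Fintype ι] {S : Set (ι → ℂ)} (h : IsCplxSub S) :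
    IsSmoothSubmanifold S := by
  intro x hx
  obtain ⟨J, fJ, U, f, hU, hxU, hf, hs, hS⟩ := h x hx
  let d := Module.finrank ℝ (J → ℂ)
  let L : (J → ℂ) ≃L[ℝ] (Fin d → ℝ) := ContinuousLinearEquiv.ofFinrankEq (by simp [d])
  refine ⟨d, U, fun y => L (f y), hU, hxU, ?_, ?_, ?_⟩
  · have h1 : ContDiffOn ℝ (⊤ : ℕ∞) f U := (hf.restrict_scalars ℝ).of_le le_top
    exact L.contDiff.comp_contDiffOn h1
  · intro y hy
    have hd : HasFDerivAt f (fderiv ℂ f y) y :=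
      ((hf.contDiffAt (hU.mem_nhds hy)).differentiableAt (by simp)).hasFDerivAt
    have h2 : HasFDerivAt (fun y => L (f y)) ((L : (J → ℂ) →L[ℝ] (Fin d → ℝ)).comp
        ((fderiv ℂ f y).restrictScalars ℝ)) y :=
      L.hasFDerivAt.comp y (hd.restrictScalars ℝ)
    rw [h2.fderiv]
    exact L.surjective.comp (hs y hy)
  · rw [hS]
    ext y
    simp

structure NeatSet {ι : Type} [Fintype ι] (Y : Set (ι → ℂ)) : Prop where
  constr : IsConstructibleSet Y
  conn : IsConnected Y
  sub : IsCplxSub Y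
  ident : ∀ V : Set (ι → ℂ), IsOpen V → (Y ∩ V).Nonempty → ∀ q : MvPolynomial ι ℂ,
    (∀ x ∈ Y ∩ V, MvPolynomial.eval x q = 0) → ∀ x ∈ Y, MvPolynomial.eval x q = 0

theorem neat_piece {ι : Type} [Fintype ι] (𝔭 : Ideal (MvPolynomial ι ℂ)) [h𝔭 : 𝔭.IsPrime]
    (h : MvPolynomial ι ℂ) (hh : h ∉ 𝔭) :
    ∃ g, g ∉ 𝔭 ∧
      (∀ x : ι → ℂ, (∀ q ∈ 𝔭, MvPolynomial.eval x q = 0) → MvPolynomial.eval x g ≠ 0 →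
        MvPolynomial.eval x h ≠ 0) ∧
      NeatSet {x : ι → ℂ | (∀ q ∈ 𝔭, MvPolynomial.eval x q = 0) ∧ MvPolynomial.eval x g ≠ 0} := by
  classical
  obtain ⟨τ, fτ, c, hc, P, w, G, b, Rj, hP, hirr, hG0, hGp, hsep, hGb, hψ, hinv, hid⟩ :=
    param_pkg 𝔭 h hh
  let ψ : (τ → ℂ) × ℂ → (ι → ℂ) := fun u j => (pe (Rj j) u.1).eval u.2 / MvPolynomial.eval u.1 b
  have hψc : ∀ u : (τ → ℂ) × ℂ, MvPolynomial.eval u.1 b ≠ 0 → ContDiffAt ℂ ω ψ u := by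
    intro u hu
    refine contDiffAt_pi.2 fun j => ?_
    exact (contDiff_pe (Rj j)).contDiffAt.div
      (((contDiff_mvEval b).comp contDiff_fst).contDiffAt) hu
  let Y : Set (ι → ℂ) := {x | (∀ q ∈ 𝔭, MvPolynomial.eval x q = 0) ∧
    MvPolynomial.eval x (MvPolynomial.rename c G) ≠ 0}
  have hcc : Continuous (fun x : ι → ℂ => x ∘ c) := by fun_prop
  have hccs : ContDiff ℂ ω (fun x : ι → ℂ => x ∘ c) := by
    refine contDiff_pi.2 fun j => ?_
    exact contDiff_apply ℂ ℂ (c j)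
  have hYmem : ∀ x, x ∈ Y ↔ (∀ q ∈ 𝔭, MvPolynomial.eval x q = 0) ∧
      MvPolynomial.eval (x ∘ c) G ≠ 0 := by
    intro x
    simp only [Y, Set.mem_ofPred_eq, MvPolynomial.eval_rename]
  have hψY : ∀ u ∈ coverSet P G, ψ u ∈ Y := by
    intro u hu
    obtain ⟨h1, h2, h3⟩ := hψ u hu
    rw [hYmem]
    refine ⟨h1, ?_⟩
    change MvPolynomial.eval ((ψ u) ∘ c) G ≠ 0
    rw [show ψ u ∘ c = u.1 from h2]
    exact hu.1
  have hYψ : ∀ x ∈ Y, (x ∘ c, MvPolynomial.eval x w) ∈ coverSet P G ∧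
      ψ (x ∘ c, MvPolynomial.eval x w) = x := by
    intro x hx
    rw [hYmem] at hx
    obtain ⟨h1, h2, h3⟩ := hinv x hx.1 hx.2
    exact ⟨h1, funext fun j => (h2 j).symm⟩
  -- local sections
  have hloc : ∀ x0 ∈ Y, ∃ Θ : (τ → ℂ) → ℂ, Θ (x0 ∘ c) = MvPolynomial.eval x0 w ∧
      (∀ᶠ z in 𝓝 (x0 ∘ c), ContDiffAt ℂ ω Θ z ∧ (z, Θ z) ∈ coverSet P G) ∧
      ∀ᶠ x in 𝓝 x0, x ∈ Y → MvPolynomial.eval x w = Θ (x ∘ c) := by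
    intro x0 hx0
    obtain ⟨hcov, hx0ψ⟩ := hYψ x0 hx0
    obtain ⟨θ, hθ0, hθ⟩ := local_roots P hP (x0 ∘ c) (hsep _ hcov.1)
    set t0 := MvPolynomial.eval x0 w with ht0
    have hroot : t0 ∈ (pe P (x0 ∘ c)).roots.toFinset := (mem_roots_pe hP _ _).2 hcov.2
    refine ⟨θ t0, hθ0 _ hroot, ?_, ?_⟩
    · filter_upwards [hθ, (isOpen_polyne G).mem_nhds hcov.1] with z hz hzG
      refine ⟨hz.1 _ hroot, hzG, ?_⟩
      simp only
      rw [hz.2.2, eval_prod]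
      exact Finset.prod_eq_zero hroot (by simp)
    · have hsepa : ∀ᶠ x in 𝓝 x0, ∀ a ∈ (pe P (x0 ∘ c)).roots.toFinset, a ≠ t0 →
          MvPolynomial.eval x w ≠ θ a (x ∘ c) := by
        rw [Filter.eventually_all_finset]
        intro a ha
        by_cases hat : a = t0
        · simp [hat]
        · have c1 : ContinuousAt (fun x : ι → ℂ => MvPolynomial.eval x w) x0 :=
            (contDiff_mvEval w).continuous.continuousAt
          have c2 : ContinuousAt (fun x : ι → ℂ => θ a (x ∘ c)) x0 :=
            ContinuousAt.comp (f := fun x : ι → ℂ => x ∘ c) (g := θ a)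
              (hθ.self_of_nhds.1 a ha).continuousAt hcc.continuousAt
          have hne : MvPolynomial.eval x0 w ≠ θ a (x0 ∘ c) := by
            rw [hθ0 a ha]; exact fun h => hat h.symm
          filter_upwards [(c1.sub c2).eventually_ne (sub_ne_zero.2 hne)] with x hx _
            using sub_ne_zero.1 hx
      filter_upwards [hsepa, hcc.continuousAt.eventually hθ] with x h1 h2 hxY
      have h3 := (hYψ x hxY).1.2
      simp only at h3
      rw [h2.2.2, eval_prod, Finset.prod_eq_zero_iff] at h3
      obtain ⟨a, ha, ha2⟩ := h3
      simp only [eval_sub, eval_X, eval_C, sub_eq_zero] at ha2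
      by_cases hat : a = t0
      · rw [← hat]; exact ha2
      · exact absurd ha2 (h1 a ha hat)
  refine ⟨MvPolynomial.rename c G, hGp, fun x hx hxg => ?_, ?_⟩
  · rw [MvPolynomial.eval_rename] at hxg
    exact (hinv x hx hxg).2.2
  change NeatSet Y
  refine ⟨?_, ?_, ?_, ?_⟩
  · refine IsConstructibleSet.inter (S := {x | ∀ q ∈ 𝔭, MvPolynomial.eval x q = 0})
      (S' := {x | MvPolynomial.eval x (MvPolynomial.rename c G) = 0}ᶜ) ?_ ?_
    · exact .of_closed _ ⟨𝔭, rfl⟩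
    · exact .compl _ (.of_closed _ ⟨{MvPolynomial.rename c G}, by simp⟩)
  · have him : Y = ψ '' coverSet P G := by
      ext x
      constructor
      · intro hx
        exact ⟨_, hYψ x hx⟩
      · rintro ⟨u, hu, rfl⟩
        exact hψY u hu
    rw [him]
    refine (cover_connected P hP hirr G hG0 hsep).image ψ fun u hu => ?_
    exact (hψc u (hGb _ hu.1)).continuousAt.continuousWithinAt
  · intro x0 hx0
    obtain ⟨Θ, hΘ0, hΘ, hΘY⟩ := hloc x0 hx0
    have hev := hΘY.and (hcc.continuousAt.eventually hΘ)
    obtain ⟨U, hUsub, hUo, hxU⟩ := mem_nhds_iff.1 hev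
    let f : (ι → ℂ) → ({j : ι // j ∉ Set.range c} → ℂ) :=
      fun x j => x j - ψ (x ∘ c, Θ (x ∘ c)) j
    have hfc : ∀ x ∈ U, ContDiffAt ℂ ω f x := by
      intro x hx
      obtain ⟨h1, h2, h3⟩ := hUsub hx
      refine contDiffAt_pi.2 fun j => ?_
      refine (contDiff_apply ℂ ℂ (j : ι)).contDiffAt.sub ?_
      have e1 : ContDiffAt ℂ ω (fun x : ι → ℂ => (x ∘ c, Θ (x ∘ c))) x :=
        hccs.contDiffAt.prodMk (ContDiffAt.comp (g := Θ) x h2 hccs.contDiffAt)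
      have e2 := contDiffAt_pi.1 (hψc (x ∘ c, Θ (x ∘ c)) (hGb _ h3.1)) j
      exact ContDiffAt.comp (g := fun u => ψ u j) x e2 e1
    refine ⟨_, inferInstance, U, f, hUo, hxU, fun x hx => (hfc x hx).contDiffWithinAt, ?_, ?_⟩
    · intro x hx v
      let v' : ι → ℂ := fun j => if hj : j ∉ Set.range c then v ⟨j, hj⟩ else 0
      have hv'c : ∀ s : ℂ, (x + s • v') ∘ c = x ∘ c := by
        intro s; funext i; simp [v']
      have hv'j : ∀ j : {j : ι // j ∉ Set.range c}, v' j = v j := by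
        intro j; simp only [v', dif_pos j.2]
      refine ⟨v', ?_⟩
      have hd : DifferentiableAt ℂ f x := (hfc x hx).differentiableAt (by simp)
      rw [← hd.lineDeriv_eq_fderiv]
      have hline : ∀ s : ℂ, f (x + s • v') = f x + s • v := by
        intro s
        funext j
        simp only [f, hv'c, Pi.add_apply, Pi.smul_apply, hv'j]
        ring
      rw [lineDeriv]
      simp only [hline]
      have : HasDerivAt (fun s : ℂ => f x + s • v) ((1 : ℂ) • v) 0 :=
        ((hasDerivAt_id (0 : ℂ)).smul_const v).const_add (f x)
      rw [this.deriv, one_smul]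
    · ext x
      constructor
      · rintro ⟨hxY, hx⟩
        refine ⟨hx, ?_⟩
        obtain ⟨h1, h2, h3⟩ := hUsub hx
        funext j
        simp only [f, Pi.zero_apply]
        rw [← h1 hxY, (hYψ x hxY).2, sub_self]
      · rintro ⟨hx, hfx⟩
        refine ⟨?_, hx⟩
        obtain ⟨h1, h2, h3⟩ := hUsub hx
        have : x = ψ (x ∘ c, Θ (x ∘ c)) := by
          funext j
          by_cases hj : j ∈ Set.range c
          · obtain ⟨i, rfl⟩ := hj
            exact (congrFun (hψ _ h3).2.1 i).symm
          · have := congrFun hfx ⟨j, hj⟩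
            exact sub_eq_zero.1 this
        rw [this]
        exact hψY _ h3
  · rintro V hV ⟨x0, hx0, hx0V⟩ q hq x hx
    by_contra hne
    have hqp : q ∉ 𝔭 := fun hqp => hne (((hYmem x).1 hx).1 q hqp)
    obtain ⟨r, hr, hrz⟩ := hid q hqp
    obtain ⟨Θ, hΘ0, hΘ, hΘY⟩ := hloc x0 hx0
    have h0 := hΘ.self_of_nhds
    have hcont : ContinuousAt (fun z => ψ (z, Θ z)) (x0 ∘ c) :=
      ContinuousAt.comp (f := fun z => (z, Θ z)) (g := ψ)
        (hψc (x0 ∘ c, Θ (x0 ∘ c)) (hGb _ h0.2.1)).continuousAt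
        (continuousAt_id.prodMk h0.1.continuousAt)
    have hval : ψ (x0 ∘ c, Θ (x0 ∘ c)) = x0 := by
      rw [hΘ0]; exact (hYψ x0 hx0).2
    have hVn : V ∈ 𝓝 (ψ (x0 ∘ c, Θ (x0 ∘ c))) := by rw [hval]; exact hV.mem_nhds hx0V
    have hev := hΘ.and (hcont.eventually hVn)
    obtain ⟨U, hUsub, hUo, hxU⟩ := mem_nhds_iff.1 hev
    refine hr (poly_zero_of_open r U hUo ⟨_, hxU⟩ fun z hz => ?_)
    obtain ⟨⟨h1, h2⟩, h3⟩ := hUsub hz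
    have hY := hψY _ h2
    have := hrz (ψ (z, Θ z)) ((hYmem _).1 hY).1 (hq _ ⟨hY, h3⟩)
    rwa [show ψ (z, Θ z) ∘ c = z from (hψ _ h2).2.1] at this
end

section

/-- zero locus -/
def zl {ι : Type} (J : Ideal (MvPolynomial ι ℂ)) : Set (ι → ℂ) :=
  {x | ∀ q ∈ J, MvPolynomial.eval x q = 0}

theorem zl_sup {ι : Type} (J : Ideal (MvPolynomial ι ℂ)) (a : MvPolynomial ι ℂ) :
    zl (J ⊔ Ideal.span {a}) = zl J ∩ {x | MvPolynomial.eval x a = 0} := by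
  ext x
  constructor
  · intro hx
    exact ⟨fun q hq => hx q (Ideal.mem_sup_left hq),
      hx a (Ideal.mem_sup_right (Ideal.mem_span_singleton_self a))⟩
  · rintro ⟨h1, h2⟩ q hq
    have : J ⊔ Ideal.span {a} ≤ RingHom.ker (MvPolynomial.eval x) := by
      refine sup_le (fun q hq => h1 q hq) ?_
      rw [Ideal.span_le, Set.singleton_subset_iff]
      exact h2
    exact this hq

theorem constr_generic {ι : Type} (𝔭 : Ideal (MvPolynomial ι ℂ)) [h𝔭 : 𝔭.IsPrime]
    {S : Set (ι → ℂ)} (hS : IsConstructibleSet S) :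
    ∃ h, h ∉ 𝔭 ∧ ((∀ x ∈ zl 𝔭, MvPolynomial.eval x h ≠ 0 → x ∈ S) ∨
      (∀ x ∈ zl 𝔭, MvPolynomial.eval x h ≠ 0 → x ∉ S)) := by
  induction hS with
  | of_closed S hS =>
    obtain ⟨P, rfl⟩ := hS
    by_cases hP : ∀ q ∈ P, q ∈ 𝔭
    · refine ⟨1, fun h => h𝔭.ne_top ((Ideal.eq_top_iff_one _).2 h), Or.inl fun x hx _ q hq => ?_⟩
      exact hx q (hP q hq)
    · push Not at hP
      obtain ⟨q, hq, hq2⟩ := hP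
      exact ⟨q, hq2, Or.inr fun x hx hne hmem => hne (hmem q hq)⟩
  | compl S _ ih =>
    obtain ⟨h, hh, h1 | h1⟩ := ih
    · exact ⟨h, hh, Or.inr fun x hx hne hm => hm (h1 x hx hne)⟩
    · exact ⟨h, hh, Or.inl fun x hx hne => h1 x hx hne⟩
  | union S S' _ _ ih ih' =>
    obtain ⟨h, hh, h1 | h1⟩ := ih
    · exact ⟨h, hh, Or.inl fun x hx hne => Or.inl (h1 x hx hne)⟩
    obtain ⟨h', hh', h2 | h2⟩ := ih'
    · exact ⟨h', hh', Or.inl fun x hx hne => Or.inr (h2 x hx hne)⟩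
    refine ⟨h * h', fun hm => (h𝔭.mem_or_mem hm).elim hh hh', Or.inr fun x hx hne => ?_⟩
    rw [map_mul] at hne
    rintro (hm | hm)
    · exact h1 x hx (left_ne_zero_of_mul hne) hm
    · exact h2 x hx (right_ne_zero_of_mul hne) hm

/-- finite union of neat sets -/
def FinNeat {ι : Type} [Fintype ι] (S : Set (ι → ℂ)) : Prop :=
  ∃ 𝒴 : Set (Set (ι → ℂ)), 𝒴.Finite ∧ (∀ Y ∈ 𝒴, NeatSet Y) ∧ S = ⋃₀ 𝒴

theorem FinNeat.union {ι : Type} [Fintype ι] {S S' : Set (ι → ℂ)} (h : FinNeat S)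
    (h' : FinNeat S') : FinNeat (S ∪ S') := by
  obtain ⟨A, hA, hA1, rfl⟩ := h
  obtain ⟨B, hB, hB1, rfl⟩ := h'
  refine ⟨A ∪ B, hA.union hB, ?_, ?_⟩
  · rintro Y (hY | hY)
    · exact hA1 Y hY
    · exact hB1 Y hY
  · rw [Set.sUnion_union]

theorem decomp {ι : Type} [Fintype ι] {S : Set (ι → ℂ)} (hS : IsConstructibleSet S) :
    FinNeat S := by
  have key : ∀ J : Ideal (MvPolynomial ι ℂ), FinNeat (S ∩ zl J) := by
    intro J
    induction J using WellFoundedGT.induction with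
    | _ J ih =>
    have hlt : ∀ a, a ∉ J → J < J ⊔ Ideal.span {a} := by
      intro a ha
      refine lt_of_le_of_ne le_sup_left fun h => ha ?_
      rw [h]
      exact Ideal.mem_sup_right (Ideal.mem_span_singleton_self a)
    by_cases hJ : J.IsPrime
    · obtain ⟨h, hh, h1 | h1⟩ := constr_generic J hS
      · obtain ⟨g, hg, hgh, hneat⟩ := neat_piece J h hh
        have e : S ∩ zl J = {x : ι → ℂ | (∀ q ∈ J, MvPolynomial.eval x q = 0) ∧
            MvPolynomial.eval x g ≠ 0} ∪ (S ∩ zl (J ⊔ Ideal.span {g})) := by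
          rw [zl_sup]
          ext x
          constructor
          · rintro ⟨hx, hxJ⟩
            by_cases h0 : MvPolynomial.eval x g = 0
            · exact Or.inr ⟨hx, hxJ, h0⟩
            · exact Or.inl ⟨hxJ, h0⟩
          · rintro (⟨hxJ, h0⟩ | ⟨hx, hxJ, _⟩)
            · exact ⟨h1 x hxJ (hgh x hxJ h0), hxJ⟩
            · exact ⟨hx, hxJ⟩
        rw [e]
        refine FinNeat.union ⟨{_}, Set.finite_singleton _, ?_, (Set.sUnion_singleton _).symm⟩
          (ih _ (hlt g hg))
        rintro Y rfl
        exact hneat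
      · have e : S ∩ zl J = S ∩ zl (J ⊔ Ideal.span {h}) := by
          rw [zl_sup]
          ext x
          constructor
          · rintro ⟨hx, hxJ⟩
            refine ⟨hx, hxJ, ?_⟩
            by_contra h0
            exact h1 x hxJ h0 hx
          · rintro ⟨hx, hxJ, _⟩
            exact ⟨hx, hxJ⟩
        rw [e]
        exact ih _ (hlt h hh)
    · rw [Ideal.not_isPrime_iff] at hJ
      rcases hJ with rfl | ⟨a, ha, b, hb, hab⟩
      · refine ⟨∅, Set.finite_empty, by simp, ?_⟩
        rw [Set.sUnion_empty, Set.eq_empty_iff_forall_notMem]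
        rintro x ⟨_, hx⟩
        have := hx 1 trivial
        simp at this
      · have e : S ∩ zl J = (S ∩ zl (J ⊔ Ideal.span {a})) ∪ (S ∩ zl (J ⊔ Ideal.span {b})) := by
          rw [zl_sup, zl_sup]
          ext x
          constructor
          · rintro ⟨hx, hxJ⟩
            have := hxJ _ hab
            rw [map_mul, mul_eq_zero] at this
            rcases this with h0 | h0
            · exact Or.inl ⟨hx, hxJ, h0⟩
            · exact Or.inr ⟨hx, hxJ, h0⟩
          · rintro (⟨hx, hxJ, _⟩ | ⟨hx, hxJ, _⟩) <;> exact ⟨hx, hxJ⟩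
        rw [e]
        exact (ih _ (hlt a ha)).union (ih _ (hlt b hb))
  have := key ⊥
  have e : zl (⊥ : Ideal (MvPolynomial ι ℂ)) = Set.univ := by
    ext x; simp [zl]
  rwa [e, Set.inter_univ] at this

theorem IsConstructibleSet.preimage_poly {ι κ : Type*} {S : Set (ι → ℂ)}
    (hS : IsConstructibleSet S) (f : ι → MvPolynomial κ ℂ) :
    IsConstructibleSet {y : κ → ℂ | (fun j => MvPolynomial.eval y (f j)) ∈ S} := by
  induction hS with
  | of_closed S hS =>
    obtain ⟨P, rfl⟩ := hS
    refine .of_closed _ ⟨MvPolynomial.bind₁ f '' P, ?_⟩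
    ext y
    simp only [Set.mem_ofPred_eq, Set.forall_mem_image]
    refine forall₂_congr fun q _ => ?_
    have := MvPolynomial.eval₂Hom_bind₁ (RingHom.id ℂ) y f q
    exact (congrArg (· = 0) this).to_iff.symm
  | compl S _ ih => exact ih.compl
  | union S S' _ _ ih ih' => exact ih.union _ _ ih'

/-- a polynomial composed with a rational map with denominator `δ` -/
theorem rational_comp {ι κ : Type*} (f : ι → MvPolynomial κ ℂ) (δ : MvPolynomial κ ℂ)
    (q : MvPolynomial ι ℂ) : ∃ (M : ℕ) (Q : MvPolynomial κ ℂ), ∀ y : κ → ℂ,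
      MvPolynomial.eval y δ ≠ 0 → MvPolynomial.eval y δ ^ M *
        MvPolynomial.eval (fun j => MvPolynomial.eval y (f j) / MvPolynomial.eval y δ) q =
        MvPolynomial.eval y Q := by
  induction q using MvPolynomial.induction_on with
  | C a => exact ⟨0, MvPolynomial.C a, fun y _ => by simp⟩
  | add p q hp hq =>
    obtain ⟨M1, F1, e1⟩ := hp
    obtain ⟨M2, F2, e2⟩ := hq
    refine ⟨M1 + M2, δ ^ M2 * F1 + δ ^ M1 * F2, fun y hy => ?_⟩
    rw [map_add, map_add, map_mul, map_mul, ← e1 y hy, ← e2 y hy, map_pow, map_pow]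
    ring
  | mul_X p j hp =>
    obtain ⟨M1, F1, e1⟩ := hp
    refine ⟨M1 + 1, F1 * f j, fun y hy => ?_⟩
    rw [map_mul, MvPolynomial.eval_X, map_mul, ← e1 y hy]
    field_simp
    ring

theorem IsConstructibleSet.polyne {κ : Type*} (δ : MvPolynomial κ ℂ) :
    IsConstructibleSet {y : κ → ℂ | MvPolynomial.eval y δ ≠ 0} :=
  .compl {y : κ → ℂ | MvPolynomial.eval y δ = 0} (.of_closed _ ⟨{δ}, by simp⟩)

theorem IsConstructibleSet.preimage_rat {ι κ : Type*} {S : Set (ι → ℂ)}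
    (hS : IsConstructibleSet S) (f : ι → MvPolynomial κ ℂ) (δ : MvPolynomial κ ℂ) :
    IsConstructibleSet {y : κ → ℂ | MvPolynomial.eval y δ ≠ 0 ∧
      (fun j => MvPolynomial.eval y (f j) / MvPolynomial.eval y δ) ∈ S} := by
  induction hS with
  | of_closed S hS =>
    obtain ⟨P, rfl⟩ := hS
    choose M Q hQ using rational_comp f δ
    have : {y : κ → ℂ | MvPolynomial.eval y δ ≠ 0 ∧
      (fun j => MvPolynomial.eval y (f j) / MvPolynomial.eval y δ) ∈
        {x | ∀ q ∈ P, MvPolynomial.eval x q = 0}} = {y : κ → ℂ | MvPolynomial.eval y δ ≠ 0} ∩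
        {y | ∀ q ∈ Q '' P, MvPolynomial.eval y q = 0} := by
      ext y
      simp only [Set.mem_ofPred_eq, Set.mem_inter_iff, Set.forall_mem_image]
      refine and_congr_right fun hy => forall₂_congr fun q _ => ?_
      rw [← hQ q y hy, mul_eq_zero, or_iff_right (pow_ne_zero _ hy)]
    rw [this]
    exact (IsConstructibleSet.polyne δ).inter (.of_closed _ ⟨_, rfl⟩)
  | compl S _ ih =>
    have := (IsConstructibleSet.polyne δ).inter ih.compl
    convert this using 1
    ext y
    simp only [Set.mem_ofPred_eq, Set.mem_inter_iff, Set.mem_compl_iff]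
    tauto
  | union S S' _ _ ih ih' =>
    convert ih.union _ _ ih' using 1
    ext y
    simp only [Set.mem_ofPred_eq, Set.mem_union]
    tauto
end

section
open Topology
open scoped ContDiff

/-- minor with columns `e` -/
def mnr {n k : ℕ} (e : Fin k → Fin n) (p : PIdx n k → ℂ) : Matrix (Fin k) (Fin k) ℂ :=
  (matP p).submatrix id e

/-- left multiplication -/
def actP {n k : ℕ} (h : Matrix (Fin k) (Fin k) ℂ) (p : PIdx n k → ℂ) : PIdx n k → ℂ :=
  Sum.elim (fun rc => (h * matP p) rc.1 rc.2) (fun r => h.mulVec (vecP p) r)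

theorem matP_actP {n k : ℕ} (h : Matrix (Fin k) (Fin k) ℂ) (p : PIdx n k → ℂ) :
    matP (actP h p) = h * matP p := rfl

theorem vecP_actP {n k : ℕ} (h : Matrix (Fin k) (Fin k) ℂ) (p : PIdx n k → ℂ) :
    vecP (actP h p) = h.mulVec (vecP p) := rfl

theorem ext_mv {n k : ℕ} {p q : PIdx n k → ℂ} (h1 : matP p = matP q) (h2 : vecP p = vecP q) :
    p = q := by
  funext a
  rcases a with ⟨r, c⟩ | r
  · exact congrFun (congrFun h1 r) c
  · exact congrFun h2 r

theorem actP_actP {n k : ℕ} (h h' : Matrix (Fin k) (Fin k) ℂ) (p : PIdx n k → ℂ) :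
    actP h (actP h' p) = actP (h * h') p := by
  apply ext_mv
  · simp only [matP_actP, Matrix.mul_assoc]
  · simp only [vecP_actP, Matrix.mulVec_mulVec]

theorem actP_one {n k : ℕ} (p : PIdx n k → ℂ) : actP 1 p = p := by
  apply ext_mv
  · simp only [matP_actP, Matrix.one_mul]
  · simp only [vecP_actP, Matrix.one_mulVec]

theorem mnr_actP {n k : ℕ} (e : Fin k → Fin n) (h : Matrix (Fin k) (Fin k) ℂ)
    (p : PIdx n k → ℂ) : mnr e (actP h p) = h * mnr e p := rfl

/-- free coordinates -/
abbrev FreeIdx {n k : ℕ} (e : Fin k → Fin n) := {a : PIdx n k // ∀ r r', a ≠ Sum.inl (r, e r')}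

open Classical in
/-- polynomial coordinates of the chart -/
noncomputable def secPoly {n k : ℕ} (e : Fin k → Fin n) (a : PIdx n k) :
    MvPolynomial (FreeIdx e) ℂ :=
  if h : ∀ r r', a ≠ Sum.inl (r, e r') then MvPolynomial.X ⟨a, h⟩ else
    MvPolynomial.C (Sum.elim (fun rc => if e rc.1 = rc.2 then (1 : ℂ) else 0) (fun _ => 0) a)

/-- chart -/
noncomputable def sec {n k : ℕ} (e : Fin k → Fin n) (y : FreeIdx e → ℂ) : PIdx n k → ℂ :=
  fun a => MvPolynomial.eval y (secPoly e a)

theorem sec_free {n k : ℕ} (e : Fin k → Fin n) (y : FreeIdx e → ℂ) (a : FreeIdx e) :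
    sec e y a = y a := by
  simp only [sec, secPoly, dif_pos a.2, MvPolynomial.eval_X]

theorem mnr_sec {n k : ℕ} {e : Fin k → Fin n} (he : Function.Injective e) (y : FreeIdx e → ℂ) :
    mnr e (sec e y) = 1 := by
  ext r r'
  have : ¬ ∀ s s', (Sum.inl (r, e r') : PIdx n k) ≠ Sum.inl (s, e s') := fun h => h r r' rfl
  simp only [mnr, matP, Matrix.submatrix_apply, Matrix.of_apply, sec, secPoly, id, dif_neg this,
    MvPolynomial.eval_C, Sum.elim_inl, he.eq_iff, Matrix.one_apply]

/-- restriction to the free coordinates -/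
def resP {n k : ℕ} (e : Fin k → Fin n) (p : PIdx n k → ℂ) : FreeIdx e → ℂ := fun a => p a

theorem res_sec {n k : ℕ} (e : Fin k → Fin n) (y : FreeIdx e → ℂ) : resP e (sec e y) = y :=
  funext fun a => sec_free e y a

theorem sec_res {n k : ℕ} {e : Fin k → Fin n} (he : Function.Injective e) {p : PIdx n k → ℂ}
    (hp : mnr e p = 1) : sec e (resP e p) = p := by
  funext a
  by_cases h : ∀ r r', a ≠ Sum.inl (r, e r')
  · exact sec_free e (resP e p) ⟨a, h⟩
  · push Not at h
    obtain ⟨r, r', rfl⟩ := h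
    have h1 := congrFun (congrFun (mnr_sec he (resP e p)) r) r'
    have h2 := congrFun (congrFun hp r) r'
    exact h1.trans h2.symm

/-- coordinates of a parameter -/
noncomputable def phiP {n k : ℕ} (e : Fin k → Fin n) (p : PIdx n k → ℂ) : FreeIdx e → ℂ :=
  resP e (actP (mnr e p)⁻¹ p)

theorem sec_phi {n k : ℕ} {e : Fin k → Fin n} (he : Function.Injective e) {p : PIdx n k → ℂ}
    (hp : (mnr e p).det ≠ 0) : actP (mnr e p) (sec e (phiP e p)) = p := by
  have hu : IsUnit (mnr e p).det := isUnit_iff_ne_zero.2 hp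
  rw [phiP, sec_res he, actP_actP, Matrix.mul_nonsing_inv _ hu, actP_one]
  rw [mnr_actP, Matrix.nonsing_inv_mul _ hu]

theorem mnr_act_sec {n k : ℕ} {e : Fin k → Fin n} (he : Function.Injective e)
    (h : Matrix (Fin k) (Fin k) ℂ) (y : FreeIdx e → ℂ) : mnr e (actP h (sec e y)) = h := by
  rw [mnr_actP, mnr_sec he, Matrix.mul_one]

theorem phi_act_sec {n k : ℕ} {e : Fin k → Fin n} (he : Function.Injective e)
    {h : Matrix (Fin k) (Fin k) ℂ} (hh : h.det ≠ 0) (y : FreeIdx e → ℂ) :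
    phiP e (actP h (sec e y)) = y := by
  rw [phiP, mnr_act_sec he, actP_actP, Matrix.nonsing_inv_mul _ (isUnit_iff_ne_zero.2 hh),
    actP_one, res_sec]

theorem mulVec_inj_of_det {k : ℕ} {h : Matrix (Fin k) (Fin k) ℂ} (hh : h.det ≠ 0) :
    Function.Injective h.mulVec :=
  Matrix.mulVec_injective_iff_isUnit.2 ((Matrix.isUnit_iff_isUnit_det _).2 (isUnit_iff_ne_zero.2 hh))

theorem flatP_actP {n k : ℕ} {h : Matrix (Fin k) (Fin k) ℂ} (hh : h.det ≠ 0)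
    (p : PIdx n k → ℂ) : flatP (actP h p) = flatP p := by
  ext x
  simp only [flatP, Set.mem_ofPred_eq, matP_actP, vecP_actP, ← Matrix.mulVec_mulVec]
  exact (mulVec_inj_of_det hh).eq_iff

theorem dirP_actP {n k : ℕ} {h : Matrix (Fin k) (Fin k) ℂ} (hh : h.det ≠ 0)
    (p : PIdx n k → ℂ) : dirP (actP h p) = dirP p := by
  ext x
  simp only [dirP, LinearMap.mem_ker, Matrix.mulVecLin_apply, matP_actP, ← Matrix.mulVec_mulVec]
  exact ⟨fun hx => mulVec_inj_of_det hh (by rw [hx, Matrix.mulVec_zero]),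
    fun hx => by rw [hx, Matrix.mulVec_zero]⟩

theorem mem_paramSet {n k : ℕ} (p : PIdx n k → ℂ) :
    p ∈ paramSet n k ↔ Function.Surjective (matP p).mulVec := by
  have : Function.Surjective (matP p).mulVec ↔ LinearMap.range (matP p).mulVecLin = ⊤ := by
    rw [LinearMap.range_eq_top]; rfl
  rw [this, paramSet, Set.mem_ofPred_eq]
  constructor
  · intro h
    apply Submodule.eq_top_of_finrank_eq
    rw [h]; simp
  · intro h
    rw [h]; simp

/-- inclusion of columns -/
def Einc {n k : ℕ} (e : Fin k → Fin n) : Matrix (Fin n) (Fin k) ℂ :=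
  Matrix.of fun c r => if c = e r then 1 else 0

theorem mul_Einc {n k : ℕ} (e : Fin k → Fin n) (p : PIdx n k → ℂ) :
    matP p * Einc e = mnr e p := by
  ext r r'
  simp [Matrix.mul_apply, Einc, mnr]

theorem mem_paramSet_of_det {n k : ℕ} {e : Fin k → Fin n} {p : PIdx n k → ℂ}
    (hp : (mnr e p).det ≠ 0) : p ∈ paramSet n k := by
  rw [mem_paramSet]
  have h1 : Function.Surjective (mnr e p).mulVec :=
    Matrix.mulVec_surjective_iff_isUnit.2
      ((Matrix.isUnit_iff_isUnit_det _).2 (isUnit_iff_ne_zero.2 hp))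
  intro v
  obtain ⟨u, hu⟩ := h1 v
  exact ⟨(Einc e).mulVec u, by rw [Matrix.mulVec_mulVec, mul_Einc, hu]⟩

theorem exists_minor {n k : ℕ} {p : PIdx n k → ℂ} (hp : p ∈ paramSet n k) :
    ∃ e : Fin k → Fin n, Function.Injective e ∧ (mnr e p).det ≠ 0 := by
  have h1 : Module.finrank ℂ (Submodule.span ℂ (Set.range (matP p).col)) = k := by
    rw [← Matrix.range_mulVecLin]; exact hp
  obtain ⟨f, hf, -, hli⟩ := Submodule.exists_fun_fin_finrank_span_eq ℂ (Set.range (matP p).col)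
  choose e' he' using hf
  have hli2 := hli.comp (Fin.cast h1.symm) (Fin.cast_injective _)
  have hcol : (mnr (fun r => e' (Fin.cast h1.symm r)) p).col = f ∘ Fin.cast h1.symm := by
    funext r
    exact he' (Fin.cast h1.symm r)
  refine ⟨fun r => e' (Fin.cast h1.symm r), ?_, ?_⟩
  · intro r r' hrr
    apply hli2.injective
    simp only [Function.comp_apply, ← he']
    exact congrArg _ hrr
  · apply isUnit_iff_ne_zero.1
    apply (Matrix.isUnit_iff_isUnit_det _).1
    apply Matrix.linearIndependent_cols_iff_isUnit.1
    rw [hcol]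
    exact hli2

theorem flat_unique {n k : ℕ} {e : Fin k → Fin n} (he : Function.Injective e)
    {p : PIdx n k → ℂ} (hp : p ∈ paramSet n k) {y : FreeIdx e → ℂ}
    (h : flatP p = flatP (sec e y)) : (mnr e p).det ≠ 0 ∧ phiP e p = y := by
  have hE : matP (sec e y) * Einc e = 1 := by rw [mul_Einc, mnr_sec he]
  have hx0 : (Einc e).mulVec (vecP (sec e y)) ∈ flatP p := by
    rw [h, flatP, Set.mem_ofPred_eq, Matrix.mulVec_mulVec, hE, Matrix.one_mulVec]
  have hker : ∀ v, (matP (sec e y)).mulVec v = 0 → (matP p).mulVec v = 0 := by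
    intro v hv
    have h2 : (Einc e).mulVec (vecP (sec e y)) + v ∈ flatP p := by
      rw [h] at hx0 ⊢
      rw [flatP, Set.mem_ofPred_eq] at hx0 ⊢
      rw [Matrix.mulVec_add, hx0, hv, add_zero]
    rw [flatP, Set.mem_ofPred_eq] at hx0 h2
    rw [Matrix.mulVec_add, hx0] at h2
    simpa using h2
  have hM : matP p = mnr e p * matP (sec e y) := by
    apply Matrix.ext_of_mulVec_single
    intro i
    generalize (Pi.single i 1 : Fin n → ℂ) = v
    have h3 := hker (v - (Einc e).mulVec ((matP (sec e y)).mulVec v)) (by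
      rw [Matrix.mulVec_sub, Matrix.mulVec_mulVec, hE, Matrix.one_mulVec, sub_self])
    rw [Matrix.mulVec_sub, Matrix.mulVec_mulVec, mul_Einc, sub_eq_zero] at h3
    rw [h3, Matrix.mulVec_mulVec]
  have hv : vecP p = (mnr e p).mulVec (vecP (sec e y)) := by
    rw [flatP, Set.mem_ofPred_eq, Matrix.mulVec_mulVec, mul_Einc] at hx0
    exact hx0.symm
  have hdet : (mnr e p).det ≠ 0 := by
    rw [mem_paramSet] at hp
    have hs : Function.Surjective (mnr e p).mulVec := by
      intro v
      obtain ⟨u, hu⟩ := hp v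
      refine ⟨(matP (sec e y)).mulVec u, ?_⟩
      rw [Matrix.mulVec_mulVec, ← hM, hu]
    exact isUnit_iff_ne_zero.1 ((Matrix.isUnit_iff_isUnit_det _).1
      (Matrix.mulVec_surjective_iff_isUnit.1 hs))
  refine ⟨hdet, ?_⟩
  have hpe : p = actP (mnr e p) (sec e y) := ext_mv hM hv
  calc phiP e p = phiP e (actP (mnr e p) (sec e y)) := by rw [← hpe]
    _ = y := phi_act_sec he hdet y
end

section
open Topology
open scoped ContDiff

/-- generic minor matrix -/
noncomputable def mnrMat {n k : ℕ} (e : Fin k → Fin n) :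
    Matrix (Fin k) (Fin k) (MvPolynomial (PIdx n k) ℂ) :=
  Matrix.of fun r r' => MvPolynomial.X (Sum.inl (r, e r'))

theorem mnrMat_map {n k : ℕ} (e : Fin k → Fin n) (p : PIdx n k → ℂ) :
    (MvPolynomial.eval p).mapMatrix (mnrMat e) = mnr e p := by
  ext r r'
  simp [mnrMat, mnr, matP]

theorem eval_detP {n k : ℕ} (e : Fin k → Fin n) (p : PIdx n k → ℂ) :
    MvPolynomial.eval p (mnrMat e).det = (mnr e p).det := by
  rw [RingHom.map_det, mnrMat_map]

theorem eval_adjP {n k : ℕ} (e : Fin k → Fin n) (p : PIdx n k → ℂ) (r j : Fin k) :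
    MvPolynomial.eval p ((mnrMat e).adjugate r j) = (mnr e p).adjugate r j := by
  have := RingHom.map_adjugate (MvPolynomial.eval p) (mnrMat e)
  rw [mnrMat_map] at this
  rw [← this]; rfl

/-- numerators -/
noncomputable def numP {n k : ℕ} (e : Fin k → Fin n) : PIdx n k → MvPolynomial (PIdx n k) ℂ :=
  Sum.elim (fun rc => ∑ j, (mnrMat e).adjugate rc.1 j * MvPolynomial.X (Sum.inl (j, rc.2)))
    (fun r => ∑ j, (mnrMat e).adjugate r j * MvPolynomial.X (Sum.inr j))

theorem phiP_eq {n k : ℕ} (e : Fin k → Fin n) (p : PIdx n k → ℂ) :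
    phiP e p = fun a : FreeIdx e =>
      MvPolynomial.eval p (numP e a) / MvPolynomial.eval p (mnrMat e).det := by
  funext ⟨a, ha⟩
  rcases a with ⟨r, c⟩ | r
  · simp only [phiP, resP, actP, Sum.elim_inl, numP, eval_detP, map_sum, map_mul, eval_adjP,
      MvPolynomial.eval_X, Matrix.inv_def, Ring.inverse_eq_inv',
      Matrix.smul_apply, Matrix.mul_apply, matP, Matrix.of_apply, smul_eq_mul, div_eq_inv_mul,
      Finset.mul_sum, mul_assoc]
  · simp only [phiP, resP, actP, Sum.elim_inr, numP, eval_detP, map_sum, map_mul, eval_adjP,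
      MvPolynomial.eval_X, Matrix.inv_def, Ring.inverse_eq_inv',
      Matrix.smul_apply, Matrix.mulVec, dotProduct, vecP, smul_eq_mul, div_eq_inv_mul,
      Finset.mul_sum, mul_assoc]

/-- the saturated set over `Y` -/
def QSet {n k : ℕ} (e : Fin k → Fin n) (Y : Set (FreeIdx e → ℂ)) : Set (PIdx n k → ℂ) :=
  {p | (mnr e p).det ≠ 0 ∧ phiP e p ∈ Y}

theorem QSet_constr {n k : ℕ} (e : Fin k → Fin n) {Y : Set (FreeIdx e → ℂ)}
    (hY : IsConstructibleSet Y) : IsConstructibleSet (QSet e Y) := by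
  have := hY.preimage_rat (fun a : FreeIdx e => numP e a) (mnrMat e).det
  convert this using 1
  ext p
  simp only [QSet, Set.mem_ofPred_eq]
  rw [phiP_eq, eval_detP]

theorem contDiff_sec {n k : ℕ} (e : Fin k → Fin n) : ContDiff ℂ ω (sec e) :=
  contDiff_pi.2 fun a => contDiff_mvEval (secPoly e a)

theorem contDiff_act {n k : ℕ} (h : Matrix (Fin k) (Fin k) ℂ) :
    ContDiff ℂ ω (actP h : (PIdx n k → ℂ) → PIdx n k → ℂ) := by
  refine contDiff_pi.2 fun a => ?_
  rcases a with ⟨r, c⟩ | r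
  · simp only [actP, Sum.elim_inl, Matrix.mul_apply, matP, Matrix.of_apply]
    fun_prop
  · simp only [actP, Sum.elim_inr, Matrix.mulVec, dotProduct, vecP]
    fun_prop

theorem contDiffAt_phi {n k : ℕ} (e : Fin k → Fin n) {p : PIdx n k → ℂ}
    (hp : (mnr e p).det ≠ 0) : ContDiffAt ℂ ω (phiP e) p := by
  have : phiP e = fun p => fun a : FreeIdx e =>
      MvPolynomial.eval p (numP e a) / MvPolynomial.eval p (mnrMat e).det :=
    funext fun p => phiP_eq e p
  rw [this]
  refine contDiffAt_pi.2 fun a => ?_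
  refine ContDiffAt.div (contDiff_mvEval _).contDiffAt (contDiff_mvEval _).contDiffAt ?_
  rwa [eval_detP]

theorem isOpen_det {n k : ℕ} (e : Fin k → Fin n) :
    IsOpen {p : PIdx n k → ℂ | (mnr e p).det ≠ 0} := by
  have := isOpen_polyne (mnrMat e).det
  simpa only [eval_detP] using this

theorem fderiv_phi_surj {n k : ℕ} {e : Fin k → Fin n} (he : Function.Injective e)
    {p : PIdx n k → ℂ} (hp : (mnr e p).det ≠ 0) : Function.Surjective (fderiv ℂ (phiP e) p) := by
  let s : (FreeIdx e → ℂ) → PIdx n k → ℂ := fun y => actP (mnr e p) (sec e y)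
  have hs : ContDiff ℂ ω s := (contDiff_act _).comp (contDiff_sec e)
  have hsp : s (phiP e p) = p := sec_phi he hp
  have h1 : HasFDerivAt (phiP e) (fderiv ℂ (phiP e) p) (s (phiP e p)) := by
    rw [hsp]
    exact ((contDiffAt_phi e hp).differentiableAt (by simp)).hasFDerivAt
  have h2 : HasFDerivAt s (fderiv ℂ s (phiP e p)) (phiP e p) :=
    (hs.differentiable (by simp) _).hasFDerivAt
  have h3 := h1.comp _ h2
  have h4 : phiP e ∘ s = id := funext fun y => phi_act_sec he hp y
  rw [h4] at h3
  have h5 := h3.unique (hasFDerivAt_id _)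
  intro v
  exact ⟨fderiv ℂ s (phiP e p) v, by
    rw [← ContinuousLinearMap.comp_apply, h5]; rfl⟩

theorem QSet_sub {n k : ℕ} {e : Fin k → Fin n} (he : Function.Injective e)
    {Y : Set (FreeIdx e → ℂ)} (hY : IsCplxSub Y) : IsCplxSub (QSet e Y) := by
  intro p hp
  obtain ⟨J, fJ, U, f, hU, hxU, hf, hs, hS⟩ := hY _ hp.2
  have hcont : ContinuousOn (phiP e) {p : PIdx n k → ℂ | (mnr e p).det ≠ 0} := fun q hq =>
    (contDiffAt_phi e hq).continuousAt.continuousWithinAt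
  refine ⟨J, fJ, {p | (mnr e p).det ≠ 0} ∩ phiP e ⁻¹' U, fun q => f (phiP e q),
    hcont.isOpen_inter_preimage (isOpen_det e) hU, ⟨hp.1, hxU⟩, ?_, ?_, ?_⟩
  · intro q hq
    have h1 : ContDiffAt ℂ ω f (phiP e q) := hf.contDiffAt (hU.mem_nhds hq.2)
    exact (h1.comp q (contDiffAt_phi e hq.1)).contDiffWithinAt
  · intro q hq
    have h1 : DifferentiableAt ℂ f (phiP e q) :=
      (hf.contDiffAt (hU.mem_nhds hq.2)).differentiableAt (by simp)
    have h2 : DifferentiableAt ℂ (phiP e) q := (contDiffAt_phi e hq.1).differentiableAt (by simp)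
    have h3 : fderiv ℂ (fun q => f (phiP e q)) q =
        (fderiv ℂ f (phiP e q)).comp (fderiv ℂ (phiP e) q) := fderiv_comp q h1 h2
    rw [h3]
    exact (hs _ hq.2).comp (fderiv_phi_surj he hq.1)
  · ext q
    have h1 := Set.ext_iff.1 hS (phiP e q)
    simp only [Set.mem_inter_iff, Set.mem_ofPred_eq] at h1
    simp only [QSet, Set.mem_inter_iff, Set.mem_ofPred_eq, Set.mem_preimage]
    tauto

theorem QSet_conn {n k : ℕ} {e : Fin k → Fin n} (he : Function.Injective e)
    {Y : Set (FreeIdx e → ℂ)} (hY : IsConnected Y) : IsConnected (QSet e Y) := by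
  let D : MvPolynomial (Fin k × Fin k) ℂ :=
    (Matrix.of fun r c => MvPolynomial.X (r, c) : Matrix (Fin k) (Fin k) _).det
  have hD : ∀ z, MvPolynomial.eval z D = (Matrix.of fun r c => z (r, c) : Matrix (Fin k) (Fin k) ℂ).det := by
    intro z
    rw [RingHom.map_det]
    congr 1
    ext r c
    simp
  have h1 : IsConnected {z : Fin k × Fin k → ℂ | MvPolynomial.eval z D ≠ 0} := by
    refine ⟨⟨fun rc => (1 : Matrix (Fin k) (Fin k) ℂ) rc.1 rc.2, ?_⟩, isPreconnected_ne D⟩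
    rw [Set.mem_ofPred_eq, hD]
    have : (Matrix.of fun r c => (1 : Matrix (Fin k) (Fin k) ℂ) r c) = 1 := rfl
    simp only [this, Matrix.det_one]
    exact one_ne_zero
  let G : (Fin k × Fin k → ℂ) × (FreeIdx e → ℂ) → PIdx n k → ℂ := fun x =>
    actP (Matrix.of fun r c => x.1 (r, c)) (sec e x.2)
  have hG : Continuous G := by
    have hsec : Continuous (sec e) := (contDiff_sec e).continuous
    refine continuous_pi fun a => ?_
    rcases a with ⟨r, c⟩ | r
    · simp only [G, actP, Sum.elim_inl, Matrix.mul_apply, matP, Matrix.of_apply]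
      fun_prop
    · simp only [G, actP, Sum.elim_inr, Matrix.mulVec, dotProduct, vecP, Matrix.of_apply]
      fun_prop
  have h2 := (h1.prod hY).image G hG.continuousOn
  convert h2 using 1
  ext p
  constructor
  · intro hp
    refine ⟨(fun rc => mnr e p rc.1 rc.2, phiP e p), ⟨?_, hp.2⟩, sec_phi he hp.1⟩
    rw [Set.mem_ofPred_eq, hD]
    exact hp.1
  · rintro ⟨⟨z, y⟩, ⟨hz, hy⟩, rfl⟩
    rw [Set.mem_ofPred_eq, hD] at hz
    refine ⟨?_, ?_⟩
    · rw [mnr_act_sec he]; exact hz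
    · rw [phi_act_sec he hz]; exact hy

theorem dirP_phi {n k : ℕ} {e : Fin k → Fin n} (he : Function.Injective e)
    {p : PIdx n k → ℂ} (hp : (mnr e p).det ≠ 0) : dirP (sec e (phiP e p)) = dirP p := by
  rw [← dirP_actP hp, sec_phi he hp]

theorem QSet_span {n k : ℕ} {e : Fin k → Fin n} (he : Function.Injective e)
    {Y : Set (FreeIdx e → ℂ)} (hY : NeatSet Y) (V : Set (PIdx n k → ℂ)) (hV : IsOpen V)
    (hne : (QSet e Y ∩ V).Nonempty) : dirSpanC (QSet e Y ∩ V) = dirSpanC (QSet e Y) := by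
  apply le_antisymm
  · exact biSup_mono fun p hp => hp.1
  obtain ⟨p0, hp0, hp0V⟩ := hne
  let s : (FreeIdx e → ℂ) → PIdx n k → ℂ := fun y => actP (mnr e p0) (sec e y)
  have hs : Continuous s := ((contDiff_act _).comp (contDiff_sec e)).continuous
  have hsp : s (phiP e p0) = p0 := sec_phi he hp0.1
  refine iSup₂_le fun p1 hp1 v hv => ?_
  rw [← dirP_phi he hp1.1] at hv
  rw [← Subspace.forall_mem_dualAnnihilator_apply_eq_zero_iff]
  intro l hl
  -- the polynomial
  let q : MvPolynomial (FreeIdx e) ℂ :=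
    MvPolynomial.C (l v) - ∑ r : Fin k, (∑ c : Fin n, secPoly e (Sum.inl (r, c)) * MvPolynomial.C (v c)) *
      MvPolynomial.C (l ((Einc e).col r))
  have hq : ∀ y, MvPolynomial.eval y q =
      l (v - (Einc e).mulVec ((matP (sec e y)).mulVec v)) := by
    intro y
    rw [map_sub]
    have : (Einc e).mulVec ((matP (sec e y)).mulVec v) =
        ∑ r, ((matP (sec e y)).mulVec v) r • (Einc e).col r := by
      funext c
      simp only [Matrix.mulVec, dotProduct, Finset.sum_apply, Pi.smul_apply, Matrix.col_apply,
        smul_eq_mul]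
      exact Finset.sum_congr rfl fun r _ => mul_comm _ _
    rw [this, map_sum]
    simp only [q, map_sub, map_sum, map_mul, MvPolynomial.eval_C, map_smul, smul_eq_mul,
      Matrix.mulVec, dotProduct, matP, Matrix.of_apply, sec]
  have h0 := hY.ident (s ⁻¹' V) (hV.preimage hs) ⟨phiP e p0, hp0.2, by
    rw [Set.mem_preimage, hsp]; exact hp0V⟩ q (by
    rintro y ⟨hy, hyV⟩
    rw [hq]
    refine (Submodule.mem_dualAnnihilator l).1 hl _ ?_
    have hmem : s y ∈ QSet e Y ∩ V := by
      refine ⟨⟨?_, ?_⟩, hyV⟩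
      · rw [mnr_act_sec he]; exact hp0.1
      · rw [phi_act_sec he hp0.1]; exact hy
    refine (le_iSup₂_of_le (s y) hmem le_rfl : dirP (s y) ≤ _) ?_
    rw [dirP_actP hp0.1, dirP, LinearMap.mem_ker, Matrix.mulVecLin_apply, Matrix.mulVec_sub,
      Matrix.mulVec_mulVec, mul_Einc, mnr_sec he, Matrix.one_mulVec, sub_self]) _ hp1.2
  rw [hq] at h0
  rw [dirP, LinearMap.mem_ker, Matrix.mulVecLin_apply] at hv
  rw [hv, Matrix.mulVec_zero, sub_zero] at h0
  exact h0

/-- family of flats over `Y` -/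
def FSet {n k : ℕ} (e : Fin k → Fin n) (Y : Set (FreeIdx e → ℂ)) : Set (Set (Fin n → ℂ)) :=
  (fun y => flatP (sec e y)) '' Y

theorem det_sec {n k : ℕ} {e : Fin k → Fin n} (he : Function.Injective e) (y : FreeIdx e → ℂ) :
    (mnr e (sec e y)).det ≠ 0 := by
  rw [mnr_sec he, Matrix.det_one]; exact one_ne_zero

theorem flatP_phi {n k : ℕ} {e : Fin k → Fin n} (he : Function.Injective e)
    {p : PIdx n k → ℂ} (hp : (mnr e p).det ≠ 0) : flatP (sec e (phiP e p)) = flatP p := by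
  rw [← flatP_actP hp, sec_phi he hp]

theorem pre_FSet {n i : ℕ} {e : Fin (n - i) → Fin n} (he : Function.Injective e)
    (Y : Set (FreeIdx e → ℂ)) : pre n i (FSet e Y) = QSet e Y := by
  ext p
  constructor
  · rintro ⟨hp, y, hy, h⟩
    obtain ⟨h1, h2⟩ := flat_unique he hp h.symm
    exact ⟨h1, h2 ▸ hy⟩
  · rintro ⟨h1, h2⟩
    exact ⟨mem_paramSet_of_det h1, phiP e p, h2, flatP_phi he h1⟩

theorem FSet_neat {n i : ℕ} {e : Fin (n - i) → Fin n} (he : Function.Injective e)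
    {Y : Set (FreeIdx e → ℂ)} (hY : NeatSet Y) : IsNeatFamilyC n i (FSet e Y) := by
  unfold IsNeatFamilyC
  rw [pre_FSet he]
  refine ⟨?_, QSet_constr e hY.constr, QSet_conn he hY.conn, (QSet_sub he hY.sub).real,
    QSet_span he hY⟩
  rintro _ ⟨y, hy, rfl⟩
  exact ⟨sec e y, mem_paramSet_of_det (det_sec he y), rfl⟩

theorem stmt12_aux {n i : ℕ} (T : Set (Set (Fin n → ℂ)))
    (hT : T ⊆ grAffC n i) (hTc : IsConstructibleSet (pre n i T)) :
    ∃ (m : ℕ) (F : Fin m → Set (Set (Fin n → ℂ))),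
      T = (⋃ a, F a) ∧ ∀ a, IsNeatFamilyC n i (F a) := by
  have hd : ∀ e : Fin (n - i) → Fin n, FinNeat {y : FreeIdx e → ℂ | sec e y ∈ pre n i T} :=
    fun e => decomp (hTc.preimage_poly (secPoly e))
  choose 𝒴 hfin hneat hun using hd
  let 𝓕 : Set (Set (Set (Fin n → ℂ))) :=
    ⋃ e : {e : Fin (n - i) → Fin n // Function.Injective e}, FSet e.1 '' 𝒴 e.1
  have h𝓕 : 𝓕.Finite := Set.finite_iUnion fun e => (hfin e.1).image _
  have hTU : T = ⋃₀ 𝓕 := by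
    ext A
    constructor
    · intro hA
      obtain ⟨p, hp, rfl⟩ := hT hA
      obtain ⟨e, he, hdet⟩ := exists_minor hp
      have h1 : phiP e p ∈ {y : FreeIdx e → ℂ | sec e y ∈ pre n i T} :=
        ⟨mem_paramSet_of_det (det_sec he _), by rw [flatP_phi he hdet]; exact hA⟩
      rw [hun e] at h1
      obtain ⟨Y, hY, hpY⟩ := h1
      exact ⟨FSet e Y, Set.mem_iUnion.2 ⟨⟨e, he⟩, Y, hY, rfl⟩, phiP e p, hpY, flatP_phi he hdet⟩
    · rintro ⟨_, hF, hA⟩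
      obtain ⟨⟨e, he⟩, Y, hY, rfl⟩ := Set.mem_iUnion.1 hF
      obtain ⟨y, hy, rfl⟩ := hA
      have h1 : y ∈ {y : FreeIdx e → ℂ | sec e y ∈ pre n i T} := by
        rw [hun e]; exact ⟨Y, hY, hy⟩
      exact h1.2
  have : Finite 𝓕 := h𝓕
  let E := Finite.equivFin 𝓕
  refine ⟨Nat.card 𝓕, fun a => (E.symm a).1, ?_, ?_⟩
  · rw [hTU, Set.sUnion_eq_iUnion]
    exact (E.symm.surjective.iUnion_comp fun x : 𝓕 => x.1).symm
  · intro a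
    obtain ⟨⟨e, he⟩, Y, hY, h⟩ := Set.mem_iUnion.1 (E.symm a).2
    show IsNeatFamilyC n i (E.symm a).1
    rw [← h]
    exact FSet_neat he (hneat e Y hY)
end

/-- Every constructible subset `T` of the complex affine Grassmannian
`GrAff_i^ℂ(ℂ^n)` can be written as a finite union of neat families. -/
theorem stmt12 {n i : ℕ} (hi : i ≤ n) (T : Set (Set (Fin n → ℂ)))
    (hT : T ⊆ grAffC n i) (hTc : IsConstructibleSet (pre n i T)) :
    ∃ (m : ℕ) (F : Fin m → Set (Set (Fin n → ℂ))),
      T = (⋃ a, F a) ∧ ∀ a, IsNeatFamilyC n i (F a) := by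
  exact stmt12_aux T hT hTc
end
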